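/- The set 𝔊₁₅ of isometry classes of unimodular hermitian 𝓞-lattices of rank 15 is finite, and the mass M₁₅ = Σ_{L ∈ 𝔊₁₅} 1/|G(L)|, where G(L) is the automorphism group of L, equals 4366489808207046403 / (2²⁶·3²¹·5³·11). -/

import Mathlib

noncomputable section
open Matrix Complex
open scoped ComplexOrder

/-- A primitive cube root of unity in `ℂ`. -/
def ω : ℂ := ⟨-1/2, Real.sqrt 3 / 2⟩

/-- The ring of Eisenstein integers `𝓞 = ℤ[ω]`, the ring of integers of `ℚ(√-3)`,
realized as a subalgebra of `ℂ` (so that complex conjugation is available). -/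
def 𝓞 : Subalgebra ℤ ℂ := Algebra.adjoin ℤ {ω}

/-- All entries of the matrix are Eisenstein integers. -/
def EntriesIn {n : ℕ} (H : Matrix (Fin n) (Fin n) ℂ) : Prop := ∀ i j, H i j ∈ 𝓞

/-- `U ∈ GLₙ(𝓞)`: entries in `𝓞`, with a two-sided inverse having entries in `𝓞`. -/
def InGL {n : ℕ} (U : Matrix (Fin n) (Fin n) ℂ) : Prop :=
  EntriesIn U ∧ ∃ V : Matrix (Fin n) (Fin n) ℂ, EntriesIn V ∧ U * V = 1 ∧ V * U = 1

/-- `H` is the Gram matrix of a hermitian `𝓞`-lattice of rank `n`: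
entries in `𝓞`, equal to its conjugate transpose, positive definite as a complex matrix. -/
def IsHermLattice {n : ℕ} (H : Matrix (Fin n) (Fin n) ℂ) : Prop :=
  EntriesIn H ∧ H.IsHermitian ∧ H.PosDef

/-- A unimodular hermitian `𝓞`-lattice: discriminant `det H = 1`. -/
def IsUnimodular {n : ℕ} (H : Matrix (Fin n) (Fin n) ℂ) : Prop :=
  IsHermLattice H ∧ H.det = 1

/-- Isometry of lattices given by Gram matrices: `H' = U * H * U*` for some `U ∈ GLₙ(𝓞)`. -/
def LatIsometric {n : ℕ} (H H' : Matrix (Fin n) (Fin n) ℂ) : Prop :=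
  ∃ U : Matrix (Fin n) (Fin n) ℂ, InGL U ∧ H' = U * H * Uᴴ

/-- A lattice is decomposable if it is isometric to one whose Gram matrix is block
diagonal with two blocks of smaller positive size. -/
def Decomposable {n : ℕ} (H : Matrix (Fin n) (Fin n) ℂ) : Prop :=
  ∃ H' : Matrix (Fin n) (Fin n) ℂ, LatIsometric H H' ∧ ∃ k : ℕ, 0 < k ∧ k < n ∧
    ∀ i j : Fin n, (((i : ℕ) < k ∧ ¬ (j : ℕ) < k) ∨ (¬ (i : ℕ) < k ∧ (j : ℕ) < k)) → H' i j = 0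

/-- The norm `x* H x` of a vector. -/
def latNorm {n : ℕ} (H : Matrix (Fin n) (Fin n) ℂ) (x : Fin n → ℂ) : ℂ :=
  star x ⬝ᵥ H.mulVec x

/-- A vector of `𝓞ⁿ`. -/
def IsLatVec {n : ℕ} (x : Fin n → ℂ) : Prop := ∀ i, x i ∈ 𝓞

/-- A root: a lattice vector of norm 2. -/
def IsRoot {n : ℕ} (H : Matrix (Fin n) (Fin n) ℂ) (x : Fin n → ℂ) : Prop :=
  IsLatVec x ∧ latNorm H x = 2

/-- The lattice contains no roots. -/
def RootFree {n : ℕ} (H : Matrix (Fin n) (Fin n) ℂ) : Prop :=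
  ∀ x : Fin n → ℂ, ¬ IsRoot H x

/-- The minimal norm of the lattice is `3`. -/
def MinNormThree {n : ℕ} (H : Matrix (Fin n) (Fin n) ℂ) : Prop :=
  (∀ x : Fin n → ℂ, IsLatVec x → x ≠ 0 → 3 ≤ (latNorm H x).re) ∧
  (∃ x : Fin n → ℂ, IsLatVec x ∧ latNorm H x = 3)

/-- The order of the automorphism group `{U ∈ GLₙ(𝓞) : U H U* = H}` of the lattice. -/
def autCard {n : ℕ} (H : Matrix (Fin n) (Fin n) ℂ) : ℕ :=
  Nat.card {U : Matrix (Fin n) (Fin n) ℂ // InGL U ∧ U * H * Uᴴ = H}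

lemma ω_re : ω.re = -1 / 2 := rfl

lemma ω_im : ω.im = Real.sqrt 3 / 2 := rfl

lemma ω_sq : ω ^ 2 = -1 - ω := by
  have h : Real.sqrt 3 * Real.sqrt 3 = 3 := Real.mul_self_sqrt (by norm_num)
  apply Complex.ext
  · simp [pow_two, ω_re, ω_im]; linarith
  · simp [pow_two, ω_re, ω_im]; ring

lemma star_ω : star ω = -1 - ω := by
  apply Complex.ext <;> simp [ω_re, ω_im]; norm_num

lemma ω_mem : ω ∈ 𝓞 := Algebra.subset_adjoin rfl

lemma mem_eis_iff {z : ℂ} : z ∈ 𝓞 ↔ ∃ a b : ℤ, z = a + b * ω := by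
  constructor
  · intro h
    induction h using Algebra.adjoin_induction with
    | mem x hx => exact ⟨0, 1, by simp [Set.mem_singleton_iff.1 hx]⟩
    | algebraMap r => exact ⟨r, 0, by simp⟩
    | add x y _ _ hx hy =>
      obtain ⟨a, b, rfl⟩ := hx
      obtain ⟨c, d, rfl⟩ := hy
      exact ⟨a + c, b + d, by push_cast; ring⟩
    | mul x y _ _ hx hy =>
      obtain ⟨a, b, rfl⟩ := hx
      obtain ⟨c, d, rfl⟩ := hy
      exact ⟨a * c - b * d, a * d + b * c - b * d, by
        push_cast; linear_combination (b * d : ℂ) * ω_sq⟩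
  · rintro ⟨a, b, rfl⟩
    exact add_mem (intCast_mem _ a) (mul_mem (intCast_mem _ b) ω_mem)

/-- The Eisenstein integers as a type. -/
abbrev Eis : Type := ↥𝓞

namespace Eis

instance : StarRing Eis where
  star z := ⟨star (z : ℂ), by
    obtain ⟨a, b, h⟩ := mem_eis_iff.1 z.2
    refine mem_eis_iff.2 ⟨a - b, -b, ?_⟩
    rw [h]
    simp only [star_add, star_mul', star_ω, star_intCast]
    push_cast
    ring⟩
  star_involutive z := Subtype.ext (star_star (z : ℂ))
  star_mul x y := Subtype.ext (star_mul (x : ℂ) y)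
  star_add x y := Subtype.ext (star_add (x : ℂ) y)

@[simp, norm_cast] lemma coe_star (z : Eis) : ((star z : Eis) : ℂ) = star (z : ℂ) := rfl

/-- The Eisenstein integer `a + b ω`. -/
def mk (a b : ℤ) : Eis := ⟨a + b * ω, mem_eis_iff.2 ⟨a, b, rfl⟩⟩

@[simp] lemma coe_mk (a b : ℤ) : (mk a b : ℂ) = a + b * ω := rfl

lemma exists_eq_mk (z : Eis) : ∃ a b : ℤ, z = mk a b := by
  obtain ⟨a, b, h⟩ := mem_eis_iff.1 z.2
  exact ⟨a, b, Subtype.ext h⟩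

lemma mk_injective {a b c d : ℤ} (h : mk a b = mk c d) : a = c ∧ b = d := by
  have h' := congrArg (Subtype.val) h
  simp only [coe_mk] at h'
  have h3 : Real.sqrt 3 ≠ 0 := by positivity
  have him := congrArg Complex.im h'
  have hre := congrArg Complex.re h'
  simp [ω_re, ω_im] at him hre
  have hb : (b : ℝ) = d := by tauto
  rw [hb] at hre
  have ha : (a : ℝ) = c := by linarith
  exact ⟨by exact_mod_cast ha, by exact_mod_cast hb⟩

/-- Coordinates with respect to the basis `1, ω`. -/
def equivProd : ℤ × ℤ ≃ Eis :=
  Equiv.ofBijective (fun p => mk p.1 p.2)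
    ⟨fun _ _ h => Prod.ext (mk_injective h).1 (mk_injective h).2, fun z => by
      obtain ⟨a, b, h⟩ := exists_eq_mk z
      exact ⟨(a, b), h.symm⟩⟩

@[simp] lemma equivProd_apply (p : ℤ × ℤ) : equivProd p = mk p.1 p.2 := rfl

lemma mk_add (a b c d : ℤ) : mk a b + mk c d = mk (a + c) (b + d) :=
  Subtype.ext (by push_cast [coe_mk]; ring)

lemma mk_mul (a b c d : ℤ) :
    mk a b * mk c d = mk (a * c - b * d) (a * d + b * c - b * d) :=
  Subtype.ext (by push_cast [coe_mk]; linear_combination (b * d : ℂ) * ω_sq)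

lemma star_mk (a b : ℤ) : star (mk a b) = mk (a - b) (-b) :=
  Subtype.ext (by
    rw [coe_star, coe_mk, coe_mk]
    simp only [star_add, star_mul', star_ω, star_intCast]
    push_cast
    ring)

lemma intCast_eq_mk (a : ℤ) : (a : Eis) = mk a 0 := Subtype.ext (by simp)

lemma one_eq_mk : (1 : Eis) = mk 1 0 := Subtype.ext (by simp)

lemma zero_eq_mk : (0 : Eis) = mk 0 0 := Subtype.ext (by simp)

lemma coe_injective : Function.Injective (fun z : Eis => (z : ℂ)) := Subtype.val_injective

/-- The inclusion of the Eisenstein integers in the complex numbers. -/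
def toC : Eis →+* ℂ := 𝓞.subtype

@[simp] lemma toC_apply (z : Eis) : toC z = (z : ℂ) := rfl

lemma normSq_mk (a b : ℤ) : Complex.normSq (mk a b : ℂ) = a ^ 2 - a * b + b ^ 2 := by
  have h : Real.sqrt 3 * Real.sqrt 3 = 3 := Real.mul_self_sqrt (by norm_num)
  simp [Complex.normSq_apply, ω_re, ω_im]
  linear_combination (b ^ 2 / 4 : ℝ) * h

lemma one_le_normSq {z : Eis} (hz : z ≠ 0) : 1 ≤ Complex.normSq (z : ℂ) := by
  obtain ⟨a, b, rfl⟩ := exists_eq_mk z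
  have hpos : 0 < Complex.normSq (mk a b : ℂ) :=
    Complex.normSq_pos.2 fun h => hz (Subtype.ext h)
  rw [normSq_mk] at hpos ⊢
  have : (0 : ℤ) < a ^ 2 - a * b + b ^ 2 := by exact_mod_cast hpos
  exact_mod_cast this

lemma exists_normSq_sub_le (z : ℂ) : ∃ w : Eis, Complex.normSq (z - w) ≤ 7 / 16 := by
  have h3 : Real.sqrt 3 * Real.sqrt 3 = 3 := Real.mul_self_sqrt (by norm_num)
  have h30 : Real.sqrt 3 ≠ 0 := by positivity
  set b : ℤ := round (z.im * 2 / Real.sqrt 3)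
  set a : ℤ := round (z.re + b / 2)
  refine ⟨mk a b, ?_⟩
  have hb := abs_le.1 (abs_sub_round (z.im * 2 / Real.sqrt 3))
  have ha := abs_le.1 (abs_sub_round (z.re + b / 2))
  rw [Complex.normSq_apply]
  simp only [coe_mk, Complex.sub_re, Complex.sub_im, Complex.add_re, Complex.add_im,
    Complex.mul_re, Complex.mul_im, Complex.intCast_re, Complex.intCast_im, ω_re, ω_im]
  set s : ℝ := z.im * 2 / Real.sqrt 3 - b with hs
  set t : ℝ := z.re + b / 2 - a with ht
  have him : z.im = (s + b) * Real.sqrt 3 / 2 := by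
    rw [hs]; field_simp; ring
  have hre : z.re = t - b / 2 + a := by rw [ht]; ring
  rw [him, hre]
  have hs2 : s * s ≤ 1 / 4 := by nlinarith
  have ht2 : t * t ≤ 1 / 4 := by nlinarith
  nlinarith

lemma finite_normSq_le (C : ℝ) : {z : Eis | Complex.normSq (z : ℂ) ≤ C}.Finite := by
  set N : ℤ := ⌈4 * |C| + 1⌉
  refine ((Set.finite_Icc (-N) N).prod (Set.finite_Icc (-N) N)).image
    (fun p : ℤ × ℤ => mk p.1 p.2) |>.subset ?_
  intro z hz
  obtain ⟨a, b, rfl⟩ := exists_eq_mk z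
  simp only [Set.mem_ofPred_eq, normSq_mk] at hz
  have hN : 4 * |C| + 1 ≤ (N : ℝ) := Int.le_ceil _
  have hC := le_abs_self C
  have ha : (a : ℝ) ^ 2 ≤ 4 * |C| := by nlinarith [sq_nonneg ((a : ℝ) - 2 * b), sq_nonneg (a : ℝ)]
  have hb : (b : ℝ) ^ 2 ≤ 4 * |C| := by nlinarith [sq_nonneg ((b : ℝ) - 2 * a), sq_nonneg (b : ℝ)]
  have key : ∀ c : ℤ, (c : ℝ) ^ 2 ≤ 4 * |C| → c ∈ Set.Icc (-N) N := by
    intro c hc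
    have h1 : |(c : ℝ)| ≤ N := by
      have := sq_abs (c : ℝ)
      nlinarith [abs_nonneg (c : ℝ), sq_nonneg (|(c : ℝ)| - 1)]
    rw [abs_le] at h1
    exact ⟨by exact_mod_cast h1.1, by exact_mod_cast h1.2⟩
  exact ⟨(a, b), ⟨key a ha, key b hb⟩, rfl⟩

instance : IsPrincipalIdealRing Eis where
  principal I := by
    classical
    by_cases hI : I = ⊥
    · subst hI; infer_instance
    obtain ⟨x, hxI, hx0⟩ := Submodule.exists_mem_ne_zero_of_ne_bot hI
    have hfin : ({z : Eis | Complex.normSq (z : ℂ) ≤ Complex.normSq (x : ℂ)} ∩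
        {z | z ∈ I ∧ z ≠ 0}).Finite := (finite_normSq_le _).inter_of_left _
    obtain ⟨d, hd, hmin⟩ := Set.exists_min_image _ (fun z : Eis => Complex.normSq (z : ℂ)) hfin
      ⟨x, by simp, hxI, hx0⟩
    obtain ⟨hdx, hdI, hd0⟩ := hd
    refine ⟨⟨d, le_antisymm ?_ ?_⟩⟩
    · intro y hy
      have hdc : (d : ℂ) ≠ 0 := fun h => hd0 (Subtype.ext h)
      obtain ⟨w, hw⟩ := exists_normSq_sub_le ((y : ℂ) / d)
      have hr : y - w * d ∈ I := I.sub_mem hy (I.mul_mem_left w hdI)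
      have hval : Complex.normSq ((y - w * d : Eis) : ℂ) ≤ 7 / 16 * Complex.normSq (d : ℂ) := by
        have : ((y - w * d : Eis) : ℂ) = ((y : ℂ) / d - w) * d := by
          push_cast; field_simp
        rw [this, Complex.normSq_mul]
        exact mul_le_mul_of_nonneg_right hw (Complex.normSq_nonneg _)
      have hdpos : 0 < Complex.normSq (d : ℂ) := Complex.normSq_pos.2 hdc
      have hz : y - w * d = 0 := by
        by_contra hne
        have hdx' : Complex.normSq (d : ℂ) ≤ Complex.normSq (x : ℂ) := hdx
        have := hmin (y - w * d) ⟨by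
          change Complex.normSq ((y - w * d : Eis) : ℂ) ≤ _
          linarith, hr, hne⟩
        linarith
      rw [sub_eq_zero] at hz
      exact Submodule.mem_span_singleton.2 ⟨w, by rw [hz, smul_eq_mul]⟩
    · rw [Submodule.span_singleton_le_iff_mem]
      exact hdI

/-- Reduction modulo the prime `√-3`. -/
def res : Eis →+* ZMod 3 where
  toFun z := ((equivProd.symm z).1 + (equivProd.symm z).2 : ℤ)
  map_one' := by
    rw [show (1 : Eis) = equivProd (1, 0) from one_eq_mk, Equiv.symm_apply_apply]; simp
  map_zero' := by
    rw [show (0 : Eis) = equivProd (0, 0) from zero_eq_mk, Equiv.symm_apply_apply]; simp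
  map_add' x y := by
    obtain ⟨⟨a, b⟩, rfl⟩ := equivProd.surjective x
    obtain ⟨⟨c, d⟩, rfl⟩ := equivProd.surjective y
    rw [show equivProd (a, b) + equivProd (c, d) = equivProd (a + c, b + d) from mk_add a b c d]
    simp only [Equiv.symm_apply_apply]
    push_cast
    ring
  map_mul' x y := by
    obtain ⟨⟨a, b⟩, rfl⟩ := equivProd.surjective x
    obtain ⟨⟨c, d⟩, rfl⟩ := equivProd.surjective y
    rw [show equivProd (a, b) * equivProd (c, d)
      = equivProd (a * c - b * d, a * d + b * c - b * d) from mk_mul a b c d]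
    simp only [Equiv.symm_apply_apply]
    push_cast
    have h3 : (3 : ZMod 3) = 0 := by decide
    linear_combination (-(b : ZMod 3) * d) * h3

lemma res_mk (a b : ℤ) : res (mk a b) = (a : ZMod 3) + b := by
  change (((equivProd.symm (equivProd (a, b))).1 + (equivProd.symm (equivProd (a, b))).2 : ℤ) :
    ZMod 3) = _
  rw [Equiv.symm_apply_apply]
  push_cast
  rfl

lemma res_star (z : Eis) : res (star z) = res z := by
  obtain ⟨a, b, rfl⟩ := exists_eq_mk z
  rw [star_mk, res_mk, res_mk]
  push_cast
  have h3 : (3 : ZMod 3) = 0 := by decide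
  linear_combination (-(b : ZMod 3)) * h3

lemma res_intCast (a : ℤ) : res (a : Eis) = a := map_intCast res a

lemma res_surjective : Function.Surjective res := fun x =>
  ⟨((x.val : ℤ) : Eis), by rw [res_intCast]; simp⟩

/-- The element `√-3 = 1 + 2ω`. -/
def root : Eis := mk 1 2

lemma star_root : star root = -root := by
  rw [root, star_mk]
  exact Subtype.ext (by push_cast [coe_mk]; ring)

lemma root_mul_root : root * root = -3 :=
  Subtype.ext (by
    rw [root, mk_mul]
    push_cast [coe_mk]
    simp [show ((3 : Eis) : ℂ) = 3 from rfl])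

lemma root_mul_star_root : root * star root = 3 := by
  rw [star_root, mul_neg, root_mul_root, neg_neg]

lemma root_ne_zero : root ≠ 0 := by
  intro h
  have := root_mul_root
  rw [h] at this
  have h2 := congrArg (fun z : Eis => (z : ℂ)) this
  norm_num at h2

lemma res_root : res root = 0 := by
  rw [root, res_mk]; decide

lemma res_eq_zero_iff {z : Eis} : res z = 0 ↔ ∃ w, z = root * w := by
  constructor
  · obtain ⟨a, b, rfl⟩ := exists_eq_mk z
    rw [res_mk]
    intro h
    have h' : ((a + b : ℤ) : ZMod 3) = 0 := by push_cast; exact h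
    rw [ZMod.intCast_zmod_eq_zero_iff_dvd] at h'
    obtain ⟨c, hc⟩ := h'
    push_cast at hc
    refine ⟨mk (b - c) (b - 2 * c), ?_⟩
    rw [root, mk_mul]
    congr 1 <;> linarith
  · rintro ⟨w, rfl⟩
    rw [map_mul, res_root, zero_mul]

end Eis

open Real in
lemma jacobi_shift {σ : ℂ} (hσ : 0 < σ.im) (u v : ℝ) :
    ∑' a : ℤ, cexp (π * I * σ * (a + u) ^ 2 + 2 * π * I * a * v) =
      1 / (-I * σ) ^ (1 / 2 : ℂ) *
        ∑' k : ℤ, cexp (-π * I * (k - v) ^ 2 / σ + 2 * π * I * u * (k - v)) := by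
  have hσ0 : σ ≠ 0 := fun h => by simp [h] at hσ
  have key := jacobiTheta₂_functional_equation (σ * u + v) σ
  simp only [jacobiTheta₂, jacobiTheta₂_term] at key
  have h1 : ∀ a : ℤ, cexp (π * I * σ * (a + u) ^ 2 + 2 * π * I * a * v) =
      cexp (π * I * σ * u ^ 2) * cexp (2 * π * I * a * (σ * u + v) + π * I * a ^ 2 * σ) := by
    intro a
    rw [← Complex.exp_add]; congr 1; ring
  have h2 : ∀ k : ℤ, cexp (-π * I * (k - v) ^ 2 / σ + 2 * π * I * u * (k - v)) =
      cexp (π * I * σ * u ^ 2) * cexp (-π * I * (σ * u + v) ^ 2 / σ) *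
        cexp (2 * π * I * k * ((σ * u + v) / σ) + π * I * k ^ 2 * (-1 / σ)) := by
    intro k
    rw [← Complex.exp_add, ← Complex.exp_add]; congr 1; field_simp; ring
  simp_rw [h1, h2, tsum_mul_left]
  rw [key]
  ring

lemma summable_int_gauss {c : ℝ} (hc : 0 < c) :
    Summable fun a : ℤ => Real.exp (-c * (a : ℝ) ^ 2) := by
  have h := (summable_jacobiTheta₂_term_iff 0 (I * (c / Real.pi : ℝ))).2 (by
    simp; positivity)
  refine h.norm.congr fun a => ?_
  rw [norm_jacobiTheta₂_term]
  congr 1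
  have := Real.pi_ne_zero
  simp
  field_simp

lemma exp_gauss_shift_le {c : ℝ} (hc : 0 < c) (x s : ℂ) :
    Real.exp (-c * Complex.normSq (x + s)) ≤
      Real.exp (c * Complex.normSq s) * Real.exp (-(c / 2) * Complex.normSq x) := by
  rw [← Real.exp_add, Real.exp_le_exp]
  simp only [Complex.normSq_apply, Complex.add_re, Complex.add_im]
  nlinarith [mul_nonneg hc.le (sq_nonneg (x.re + 2 * s.re)),
    mul_nonneg hc.le (sq_nonneg (x.im + 2 * s.im))]

lemma summable_eis_gauss {c : ℝ} (hc : 0 < c) (s : ℂ) :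
    Summable fun x : Eis => Real.exp (-c * Complex.normSq ((x : ℂ) + s)) := by
  have h := (summable_int_gauss (c := c / 4) (by positivity)).mul_of_nonneg
    (summable_int_gauss (c := c / 4) (by positivity)) (fun _ => (Real.exp_pos _).le)
    (fun _ => (Real.exp_pos _).le)
  rw [← Eis.equivProd.summable_iff]
  refine Summable.of_nonneg_of_le (fun _ => (Real.exp_pos _).le) (fun p => ?_)
    (h.mul_left (Real.exp (c * Complex.normSq s)))
  refine (exp_gauss_shift_le hc _ s).trans ?_
  refine mul_le_mul_of_nonneg_left ?_ (Real.exp_pos _).le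
  rw [← Real.exp_add, Real.exp_le_exp, Eis.equivProd_apply, Eis.normSq_mk]
  nlinarith [mul_nonneg hc.le (sq_nonneg ((p.1 : ℝ) - p.2))]

lemma summable_int_gauss_shift {c : ℝ} (hc : 0 < c) (u : ℝ) :
    Summable fun a : ℤ => Real.exp (-c * ((a : ℝ) + u) ^ 2) := by
  refine Summable.of_nonneg_of_le (fun _ => (Real.exp_pos _).le) (fun a => ?_)
    ((summable_int_gauss (c := c / 2) (by positivity)).mul_left (Real.exp (c * u ^ 2)))
  rw [← Real.exp_add, Real.exp_le_exp]
  nlinarith [mul_nonneg hc.le (sq_nonneg ((a : ℝ) + 2 * u))]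

/-- The exponential `exp (2πi (τ A + B))`. -/
def gTerm (τ : ℂ) (A B : ℝ) : ℂ := cexp (2 * Real.pi * I * (τ * A + B))

lemma gTerm_mul (τ : ℂ) (A B A' B' : ℝ) :
    gTerm τ A B * gTerm τ A' B' = gTerm τ (A + A') (B + B') := by
  rw [gTerm, gTerm, gTerm, ← Complex.exp_add]
  congr 1
  push_cast
  ring

lemma norm_gTerm (τ : ℂ) (A B : ℝ) : ‖gTerm τ A B‖ = Real.exp (-(2 * Real.pi * τ.im) * A) := by
  rw [gTerm, Complex.norm_exp]
  congr 1
  have : (2 * Real.pi * I * (τ * A + B) : ℂ) =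
     ((2 * Real.pi * A : ℝ) : ℂ) * (I * τ) + ((2 * Real.pi * B : ℝ) : ℂ) * I := by
    push_cast; ring
  rw [this, Complex.add_re, Complex.re_ofReal_mul, Complex.re_ofReal_mul]
  simp
  ring

lemma im_neg_inv_pos {τ : ℂ} (hτ : 0 < τ.im) : 0 < (-1 / τ).im := by
  have h0 : τ ≠ 0 := fun h => by simp [h] at hτ
  rw [neg_div, one_div, Complex.neg_im, Complex.inv_im, neg_div, neg_neg]
  exact div_pos hτ (Complex.normSq_pos.2 h0)

lemma sqrt_real_mul {r : ℝ} (hr : 0 < r) {w : ℂ} (hw : w ≠ 0) :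
    (r * w) ^ (1 / 2 : ℂ) = Real.sqrt r * w ^ (1 / 2 : ℂ) := by
  have hr0 : (r : ℂ) ≠ 0 := by exact_mod_cast hr.ne'
  rw [Complex.cpow_def_of_ne_zero (mul_ne_zero hr0 hw), Complex.log_ofReal_mul hr hw, add_mul,
    Complex.exp_add, Complex.cpow_def_of_ne_zero hw]
  congr 1
  rw [Real.sqrt_eq_rpow, Complex.ofReal_cpow hr.le, Complex.cpow_def_of_ne_zero hr0,
    Complex.ofReal_log hr.le]
  norm_num

lemma int_poisson {τ : ℂ} (hτ : 0 < τ.im) {c : ℝ} (hc : 0 < c) (u v : ℝ) :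
    ∑' a : ℤ, gTerm τ (c * (a + u) ^ 2) (a * v) =
      (1 / (Real.sqrt (2 * c) * (-I * τ) ^ (1 / 2 : ℂ))) *
        ∑' k : ℤ, gTerm (-1 / τ) ((k - v) ^ 2 / (4 * c)) (u * (k - v)) := by
  have h0 : τ ≠ 0 := fun h => by simp [h] at hτ
  have hc0 : (c : ℂ) ≠ 0 := by exact_mod_cast hc.ne'
  have hσ : 0 < (((2 * c : ℝ) : ℂ) * τ).im := by
    rw [Complex.im_ofReal_mul]; positivity
  have key := jacobi_shift hσ u v
  have hw : -I * τ ≠ 0 := mul_ne_zero (neg_ne_zero.2 I_ne_zero) h0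
  rw [show -I * (((2 * c : ℝ) : ℂ) * τ) = ((2 * c : ℝ) : ℂ) * (-I * τ) by ring,
    sqrt_real_mul (by positivity) hw] at key
  convert key using 3
  · rename_i a
    rw [gTerm]
    congr 1
    push_cast
    ring
  · funext k
    rw [gTerm]
    congr 1
    push_cast
    field_simp
    ring

lemma summable_gTerm_mul {ι κ : Type*} {f : ι → ℂ} {g : κ → ℂ} {F : ι × κ → ℂ}
    (hf : Summable fun i => ‖f i‖) (hg : Summable fun i => ‖g i‖)
    (h : ∀ p, ‖F p‖ = ‖f p.1‖ * ‖g p.2‖) : Summable F := by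
  refine Summable.of_norm ?_
  simp_rw [h]
  exact hf.mul_of_nonneg hg (fun _ => norm_nonneg _) (fun _ => norm_nonneg _)

lemma summable_norm_gTerm_int {τ : ℂ} (hτ : 0 < τ.im) {c : ℝ} (hc : 0 < c) (u : ℝ) (B : ℤ → ℝ) :
    Summable fun a : ℤ => ‖gTerm τ (c * (a + u) ^ 2) (B a)‖ := by
  refine (summable_int_gauss_shift (c := 2 * Real.pi * τ.im * c) (by positivity) u).congr
    fun a => ?_
  rw [norm_gTerm]
  congr 1
  ring

lemma summable_norm_gTerm_eis {τ : ℂ} (hτ : 0 < τ.im) {c : ℝ} (hc : 0 < c) (s : ℂ)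
    (B : Eis → ℝ) :
    Summable fun a : Eis => ‖gTerm τ (c * Complex.normSq (a + s)) (B a)‖ := by
  refine (summable_eis_gauss (c := 2 * Real.pi * τ.im * c) (by positivity) s).congr
    fun a => ?_
  rw [norm_gTerm]
  congr 1
  ring

namespace Eis

lemma coe_root : (root : ℂ) = Real.sqrt 3 * I := by
  rw [root, coe_mk]
  apply Complex.ext
  · simp [ω_re, ω_im]; norm_num
  · simp [ω_re, ω_im]; ring

lemma star_mk_div_root (k l : ℤ) :
    star ((mk (-l) k : Eis) : ℂ) / root = ⟨-k / 2, (l + k / 2) / Real.sqrt 3⟩ := by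
  have h3 : Real.sqrt 3 * Real.sqrt 3 = 3 := Real.mul_self_sqrt (by norm_num)
  have h30 : Real.sqrt 3 ≠ 0 := by positivity
  have h30' : (Real.sqrt 3 : ℂ) * I ≠ 0 := by simp
  rw [coe_root, div_eq_iff h30', coe_mk]
  apply Complex.ext
  · simp [ω_re, ω_im]; field_simp; ring
  · simp [ω_re, ω_im]; ring

/-- Poisson summation for shifted Gaussians on the Eisenstein integers. -/
theorem poisson {q : ℝ} (hq : 0 < q) : ∃ C : ℝ, 0 < C ∧ ∀ τ : ℂ, 0 < τ.im → ∀ s z : ℂ,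
    ∑' x : Eis, gTerm τ (q * Complex.normSq (x + s)) (2 * (x * z : ℂ).re) =
      C / (-I * τ) * ∑' y : Eis, gTerm (-1 / τ) (Complex.normSq (star (y : ℂ) / root + z) / q)
        (-2 * (s * (star (y : ℂ) / root + z)).re) := by
  refine ⟨1 / (Real.sqrt (2 * q) * Real.sqrt (2 * (3 / 4 * q))), by positivity, ?_⟩
  intro τ hτ s z
  have h3 : Real.sqrt 3 * Real.sqrt 3 = 3 := Real.mul_self_sqrt (by norm_num)
  have h30 : Real.sqrt 3 ≠ 0 := by positivity
  have h0 : τ ≠ 0 := fun h => by simp [h] at hτ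
  have hw : -I * τ ≠ 0 := mul_ne_zero (neg_ne_zero.2 I_ne_zero) h0
  have hτ' := im_neg_inv_pos hτ
  set v : ℝ := 2 * z.re with hv
  set t : ℝ := 2 * s.im / Real.sqrt 3 with ht
  set c : ℝ := 2 * (ω * z).re with hcdef
  have hc : c = -z.re - Real.sqrt 3 * z.im := by
    rw [hcdef]; simp [ω_re, ω_im]; ring
  have hst : s.im = t * Real.sqrt 3 / 2 := by rw [ht]; field_simp
  -- the three double series
  set F : ℤ × ℤ → ℂ := fun p => gTerm τ (q * (p.2 + (s.re - p.1 / 2)) ^ 2) (p.2 * v) *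
    gTerm τ (3 / 4 * q * (p.1 + t) ^ 2) (p.1 * c) with hF
  set G : ℤ × ℤ → ℂ := fun p => gTerm (-1 / τ) ((p.2 - v) ^ 2 / (4 * q))
    ((s.re - p.1 / 2) * (p.2 - v)) * gTerm τ (3 / 4 * q * (p.1 + t) ^ 2) (p.1 * c) with hG
  set K : ℤ × ℤ → ℂ := fun p => gTerm (-1 / τ) ((p.1 - v) ^ 2 / (4 * q)) (s.re * (p.1 - v)) *
    gTerm (-1 / τ) ((p.2 - (c - (p.1 - v) / 2)) ^ 2 / (4 * (3 / 4 * q)))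
      (t * (p.2 - (c - (p.1 - v) / 2))) with hK
  have eF : ∀ p : ℤ × ℤ, F p = gTerm τ (q * Complex.normSq ((mk p.2 p.1 : Eis) + s))
      (2 * ((mk p.2 p.1 : Eis) * z : ℂ).re) := by
    intro p
    rw [hF]
    simp only
    rw [gTerm_mul]
    congr 1
    · simp [Complex.normSq_apply, ω_re, ω_im, hst]
      linear_combination (-(q / 4) * (p.1 + t) ^ 2) * h3
    · rw [hv, hc]; simp [ω_re, ω_im]; ring
  have eK : ∀ p : ℤ × ℤ, K p = gTerm (-1 / τ)
      (Complex.normSq (star ((mk (-p.2) p.1 : Eis) : ℂ) / root + z) / q)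
      (-2 * (s * (star ((mk (-p.2) p.1 : Eis) : ℂ) / root + z)).re) := by
    intro p
    rw [hK]
    simp only
    rw [gTerm_mul, star_mk_div_root]
    have e1 : ((p.2 + p.1 / 2) / Real.sqrt 3 + z.im) =
        (p.2 - (c - (p.1 - v) / 2)) / Real.sqrt 3 := by
      rw [hc, hv]; field_simp; ring
    congr 1
    · simp only [Complex.normSq_apply, Complex.add_re, Complex.add_im, e1]
      have : (p.2 - (c - (p.1 - v) / 2)) / Real.sqrt 3 * ((p.2 - (c - (p.1 - v) / 2)) / Real.sqrt 3)
        = (p.2 - (c - (p.1 - v) / 2)) ^ 2 / 3 := by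
        rw [div_mul_div_comm, h3]; ring
      rw [this, hv]
      field_simp
      ring
    · simp only [Complex.mul_re, Complex.add_re, Complex.add_im, e1, hst, hv]
      field_simp
      ring
  have sF : Summable F := by
    have := (summable_norm_gTerm_eis hτ hq s (fun x => 2 * (x * z : ℂ).re)).of_norm
    rw [← ((Equiv.prodComm ℤ ℤ).trans equivProd).summable_iff] at this
    exact this.congr fun p => (eF p).symm
  have sK : Summable K := by
    have := (summable_norm_gTerm_eis hτ' (c := 1 / (3 * q)) (by positivity)
      (star (root * z)) (fun y => -2 * (s * (star (y : ℂ) / root + z)).re)).of_norm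
    rw [← (((Equiv.prodComm ℤ ℤ).trans ((Equiv.neg ℤ).prodCongr (Equiv.refl ℤ))).trans
      equivProd).summable_iff] at this
    refine this.congr fun p => ?_
    rw [eK]
    simp only [Function.comp, Equiv.trans_apply, Equiv.prodComm_apply, Prod.swap,
      Equiv.prodCongr_apply, Prod.map, Equiv.neg_apply, Equiv.refl_apply, equivProd_apply]
    congr 1
    set y : ℂ := ((mk (-p.2) p.1 : Eis) : ℂ)
    have hr : (root : ℂ) ≠ 0 := by rw [coe_root]; simp
    have : star y / root + z = star (y + star (root * z)) / root := by
      rw [star_add, star_star]; field_simp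
    rw [this, Complex.normSq_div]
    have h4 : Complex.normSq (root : ℂ) = 3 := by
      rw [coe_root]; simp [h3]
    rw [h4, show Complex.normSq (star (y + star (root * z))) = Complex.normSq (y + star (root * z))
      from Complex.normSq_conj _]
    field_simp
  have sG : Summable (fun p : ℤ × ℤ => G p) := by
    refine summable_gTerm_mul
      (summable_norm_gTerm_int hτ (c := 3 / 4 * q) (by positivity) t (fun a => a * c))
      (summable_norm_gTerm_int hτ' (c := 1 / (4 * q)) (by positivity) (-v) (fun _ => 0)) ?_
    intro p
    rw [hG]
    simp only [norm_mul, norm_gTerm]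
    rw [mul_comm]
    congr 3
    ring
  have step1 : ∑' p, F p = 1 / (Real.sqrt (2 * q) * (-I * τ) ^ (1 / 2 : ℂ)) * ∑' p, G p := by
    rw [sF.tsum_prod, sG.tsum_prod, ← tsum_mul_left]
    congr 1
    funext b
    simp only [hF, hG]
    rw [tsum_mul_right, tsum_mul_right, int_poisson hτ hq]
    ring
  have step2 : ∑' p, G p = 1 / (Real.sqrt (2 * (3 / 4 * q)) * (-I * τ) ^ (1 / 2 : ℂ)) *
      ∑' p, K p := by
    have sG' : Summable (fun p : ℤ × ℤ => G (Prod.swap p)) :=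
      (Equiv.prodComm ℤ ℤ).summable_iff.2 sG
    rw [← (Equiv.prodComm ℤ ℤ).tsum_eq G, sK.tsum_prod]
    simp only [Equiv.prodComm_apply]
    rw [sG'.tsum_prod, ← tsum_mul_left]
    congr 1
    funext k
    simp only [hG, hK, Prod.swap]
    rw [tsum_mul_left, mul_left_comm, ← int_poisson hτ (by positivity), ← tsum_mul_left]
    congr 1
    funext b
    have e2 : ∀ B : ℝ, ∀ A : ℝ, gTerm (-1 / τ) A B = gTerm (-1 / τ) A 0 * gTerm τ 0 B := by
      intro B A
      simp only [gTerm, ← Complex.exp_add]; congr 1; push_cast; ring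
    rw [e2 ((s.re - b / 2) * (k - v)), e2 (s.re * (k - v)), mul_assoc (gTerm _ _ 0),
      mul_assoc (gTerm _ _ 0), gTerm_mul, gTerm_mul]
    congr 2
    ring
  rw [← ((Equiv.prodComm ℤ ℤ).trans equivProd).tsum_eq, ← (((Equiv.prodComm ℤ ℤ).trans
    ((Equiv.neg ℤ).prodCongr (Equiv.refl ℤ))).trans equivProd).tsum_eq]
  have hsq : (-I * τ) ^ (1 / 2 : ℂ) * (-I * τ) ^ (1 / 2 : ℂ) = -I * τ := by
    rw [← Complex.cpow_add _ _ hw]; norm_num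
  calc _ = ∑' p, F p := by
        congr 1; funext p; rw [eF]; rfl
    _ = _ := by
        rw [step1, step2, ← mul_assoc]
        congr 1
        · rw [div_mul_div_comm, one_mul, mul_mul_mul_comm, hsq]
          push_cast
          rw [div_div]
        · congr 1; funext p; rw [eK]; rfl

end Eis

/-- The value `x H x*` of the hermitian form with Gram matrix `H`. -/
def hq {n : ℕ} (H : Matrix (Fin n) (Fin n) ℂ) (x : Fin n → ℂ) : ℝ :=
  (∑ i, ∑ j, x i * H i j * star (x j)).re

section PosDef

variable {n : ℕ}

lemma sum_eq_star_dotProduct (H : Matrix (Fin n) (Fin n) ℂ) (x : Fin n → ℂ) :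
    ∑ i, ∑ j, x i * H i j * star (x j) = star (star x) ⬝ᵥ H *ᵥ star x := by
  simp only [dotProduct, mulVec, Finset.mul_sum, Pi.star_apply, star_star]
  refine Finset.sum_congr rfl fun i _ => Finset.sum_congr rfl fun j _ => ?_
  ring

lemma hq_im {H : Matrix (Fin n) (Fin n) ℂ} (hH : H.IsHermitian) (x : Fin n → ℂ) :
    (∑ i, ∑ j, x i * H i j * star (x j)).im = 0 := by
  rw [← Complex.conj_eq_iff_im, map_sum, Finset.sum_comm]
  simp_rw [map_sum]
  refine Finset.sum_congr rfl fun i _ => Finset.sum_congr rfl fun j _ => ?_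
  have := hH.apply i j
  simp only [RCLike.star_def] at this
  simp only [map_mul, RCLike.star_def, Complex.conj_conj, ← this]
  ring

lemma coe_hq {H : Matrix (Fin n) (Fin n) ℂ} (hH : H.IsHermitian) (x : Fin n → ℂ) :
    (hq H x : ℂ) = ∑ i, ∑ j, x i * H i j * star (x j) :=
  Complex.ext rfl (by rw [hq_im hH]; simp)

lemma posDef_iff_hq {H : Matrix (Fin n) (Fin n) ℂ} :
    H.PosDef ↔ H.IsHermitian ∧ ∀ x, x ≠ 0 → 0 < hq H x := by
  rw [posDef_iff_dotProduct_mulVec]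
  refine and_congr_right fun hH => ⟨fun h x hx => ?_, fun h x hx => ?_⟩
  · rw [hq, sum_eq_star_dotProduct]
    exact (Complex.lt_def.1 (h (star_ne_zero.2 hx))).1
  · have h1 := h (star x) (star_ne_zero.2 hx)
    have h2 := hq_im hH (star x)
    rw [hq, sum_eq_star_dotProduct, star_star, star_star] at h1
    rw [sum_eq_star_dotProduct, star_star, star_star] at h2
    exact Complex.lt_def.2 ⟨h1, h2.symm⟩

lemma continuous_hq (H : Matrix (Fin n) (Fin n) ℂ) : Continuous (hq H) := by
  unfold hq
  fun_prop

lemma hq_smul (H : Matrix (Fin n) (Fin n) ℂ) (c : ℂ) (x : Fin n → ℂ) :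
    hq H (c • x) = Complex.normSq c * hq H x := by
  rw [hq, hq, ← Complex.re_ofReal_mul, ← Complex.mul_conj, Finset.mul_sum]
  simp_rw [Finset.mul_sum]
  congr 1
  refine Finset.sum_congr rfl fun i _ => Finset.sum_congr rfl fun j _ => ?_
  simp
  ring

lemma hq_zero (H : Matrix (Fin n) (Fin n) ℂ) : hq H 0 = 0 := by simp [hq]

/-- A positive definite form dominates a multiple of the standard one. -/
lemma exists_le_hq {H : Matrix (Fin n) (Fin n) ℂ} (hH : H.PosDef) :
    ∃ c : ℝ, 0 < c ∧ ∀ x, c * ∑ i, Complex.normSq (x i) ≤ hq H x := by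
  have hH' := (posDef_iff_hq.1 hH).2
  obtain ⟨c, hc, hcb⟩ : ∃ c : ℝ, 0 < c ∧ ∀ x ∈ Metric.sphere (0 : Fin n → ℂ) 1, c ≤ hq H x := by
    rcases (Metric.sphere (0 : Fin n → ℂ) 1).eq_empty_or_nonempty with h | h
    · exact ⟨1, one_pos, by simp [h]⟩
    · obtain ⟨x, hx, hmin⟩ := (isCompact_sphere (0 : Fin n → ℂ) 1).exists_isMinOn h
        (continuous_hq H).continuousOn
      refine ⟨hq H x, hH' x (fun h0 => by simp [h0] at hx), fun y hy => hmin hy⟩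
  refine ⟨c / (n + 1), by positivity, fun x => ?_⟩
  by_cases hx : x = 0
  · simp [hx, hq_zero]
  have hnx : ‖x‖ ≠ 0 := norm_ne_zero_iff.2 hx
  have h1 := hcb ((‖x‖⁻¹ : ℂ) • x) (by simp [norm_smul, hnx])
  rw [hq_smul] at h1
  have h2 : c * ‖x‖ ^ 2 ≤ hq H x := by
    have : Complex.normSq (‖x‖⁻¹ : ℂ) = (‖x‖ ^ 2)⁻¹ := by
      rw [← Complex.ofReal_inv, Complex.normSq_ofReal]; ring
    rw [this, ← div_eq_inv_mul, le_div_iff₀ (by positivity)] at h1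
    exact h1
  refine le_trans ?_ h2
  have h3 : ∑ i, Complex.normSq (x i) ≤ n * ‖x‖ ^ 2 := by
    refine (Finset.sum_le_card_nsmul _ _ (‖x‖ ^ 2) fun i _ => ?_).trans (by simp)
    rw [Complex.normSq_eq_norm_sq]
    exact pow_le_pow_left₀ (norm_nonneg _) (norm_le_pi_norm x i) 2
  rw [div_mul_eq_mul_div, div_le_iff₀ (by positivity), mul_assoc]
  refine mul_le_mul_of_nonneg_left ?_ hc.le
  nlinarith [sq_nonneg ‖x‖]

end PosDef

/-- The coercion of an Eisenstein vector to a complex vector. -/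
def vC {n : ℕ} (x : Fin n → Eis) : Fin n → ℂ := fun i => x i

@[simp] lemma vC_apply {n : ℕ} (x : Fin n → Eis) (i : Fin n) : vC x i = x i := rfl

lemma vC_cons {n : ℕ} (x : Eis) (y : Fin n → Eis) :
    vC (Fin.cons x y : Fin (n + 1) → Eis) = Fin.cons (x : ℂ) (vC y) := by
  ext i
  refine Fin.cases ?_ (fun j => ?_) i <;> simp

lemma vC_injective {n : ℕ} : Function.Injective (vC (n := n)) := fun x y h => by
  ext i
  exact congrFun h i

lemma vC_zero {n : ℕ} : vC (0 : Fin n → Eis) = 0 := by ext; simp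

lemma summable_exp_sum_normSq (n : ℕ) {c : ℝ} (hc : 0 < c) (s : Fin n → ℂ) :
    Summable fun x : Fin n → Eis => Real.exp (-c * ∑ i, Complex.normSq (x i + s i)) := by
  induction n with
  | zero => exact Summable.of_finite
  | succ n ih =>
    have h := (summable_eis_gauss hc (s 0)).mul_of_nonneg (ih fun i => s i.succ)
      (fun _ => (Real.exp_pos _).le) (fun _ => (Real.exp_pos _).le)
    rw [← (Fin.consEquiv (fun _ : Fin (n + 1) => Eis)).summable_iff]
    refine h.congr fun p => ?_
    rw [← Real.exp_add]
    simp [Fin.consEquiv, Fin.sum_univ_succ]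
    ring

lemma summable_exp_hq {n : ℕ} {H : Matrix (Fin n) (Fin n) ℂ} (hH : H.PosDef) {c : ℝ}
    (hc : 0 < c) : Summable fun x : Fin n → Eis => Real.exp (-c * hq H (vC x)) := by
  obtain ⟨c', hc', h⟩ := exists_le_hq hH
  refine Summable.of_nonneg_of_le (fun _ => (Real.exp_pos _).le) (fun x => ?_)
    (summable_exp_sum_normSq n (mul_pos hc hc') 0)
  rw [Real.exp_le_exp]
  have := mul_le_mul_of_nonneg_left (h (vC x)) hc.le
  simp only [vC_apply] at this
  simp only [Pi.zero_apply, add_zero]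
  linarith

lemma finite_hq_le {n : ℕ} {H : Matrix (Fin n) (Fin n) ℂ} (hH : H.PosDef) (C : ℝ) :
    {x : Fin n → Eis | hq H (vC x) ≤ C}.Finite := by
  have h := (summable_exp_hq hH one_pos).tendsto_cofinite_zero.eventually_lt_const
    (Real.exp_pos (-C))
  refine (Filter.eventually_cofinite.1 h).subset fun x hx => ?_
  simpa using hx

/-- The Schur complement of the top left entry. -/
def schur {n : ℕ} (H : Matrix (Fin (n + 1)) (Fin (n + 1)) ℂ) : Matrix (Fin n) (Fin n) ℂ :=
  fun i j => H i.succ j.succ - H i.succ 0 * H 0 j.succ / H 0 0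

section Schur

variable {n : ℕ} {H : Matrix (Fin (n + 1)) (Fin (n + 1)) ℂ}

lemma apply_zero_zero_pos (hH : H.PosDef) : 0 < (H 0 0).re ∧ ((H 0 0).re : ℂ) = H 0 0 := by
  have h := (posDef_iff_hq.1 hH).2 (Pi.single 0 1) (by simp)
  refine ⟨by simpa [hq, Pi.single_apply, Finset.sum_ite_eq] using h, ?_⟩
  exact Complex.conj_eq_iff_re.1 (hH.1.apply 0 0)

lemma hq_cons (hH : H.PosDef) (a : ℂ) (x : Fin n → ℂ) :
    hq H (Fin.cons a x) = (H 0 0).re * Complex.normSq (a + ∑ i, x i * H i.succ 0 / (H 0 0).re) +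
      hq (schur H) x := by
  obtain ⟨h0, h0'⟩ := apply_zero_zero_pos hH
  have h00 : H 0 0 ≠ 0 := by rw [← h0']; exact_mod_cast h0.ne'
  have hb : ∀ i : Fin n, H 0 i.succ = star (H i.succ 0) := fun i => (hH.1.apply 0 i.succ).symm
  have : (((H 0 0).re * Complex.normSq (a + ∑ i, x i * H i.succ 0 / (H 0 0).re) : ℝ) : ℂ) +
      ∑ i, ∑ j, x i * schur H i j * star (x j) =
      ∑ i, ∑ j, (Fin.cons a x : Fin (n + 1) → ℂ) i * H i j *
        star ((Fin.cons a x : Fin (n + 1) → ℂ) j) := by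
    have hre : star (H 0 0) = H 0 0 := hH.1.apply 0 0
    have e2 : ∑ i, ∑ j, x i * schur H i j * star (x j) =
        ∑ i, ∑ j, x i * H i.succ j.succ * star (x j) -
        (∑ i, x i * H i.succ 0) * star (∑ i, x i * H i.succ 0) / H 0 0 := by
      simp only [schur, hb, star_sum, Finset.sum_mul_sum, Finset.sum_div,
        ← Finset.sum_sub_distrib, star_mul']
      refine Finset.sum_congr rfl fun i _ => Finset.sum_congr rfl fun j _ => ?_
      ring
    rw [e2]
    simp only [Fin.sum_univ_succ, Fin.cons_zero, Fin.cons_succ, Finset.sum_add_distrib]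
    rw [Complex.ofReal_mul, ← Complex.mul_conj, h0', ← Finset.sum_div]
    have e3 : ∑ j, a * H 0 j.succ * star (x j) = a * star (∑ i, x i * H i.succ 0) := by
      simp only [star_sum, Finset.mul_sum, hb, star_mul']
      refine Finset.sum_congr rfl fun i _ => ?_
      ring
    rw [e3, ← Finset.sum_mul]
    set B := ∑ i, x i * H i.succ 0
    rw [← RCLike.star_def, star_add, star_div₀, hre]
    field_simp
    ring
  rw [hq, ← this, Complex.add_re, Complex.ofReal_re, hq]

lemma schur_posDef (hH : H.PosDef) : (schur H).PosDef := by
  refine posDef_iff_hq.2 ⟨?_, fun x hx => ?_⟩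
  · ext i j
    simp only [schur, conjTranspose_apply, star_sub, star_mul', star_div₀, hH.1.apply]
    ring
  · have h := (posDef_iff_hq.1 hH).2 (Fin.cons (-∑ i, x i * H i.succ 0 / (H 0 0).re) x) (by
      intro h
      refine hx (funext fun i => ?_)
      simpa using congrFun h i.succ)
    rw [hq_cons hH] at h
    simpa using h

lemma det_eq_mul_det_schur (h00 : H 0 0 ≠ 0) : H.det = H 0 0 * (schur H).det := by
  set B : Matrix (Fin (n + 1)) (Fin (n + 1)) ℂ :=
    fun i j => Fin.cases (H 0 j) (fun k => H k.succ j - H k.succ 0 / H 0 0 * H 0 j) i with hB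
  rw [det_eq_of_forall_row_eq_smul_add_const (B := B)
    (Fin.cons 0 fun k => H k.succ 0 / H 0 0) 0 rfl, det_succ_column_zero,
    Finset.sum_eq_single 0]
  · simp [hB]
    left
    congr 1
    ext i j
    change H i.succ j.succ - H i.succ 0 / H 0 0 * H 0 j.succ = _
    simp only [schur]
    ring
  · intro i _ hi
    obtain ⟨k, rfl⟩ := Fin.exists_succ_eq.2 hi
    simp [hB, h00]
  · simp
  · intro i j
    refine Fin.cases ?_ (fun k => ?_) i <;> simp [hB]

end Schur

/-- The dual vector `ȳ / √-3 + z`. -/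
def dualVec {n : ℕ} (y : Fin n → Eis) (z : Fin n → ℂ) : Fin n → ℂ :=
  fun i => star (y i : ℂ) / Eis.root + z i

/-- The dual form `w* H⁻¹ w`. -/
def dq {n : ℕ} (H : Matrix (Fin n) (Fin n) ℂ) (w : Fin n → ℂ) : ℝ := hq H⁻¹ (star w)

section Theta

variable {n : ℕ}

lemma Eis.coe_root_ne_zero : (Eis.root : ℂ) ≠ 0 := by rw [Eis.coe_root]; simp

lemma Eis.normSq_root : Complex.normSq (Eis.root : ℂ) = 3 := by
  rw [Eis.coe_root]; simp

lemma dq_eq {H : Matrix (Fin n) (Fin n) ℂ} (hH : H.PosDef) {v w : Fin n → ℂ}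
    (h : H *ᵥ v = w) : dq H w = (∑ i, star (w i) * v i).re := by
  have hdet : IsUnit H.det := hH.det_pos.ne'.isUnit
  have hv : v = H⁻¹ *ᵥ w := by
    rw [← h, mulVec_mulVec, nonsing_inv_mul _ hdet, one_mulVec]
  rw [dq, hq, hv]
  congr 1
  refine Finset.sum_congr rfl fun i _ => ?_
  simp [mulVec, dotProduct, Finset.mul_sum]
  refine Finset.sum_congr rfl fun j _ => ?_
  ring

lemma exists_mulVec_eq {H : Matrix (Fin n) (Fin n) ℂ} (hH : H.PosDef) (w : Fin n → ℂ) :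
    ∃ v, H *ᵥ v = w :=
  ⟨H⁻¹ *ᵥ w, by
    rw [mulVec_mulVec, mul_nonsing_inv _ hH.det_pos.ne'.isUnit, one_mulVec]⟩

lemma dq_cons {H : Matrix (Fin (n + 1)) (Fin (n + 1)) ℂ} (hH : H.PosDef) (a : ℂ)
    (w : Fin n → ℂ) :
    dq H (Fin.cons a w) = Complex.normSq a / (H 0 0).re +
      dq (schur H) (fun i => w i - H i.succ 0 * a / (H 0 0).re) := by
  obtain ⟨h0, h0'⟩ := apply_zero_zero_pos hH
  have h00 : H 0 0 ≠ 0 := by rw [← h0']; exact_mod_cast h0.ne'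
  have hre : star (H 0 0) = H 0 0 := hH.1.apply 0 0
  have hb : ∀ i : Fin n, H 0 i.succ = star (H i.succ 0) := fun i => (hH.1.apply 0 i.succ).symm
  obtain ⟨v, hv⟩ := exists_mulVec_eq (schur_posDef hH) (fun i => w i - H i.succ 0 * a / (H 0 0).re)
  have hv' : H *ᵥ (Fin.cons ((a - ∑ j, H 0 j.succ * v j) / H 0 0) v) = Fin.cons a w := by
    ext i
    refine Fin.cases ?_ (fun i => ?_) i
    · simp [mulVec, dotProduct, Fin.sum_univ_succ]
      field_simp
      ring
    · have := congrFun hv i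
      simp only [mulVec, dotProduct, schur, h0', sub_mul, Finset.sum_sub_distrib] at this
      have e : ∑ j, H i.succ 0 * H 0 j.succ / H 0 0 * v j =
          H i.succ 0 * (∑ j, H 0 j.succ * v j) / H 0 0 := by
        rw [Finset.mul_sum, Finset.sum_div]
        refine Finset.sum_congr rfl fun j _ => ?_
        ring
      rw [e] at this
      simp [mulVec, dotProduct, Fin.sum_univ_succ]
      linear_combination this
  rw [dq_eq hH hv', dq_eq (schur_posDef hH) hv]
  have : (∑ i, star ((Fin.cons a w : Fin (n + 1) → ℂ) i) *
      (Fin.cons ((a - ∑ j, H 0 j.succ * v j) / H 0 0) v : Fin (n + 1) → ℂ) i) =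
      ((Complex.normSq a / (H 0 0).re : ℝ) : ℂ) +
        ∑ i, star (w i - H i.succ 0 * a / (H 0 0).re) * v i := by
    have e : ∑ i, star (w i - H i.succ 0 * a / (H 0 0).re) * v i =
        ∑ i, star (w i) * v i - star a * (∑ j, H 0 j.succ * v j) / H 0 0 := by
      rw [Finset.mul_sum, Finset.sum_div, ← Finset.sum_sub_distrib]
      refine Finset.sum_congr rfl fun j _ => ?_
      rw [h0', hb, star_sub, star_div₀, star_mul', hre]
      ring
    rw [e]
    simp only [Fin.sum_univ_succ, Fin.cons_zero, Fin.cons_succ, Complex.ofReal_div,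
      ← Complex.mul_conj, h0', RCLike.star_def]
    field_simp
    ring
  rw [this, Complex.add_re, Complex.ofReal_re]

lemma summable_exp_dq {H : Matrix (Fin n) (Fin n) ℂ} (hH : H.PosDef) {c : ℝ} (hc : 0 < c)
    (z : Fin n → ℂ) :
    Summable fun y : Fin n → Eis => Real.exp (-c * dq H (dualVec y z)) := by
  obtain ⟨c', hc', h⟩ := exists_le_hq hH.inv
  refine Summable.of_nonneg_of_le (fun _ => (Real.exp_pos _).le) (fun y => ?_)
    (summable_exp_sum_normSq n (c := c * c' / 3) (by positivity)
      (fun i => star (Eis.root * z i)))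
  rw [Real.exp_le_exp]
  have h1 := mul_le_mul_of_nonneg_left (h (star (dualVec y z))) hc.le
  have h2 : ∀ i, Complex.normSq (star (dualVec y z) i) =
      Complex.normSq (y i + star (Eis.root * z i)) / 3 := by
    intro i
    have e : star (dualVec y z) i = (y i + star (Eis.root * z i)) / star (Eis.root : ℂ) := by
      have := star_ne_zero.2 Eis.coe_root_ne_zero
      simp only [dualVec, Pi.star_apply, star_add, star_mul', star_div₀, star_star]
      field_simp
    rw [e, Complex.normSq_div, RCLike.star_def, Complex.normSq_conj, Eis.normSq_root]
  simp only [h2, ← Finset.sum_div] at h1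
  rw [dq]
  linarith

/-- Poisson summation for a hermitian Gaussian on `𝓞ⁿ`. -/
theorem hermitian_poisson : ∀ {n : ℕ} {H : Matrix (Fin n) (Fin n) ℂ}, H.PosDef →
    ∃ C : ℝ, 0 < C ∧ ∀ τ : ℂ, 0 < τ.im → ∀ z : Fin n → ℂ,
      ∑' x : Fin n → Eis, gTerm τ (hq H (vC x)) (2 * (∑ i, x i * z i : ℂ).re) =
        C / (-I * τ) ^ n * ∑' y : Fin n → Eis, gTerm (-1 / τ) (dq H (dualVec y z)) 0
  | 0, H, _ => ⟨1, one_pos, fun τ _ z => by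
      simp [gTerm, hq, dq]⟩
  | n + 1, H, hH => by
    obtain ⟨h0, h0'⟩ := apply_zero_zero_pos hH
    set q := (H 0 0).re with hqdef
    obtain ⟨C₁, hC₁, h₁⟩ := Eis.poisson h0
    obtain ⟨C₂, hC₂, h₂⟩ := hermitian_poisson (schur_posDef hH)
    refine ⟨C₁ * C₂, mul_pos hC₁ hC₂, fun τ hτ z => ?_⟩
    have hτ' := im_neg_inv_pos hτ
    set s : (Fin n → Eis) → ℂ := fun x => ∑ i, x i * H i.succ 0 / q with hs
    set w : Eis → ℂ := fun y => star (y : ℂ) / Eis.root + z 0 with hw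
    set z' : Eis → Fin n → ℂ := fun y i => z i.succ - H i.succ 0 * w y / q with hz'
    set e := Fin.consEquiv (fun _ : Fin (n + 1) => Eis) with he
    have s₁ : Summable fun x : Fin (n + 1) → Eis =>
        gTerm τ (hq H (vC x)) (2 * (∑ i, x i * z i : ℂ).re) := by
      refine Summable.of_norm ((summable_exp_hq hH (c := 2 * Real.pi * τ.im)
        (by positivity)).congr fun x => ?_)
      rw [norm_gTerm]
    have s₂ : Summable fun y : Fin (n + 1) → Eis => gTerm (-1 / τ) (dq H (dualVec y z)) 0 := by
      refine Summable.of_norm ((summable_exp_dq hH (c := 2 * Real.pi * (-1 / τ).im)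
        (by positivity) z).congr fun x => ?_)
      rw [norm_gTerm]
    set G : (Fin n → Eis) × Eis → ℂ := fun p => gTerm (-1 / τ) (Complex.normSq (w p.2) / q) 0 *
      gTerm τ (hq (schur H) (vC p.1)) (2 * (∑ i, p.1 i * z' p.2 i : ℂ).re) with hG
    have s₃ : Summable G := by
      refine summable_gTerm_mul
        (f := fun x : Fin n → Eis => gTerm τ (hq (schur H) (vC x)) 0)
        (g := fun y : Eis => gTerm (-1 / τ) (Complex.normSq (w y) / q) 0) ?_ ?_ ?_
      · refine (summable_exp_hq (schur_posDef hH) (c := 2 * Real.pi * τ.im)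
          (by positivity)).congr fun x => ?_
        rw [norm_gTerm]
      · refine (summable_norm_gTerm_eis hτ' (c := 1 / (3 * q)) (by positivity)
          (star (Eis.root * z 0)) (fun _ => 0)).congr fun y => ?_
        rw [norm_gTerm, norm_gTerm]
        congr 2
        have : w y = star (y + star (Eis.root * z 0)) / Eis.root := by
          have := Eis.coe_root_ne_zero
          rw [hw, star_add, star_star]; field_simp
        rw [this, Complex.normSq_div, RCLike.star_def, Complex.normSq_conj, Eis.normSq_root]
        field_simp
      · intro p
        simp only [hG, norm_mul, norm_gTerm]
        ring
    have step₁ : ∀ p : Eis × (Fin n → Eis), gTerm τ (hq H (vC (e p)))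
        (2 * (∑ i, (e p) i * z i : ℂ).re) =
        gTerm τ (hq (schur H) (vC p.2)) (2 * (∑ i, p.2 i * z i.succ : ℂ).re) *
        gTerm τ (q * Complex.normSq (p.1 + s p.2)) (2 * (p.1 * z 0 : ℂ).re) := by
      intro p
      have : vC (e p) = Fin.cons (p.1 : ℂ) (vC p.2) := vC_cons p.1 p.2
      rw [gTerm_mul, this, hq_cons hH]
      congr 1
      · simp only [vC_apply, hs]; ring
      · simp [he, Fin.consEquiv, Fin.sum_univ_succ]; ring
    have step₂ : ∀ p : Eis × (Fin n → Eis), gTerm (-1 / τ) (dq H (dualVec (e p) z)) 0 =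
        gTerm (-1 / τ) (Complex.normSq (w p.1) / q) 0 *
          gTerm (-1 / τ) (dq (schur H) (dualVec p.2 (z' p.1))) 0 := by
      intro p
      have : dualVec (e p) z = Fin.cons (w p.1) (dualVec p.2 fun i => z i.succ) := by
        ext i
        refine Fin.cases ?_ (fun i => ?_) i <;> simp [dualVec, he, Fin.consEquiv, hw]
      rw [gTerm_mul, this, dq_cons hH, add_zero]
      congr 3
      funext i
      simp only [dualVec, hz']
      ring
    have lhs : ∑' x : Fin (n + 1) → Eis, gTerm τ (hq H (vC x)) (2 * (∑ i, x i * z i : ℂ).re) =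
        C₁ / (-I * τ) * ∑' p, G p := by
      rw [← e.tsum_eq, ← (Equiv.prodComm _ _).tsum_eq, s₃.tsum_prod, ← tsum_mul_left]
      rw [← e.summable_iff, ← (Equiv.prodComm _ _).summable_iff] at s₁
      simp only [Function.comp_def] at s₁
      rw [Summable.tsum_prod s₁]
      congr 1
      funext x
      simp only [Equiv.prodComm_apply, Prod.swap_prod_mk, step₁]
      rw [tsum_mul_left, h₁ τ hτ (s x) (z 0), mul_left_comm, ← tsum_mul_left]
      congr 2
      funext y
      have e2 : ∀ A B : ℝ, gTerm (-1 / τ) A B = gTerm (-1 / τ) A 0 * gTerm τ 0 B := by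
        intro A B
        simp only [gTerm, ← Complex.exp_add]; congr 1; push_cast; ring
      rw [e2, mul_left_comm, gTerm_mul]
      simp only [hG]
      congr 2
      · ring
      · have : (∑ i, x i * z' y i : ℂ) = ∑ i, x i * z i.succ - s x * w y := by
          simp only [hz', hs, Finset.sum_mul, ← Finset.sum_sub_distrib]
          refine Finset.sum_congr rfl fun i _ => ?_
          ring
        rw [this, Complex.sub_re]
        ring
    have rhs : ∑' p, G p = C₂ / (-I * τ) ^ n *
        ∑' y : Fin (n + 1) → Eis, gTerm (-1 / τ) (dq H (dualVec y z)) 0 := by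
      have s₃' := s₃
      rw [← (Equiv.prodComm _ _).tsum_eq, ← e.tsum_eq (fun y => gTerm (-1 / τ) _ 0)]
      rw [← (Equiv.prodComm _ _).summable_iff] at s₃'
      rw [← e.summable_iff] at s₂
      simp only [Function.comp_def] at s₂ s₃'
      rw [Summable.tsum_prod s₃', Summable.tsum_prod s₂, ← tsum_mul_left]
      congr 1
      funext y
      simp only [Equiv.prodComm_apply, Prod.swap_prod_mk, step₂, hG]
      rw [tsum_mul_left, tsum_mul_left, h₂ τ hτ (z' y)]
      ring
    rw [lhs, rhs]
    push_cast
    rw [pow_succ']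
    ring

end Theta

/-- The complex matrix underlying a matrix of Eisenstein integers. -/
def toM {m n : ℕ} (H : Matrix (Fin m) (Fin n) Eis) : Matrix (Fin m) (Fin n) ℂ := H.map Eis.toC

/-- Gram matrices of positive definite hermitian unimodular lattices. -/
structure Uni {n : ℕ} (H : Matrix (Fin n) (Fin n) Eis) : Prop where
  herm : Hᴴ = H
  pos : (toM H).PosDef
  det : H.det = 1

/-- The sesquilinear form `x H y*`. -/
def hb {n : ℕ} (H : Matrix (Fin n) (Fin n) Eis) (x y : Fin n → Eis) : Eis := x ⬝ᵥ H *ᵥ star y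

/-- The number of vectors of norm `m`. -/
def rep {n : ℕ} (H : Matrix (Fin n) (Fin n) Eis) (m : ℕ) : ℕ :=
  Nat.card {x : Fin n → Eis // hb H x x = m}

lemma Eis.exists_int_of_star_eq {z : Eis} (h : star z = z) : ∃ k : ℤ, z = k := by
  obtain ⟨a, b, rfl⟩ := Eis.exists_eq_mk z
  rw [Eis.star_mk] at h
  obtain ⟨-, h2⟩ := Eis.mk_injective h
  obtain rfl : b = 0 := by omega
  exact ⟨a, (Eis.intCast_eq_mk a).symm⟩

lemma Eis.coe_natCast (m : ℕ) : ((m : Eis) : ℂ) = m := map_natCast Eis.toC m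

lemma Eis.coe_intCast (m : ℤ) : ((m : Eis) : ℂ) = m := map_intCast Eis.toC m

section Form

variable {n : ℕ} {H : Matrix (Fin n) (Fin n) Eis}

@[simp] lemma toM_apply {m : ℕ} (H : Matrix (Fin m) (Fin n) Eis) (i : Fin m) (j : Fin n) :
    toM H i j = H i j := rfl

lemma toM_mul {l m : ℕ} (A : Matrix (Fin l) (Fin m) Eis) (B : Matrix (Fin m) (Fin n) Eis) :
    toM (A * B) = toM A * toM B := Matrix.map_mul

lemma toM_conjTranspose {m : ℕ} (A : Matrix (Fin m) (Fin n) Eis) : toM Aᴴ = (toM A)ᴴ := by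
  ext i j; simp

lemma toM_one : toM (1 : Matrix (Fin n) (Fin n) Eis) = 1 :=
  Matrix.map_one _ (map_zero _) (map_one _)

lemma toM_injective {m : ℕ} : Function.Injective (toM (m := m) (n := n)) := fun A B h => by
  ext i j
  exact congrFun (congrFun h i) j

lemma det_toM (H : Matrix (Fin n) (Fin n) Eis) : (toM H).det = (H.det : ℂ) :=
  (RingHom.map_det Eis.toC H).symm

lemma hb_add_left (x y z : Fin n → Eis) : hb H (x + y) z = hb H x z + hb H y z :=
  add_dotProduct _ _ _

lemma hb_smul_left (c : Eis) (x z : Fin n → Eis) : hb H (c • x) z = c * hb H x z :=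
  smul_dotProduct _ _ _

lemma hb_star (hH : Hᴴ = H) (x y : Fin n → Eis) : star (hb H x y) = hb H y x := by
  rw [hb, hb, dotProduct_mulVec y, dotProduct_star, star_vecMul, hH]

lemma hb_add_right (x y z : Fin n → Eis) : hb H x (y + z) = hb H x y + hb H x z := by
  rw [hb, star_add, mulVec_add, dotProduct_add]; rfl

lemma hb_smul_right (c : Eis) (x z : Fin n → Eis) : hb H x (c • z) = star c * hb H x z := by
  rw [hb, star_smul, mulVec_smul, dotProduct_smul]; rfl

lemma coe_hb_self (hH : Hᴴ = H) (x : Fin n → Eis) :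
    ((hb H x x : Eis) : ℂ) = hq (toM H) (vC x) := by
  rw [coe_hq (by rw [IsHermitian, ← toM_conjTranspose, hH])]
  simp only [hb, dotProduct, mulVec, Finset.mul_sum, toM_apply, vC_apply]
  push_cast
  refine Finset.sum_congr rfl fun i _ => Finset.sum_congr rfl fun j _ => ?_
  simp [mul_assoc]

lemma Uni.exists_nat (hH : Uni H) (x : Fin n → Eis) :
    ∃ m : ℕ, hb H x x = m ∧ hq (toM H) (vC x) = m := by
  obtain ⟨k, hk⟩ := Eis.exists_int_of_star_eq (hb_star hH.herm x x)
  have h1 : hq (toM H) (vC x) = k := by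
    have := coe_hb_self hH.herm x
    rw [hk, Eis.coe_intCast] at this
    exact_mod_cast this.symm
  have h0 : 0 ≤ k := by
    by_cases hx : vC x = 0
    · rw [hx, hq_zero] at h1
      exact_mod_cast h1.le
    · have := (posDef_iff_hq.1 hH.pos).2 _ hx
      rw [h1] at this
      exact_mod_cast this.le
  lift k to ℕ using h0
  exact ⟨k, by simpa using hk, by simpa using h1⟩

/-- The norm of a vector of a unimodular lattice as a natural number. -/
def normNat (H : Matrix (Fin n) (Fin n) Eis) (x : Fin n → Eis) : ℕ := ⌊hq (toM H) (vC x)⌋₊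

lemma Uni.hb_self (hH : Uni H) (x : Fin n → Eis) : hb H x x = normNat H x := by
  obtain ⟨m, h1, h2⟩ := hH.exists_nat x
  rw [h1, normNat, h2, Nat.floor_natCast]

lemma Uni.hq_eq (hH : Uni H) (x : Fin n → Eis) : hq (toM H) (vC x) = normNat H x := by
  obtain ⟨m, h1, h2⟩ := hH.exists_nat x
  rw [normNat, h2, Nat.floor_natCast]

instance : CharZero Eis :=
  ⟨fun a b h => by
    have := congrArg (fun z : Eis => (z : ℂ)) h
    simpa using this⟩

lemma Uni.hb_eq_iff (hH : Uni H) (x : Fin n → Eis) (m : ℕ) : hb H x x = m ↔ normNat H x = m := by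
  rw [hH.hb_self]
  exact Nat.cast_inj

lemma Uni.finite_norm (hH : Uni H) (m : ℕ) : Finite {x : Fin n → Eis // hb H x x = m} := by
  refine ((finite_hq_le hH.pos m).subset fun x hx => ?_).to_subtype
  have := (hH.hb_eq_iff x m).1 hx
  simp [hH.hq_eq, this]

end Form

/-- The nome `exp (2πiτ)`. -/
def nome (τ : ℂ) : ℂ := cexp (2 * Real.pi * I * τ)

lemma norm_nome (τ : ℂ) : ‖nome τ‖ = Real.exp (-(2 * Real.pi * τ.im)) := by
  rw [nome, Complex.norm_exp]
  congr 1
  simp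

lemma norm_nome_lt_one {τ : ℂ} (hτ : 0 < τ.im) : ‖nome τ‖ < 1 := by
  rw [norm_nome, Real.exp_lt_one_iff]
  have := Real.pi_pos
  simp only [Left.neg_neg_iff]
  positivity

lemma nome_pow (τ : ℂ) (m : ℕ) : nome τ ^ m = gTerm τ m 0 := by
  rw [nome, gTerm, ← Complex.exp_nat_mul]
  congr 1
  push_cast
  ring

/-- The value at `q` of the function with the given power series. -/
def PowerSeries.ev (a : PowerSeries ℂ) (q : ℂ) : ℂ := ∑' m, PowerSeries.coeff m a * q ^ m

/-- Power series of modular forms for the Fricke group of level 3. -/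
structure IsFricke (k : ℕ) (a : PowerSeries ℂ) : Prop where
  summable : ∀ q : ℂ, ‖q‖ < 1 → Summable fun m => ‖PowerSeries.coeff m a * q ^ m‖
  fricke : ∀ τ : ℂ, 0 < τ.im →
    a.ev (nome (-1 / (3 * τ))) = (Real.sqrt 3 * τ / I) ^ k * a.ev (nome τ)

/-- The theta series of a lattice. -/
def theta {n : ℕ} (H : Matrix (Fin n) (Fin n) Eis) : PowerSeries ℂ :=
  PowerSeries.mk fun m => (rep H m : ℂ)

section ThetaSeries

variable {n : ℕ} {H : Matrix (Fin n) (Fin n) Eis}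

lemma Uni.summable_norm_pow (hH : Uni H) {q : ℂ} (hq : ‖q‖ < 1) :
    Summable fun x : Fin n → Eis => ‖q ^ normNat H x‖ := by
  set r := max ‖q‖ (1 / 2) with hr
  have hr0 : 0 < r := lt_max_of_lt_right (by norm_num)
  have hr1 : r < 1 := max_lt hq (by norm_num)
  refine Summable.of_nonneg_of_le (fun _ => norm_nonneg _) (fun x => ?_)
    (summable_exp_hq hH.pos (c := -Real.log r) (by linarith [Real.log_neg hr0 hr1]))
  rw [norm_pow, neg_neg, hH.hq_eq, Real.exp_mul, Real.exp_log hr0, Real.rpow_natCast]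
  exact pow_le_pow_left₀ (norm_nonneg _) (le_max_left _ _) _

lemma Uni.hasSum_theta (hH : Uni H) {q : ℂ} (hq : ‖q‖ < 1) :
    (Summable fun m => ‖PowerSeries.coeff m (theta H) * q ^ m‖) ∧
      (theta H).ev q = ∑' x : Fin n → Eis, q ^ normNat H x := by
  have hs := hH.summable_norm_pow hq
  have hfib : ∀ m, Nat.card {x : Fin n → Eis // normNat H x = m} = rep H m := fun m =>
    Nat.card_congr (Equiv.subtypeEquivRight fun x => (hH.hb_eq_iff x m).symm)
  have hfin : ∀ m, Finite {x : Fin n → Eis // normNat H x = m} := fun m => by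
    have := hH.finite_norm m
    exact Finite.of_equiv _ (Equiv.subtypeEquivRight fun x => hH.hb_eq_iff x m)
  rw [← (Equiv.sigmaFiberEquiv (normNat H)).summable_iff] at hs
  have key : ∀ m, ∑' x : {x : Fin n → Eis // normNat H x = m}, q ^ normNat H x =
      PowerSeries.coeff m (theta H) * q ^ m := by
    intro m
    rw [tsum_congr (g := fun _ => q ^ m) fun x => by rw [x.2], tsum_const, hfib, theta,
      PowerSeries.coeff_mk, nsmul_eq_mul]
  constructor
  · refine (hs.sigma).congr fun m => ?_
    rw [tsum_congr (g := fun _ => ‖q ^ m‖) fun x => by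
      simp only [Function.comp, Equiv.sigmaFiberEquiv, Equiv.coe_fn_mk]
      rw [x.2], tsum_const, hfib, theta, PowerSeries.coeff_mk, nsmul_eq_mul, norm_mul]
    simp
  · rw [PowerSeries.ev, ← (Equiv.sigmaFiberEquiv (normNat H)).tsum_eq,
      Summable.tsum_sigma (Summable.of_norm hs)]
    exact tsum_congr fun m => (key m).symm

lemma Uni.theta_ev_nome (hH : Uni H) {τ : ℂ} (hτ : 0 < τ.im) :
    (theta H).ev (nome τ) = ∑' x : Fin n → Eis, gTerm τ (hq (toM H) (vC x)) 0 := by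
  rw [(hH.hasSum_theta (norm_nome_lt_one hτ)).2]
  refine tsum_congr fun x => ?_
  rw [nome_pow, hH.hq_eq]

lemma Uni.mul_adjugate (hH : Uni H) : H * H.adjugate = 1 ∧ H.adjugate * H = 1 := by
  rw [Matrix.mul_adjugate, Matrix.adjugate_mul, hH.det, one_smul]
  exact ⟨rfl, rfl⟩

/-- Right multiplication by a unimodular Gram matrix. -/
def Uni.vecMulEquiv (hH : Uni H) : (Fin n → Eis) ≃ (Fin n → Eis) where
  toFun x := x ᵥ* H
  invFun x := x ᵥ* H.adjugate
  left_inv x := by simp only; rw [vecMul_vecMul, hH.mul_adjugate.1, vecMul_one]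
  right_inv x := by simp only; rw [vecMul_vecMul, hH.mul_adjugate.2, vecMul_one]

lemma Uni.dq_vecMul (hH : Uni H) (x : Fin n → Eis) :
    dq (toM H) (dualVec (x ᵥ* H) 0) = 1 / 3 * hq (toM H) (vC x) := by
  have hmul : toM H *ᵥ (fun i => star (x i : ℂ) / Eis.root) = dualVec (x ᵥ* H) 0 := by
    ext i
    simp only [mulVec, dotProduct, toM_apply, dualVec, vecMul, Pi.zero_apply, add_zero]
    push_cast
    rw [star_sum, Finset.sum_div]
    refine Finset.sum_congr rfl fun j _ => ?_
    have := congrArg (fun M : Matrix (Fin n) (Fin n) Eis => ((M i j : Eis) : ℂ)) hH.herm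
    simp only [conjTranspose_apply, Eis.coe_star] at this
    rw [star_mul', this]
    ring
  rw [dq_eq hH.pos hmul]
  have : (∑ i, star (dualVec (x ᵥ* H) 0 i) * (star (x i : ℂ) / Eis.root)) =
      ((1 / 3 * hq (toM H) (vC x) : ℝ) : ℂ) := by
    rw [Complex.ofReal_mul, coe_hq hH.pos.1, Finset.sum_comm, Finset.mul_sum]
    refine Finset.sum_congr rfl fun i _ => ?_
    simp only [dualVec, vecMul, dotProduct, Pi.zero_apply, add_zero, star_div₀, star_star,
      toM_apply, vC_apply]
    push_cast
    rw [Finset.sum_div, Finset.sum_mul, Finset.mul_sum]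
    refine Finset.sum_congr rfl fun j _ => ?_
    have hr : star (Eis.root : ℂ) * Eis.root = 3 := by
      have := congrArg (fun z : Eis => (z : ℂ)) Eis.root_mul_star_root
      rw [show (3 : Eis) = (3 : ℕ) by norm_cast, Eis.coe_natCast] at this
      simpa [mul_comm] using this
    have hr1 := Eis.coe_root_ne_zero
    have hr2 := star_ne_zero.2 hr1
    rw [div_mul_div_comm, hr]
    ring
  rw [this, Complex.ofReal_re]

theorem Uni.isFricke_theta (hH : Uni H) : IsFricke n (theta H) := by
  refine ⟨fun q hq => (hH.hasSum_theta hq).1, ?_⟩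
  obtain ⟨C, hC, h⟩ := hermitian_poisson hH.pos
  have h3 : Real.sqrt 3 * Real.sqrt 3 = 3 := Real.mul_self_sqrt (by norm_num)
  have h30 : (Real.sqrt 3 : ℂ) ≠ 0 := by simp
  have h3' : (Real.sqrt 3 : ℂ) * Real.sqrt 3 = 3 := by exact_mod_cast h3
  have him : ∀ τ : ℂ, 0 < τ.im → 0 < (-1 / (3 * τ)).im := fun τ hτ =>
    im_neg_inv_pos (by simpa using hτ)
  have key : ∀ τ : ℂ, 0 < τ.im →
      (theta H).ev (nome τ) = C / (-I * τ) ^ n * (theta H).ev (nome (-1 / (3 * τ))) := by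
    intro τ hτ
    have hτ0 : τ ≠ 0 := fun h => by simp [h] at hτ
    rw [hH.theta_ev_nome hτ, hH.theta_ev_nome (him τ hτ)]
    have h1 := h τ hτ 0
    rw [← hH.vecMulEquiv.tsum_eq (fun y => gTerm (-1 / τ) (dq (toM H) (dualVec y 0)) 0)] at h1
    simp only [Pi.zero_apply, mul_zero, Finset.sum_const_zero, Complex.zero_re] at h1
    rw [h1]
    congr 1
    refine tsum_congr fun x => ?_
    change gTerm _ (dq _ (dualVec (x ᵥ* H) 0)) 0 = _
    rw [hH.dq_vecMul, gTerm, gTerm]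
    congr 1
    push_cast
    field_simp
  have hτ0 : 0 < (I / Real.sqrt 3 : ℂ).im := by
    rw [Complex.div_ofReal_im, I_im]
    positivity
  have hfix : (-1 / (3 * (I / Real.sqrt 3)) : ℂ) = I / Real.sqrt 3 := by
    rw [← h3']
    have := I_ne_zero
    field_simp
    rw [I_sq]
  have hC' : (C : ℂ) * (Real.sqrt 3) ^ n = 1 := by
    have h1 := key _ hτ0
    rw [hfix] at h1
    have hne : (theta H).ev (nome (I / Real.sqrt 3)) ≠ 0 := by
      have hs := hH.summable_norm_pow (norm_nome_lt_one hτ0)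
      have hreal : ∀ x, nome (I / Real.sqrt 3) ^ normNat H x =
          ((‖nome (I / Real.sqrt 3) ^ normNat H x‖ : ℝ) : ℂ) := by
        intro x
        rw [norm_pow, norm_nome, Complex.ofReal_pow, Complex.ofReal_exp, nome]
        congr 2
        rw [Complex.div_ofReal_im, I_im]
        push_cast
        linear_combination (2 * Real.pi / Real.sqrt 3 : ℂ) * I_mul_I
      rw [(hH.hasSum_theta (norm_nome_lt_one hτ0)).2, tsum_congr hreal, ← Complex.ofReal_tsum]
      refine Complex.ofReal_ne_zero.2 (hs.tsum_pos (fun _ => norm_nonneg _) 0 ?_).ne'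
      exact norm_pos_iff.2 (pow_ne_zero _ (Complex.exp_ne_zero _))
    have h2 : (C : ℂ) / (-I * (I / Real.sqrt 3)) ^ n = 1 := by
      refine mul_right_cancel₀ hne ?_
      rw [← h1, one_mul]
    have h4 : (-I * (I / Real.sqrt 3) : ℂ) = (Real.sqrt 3 : ℂ)⁻¹ := by
      linear_combination (-1 / Real.sqrt 3 : ℂ) * I_mul_I
    rw [h4, inv_pow, div_inv_eq_mul] at h2
    exact h2
  intro τ hτ
  have hτ0 : τ ≠ 0 := fun h => by simp [h] at hτ
  have hw : -I * τ ≠ 0 := mul_ne_zero (neg_ne_zero.2 I_ne_zero) hτ0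
  have e : (Real.sqrt 3 * τ / I : ℂ) = Real.sqrt 3 * (-I * τ) := by
    rw [div_eq_iff I_ne_zero]
    linear_combination (Real.sqrt 3 * τ : ℂ) * I_mul_I
  rw [key τ hτ, e, mul_pow, ← mul_assoc, mul_assoc (_ ^ n), mul_div_cancel₀ _ (pow_ne_zero _ hw),
    mul_comm _ (C : ℂ), hC', one_mul]

end ThetaSeries

/-! ### Uniqueness of Fricke forms with a high order of vanishing -/

section PowerSeriesEval

/-- Absolute convergence on the open unit disc. -/
def PowerSeries.ConvDisc (a : PowerSeries ℂ) : Prop :=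
  ∀ q : ℂ, ‖q‖ < 1 → Summable fun m ↦ ‖PowerSeries.coeff m a * q ^ m‖

variable {a b : PowerSeries ℂ}

lemma PowerSeries.ConvDisc.hasFPowerSeriesOnBall (ha : a.ConvDisc) :
    HasFPowerSeriesOnBall a.ev
      (FormalMultilinearSeries.ofScalars ℂ fun m ↦ PowerSeries.coeff m a) 0 1 := by
  set p := FormalMultilinearSeries.ofScalars ℂ fun m ↦ PowerSeries.coeff m a
  have hr : 1 ≤ p.radius := by
    refine ENNReal.le_of_forall_nnreal_lt fun r hr ↦ ?_
    refine p.le_radius_of_summable ?_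
    have h1 : ‖((r : ℝ) : ℂ)‖ < 1 := by
      simpa using (by exact_mod_cast hr : r < 1)
    refine (ha _ h1).congr fun m ↦ ?_
    simp [p]
  have h := (p.hasFPowerSeriesOnBall (zero_lt_one.trans_le hr)).mono zero_lt_one hr
  refine h.congr fun q _ ↦ ?_
  simp [p, FormalMultilinearSeries.sum, PowerSeries.ev, FormalMultilinearSeries.ofScalars,
    mul_comm]

lemma eball_one_eq : Metric.eball (0 : ℂ) 1 = Metric.ball 0 1 := by
  simpa using Metric.eball_ofReal (x := (0 : ℂ)) (ε := 1)

lemma PowerSeries.ConvDisc.differentiableOn (ha : a.ConvDisc) :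
    DifferentiableOn ℂ a.ev (Metric.ball 0 1) := by
  rw [← eball_one_eq]
  exact ha.hasFPowerSeriesOnBall.differentiableOn

lemma PowerSeries.ConvDisc.eq_zero (ha : a.ConvDisc)
    (h : ∀ q ∈ Metric.ball (0 : ℂ) 1, a.ev q = 0) : a = 0 := by
  have h0 : HasFPowerSeriesAt (0 : ℂ → ℂ)
      (FormalMultilinearSeries.ofScalars ℂ fun m ↦ PowerSeries.coeff m a) 0 := by
    refine (ha.hasFPowerSeriesOnBall.hasFPowerSeriesAt).congr ?_
    filter_upwards [Metric.ball_mem_nhds (0 : ℂ) one_pos] with q hq using h q hq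
  have h1 := h0.eq_zero
  rw [FormalMultilinearSeries.ofScalars_series_eq_zero] at h1
  ext m
  simpa using congrFun h1 m

lemma PowerSeries.ConvDisc.add (ha : a.ConvDisc) (hb : b.ConvDisc) : (a + b).ConvDisc :=
  fun q hq ↦ .of_nonneg_of_le (fun _ ↦ norm_nonneg _)
    (fun m ↦ by simpa [add_mul] using norm_add_le (coeff m a * q ^ m) (coeff m b * q ^ m))
    ((ha q hq).add (hb q hq))

lemma PowerSeries.ConvDisc.smul (c : ℂ) (ha : a.ConvDisc) : (c • a).ConvDisc :=
  fun q hq ↦ by simpa [mul_assoc] using (ha q hq).mul_left ‖c‖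

lemma PowerSeries.ev_add (ha : a.ConvDisc) (hb : b.ConvDisc) {q : ℂ} (hq : ‖q‖ < 1) :
    (a + b).ev q = a.ev q + b.ev q := by
  simp only [ev, map_add, add_mul]
  exact (ha q hq).of_norm.tsum_add (hb q hq).of_norm

lemma PowerSeries.ev_smul (c : ℂ) (a : PowerSeries ℂ) (q : ℂ) : (c • a).ev q = c * a.ev q := by
  simp [ev, mul_assoc, tsum_mul_left]

lemma PowerSeries.coeff_mul_mul_pow (a b : PowerSeries ℂ) (q : ℂ) (m : ℕ) :
    coeff m (a * b) * q ^ m =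
      ∑ p ∈ Finset.HasAntidiagonal.antidiagonal m, coeff p.1 a * q ^ p.1 * (coeff p.2 b * q ^ p.2) := by
  rw [coeff_mul, Finset.sum_mul]
  refine Finset.sum_congr rfl fun p hp ↦ ?_
  rw [← Finset.HasAntidiagonal.mem_antidiagonal.1 hp]
  ring

lemma PowerSeries.ConvDisc.mul (ha : a.ConvDisc) (hb : b.ConvDisc) : (a * b).ConvDisc :=
  fun q hq ↦ by
    refine (summable_norm_sum_mul_antidiagonal_of_summable_norm (ha q hq) (hb q hq)).congr
      fun m ↦ ?_
    rw [coeff_mul_mul_pow]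

lemma PowerSeries.ev_mul (ha : a.ConvDisc) (hb : b.ConvDisc) {q : ℂ} (hq : ‖q‖ < 1) :
    (a * b).ev q = a.ev q * b.ev q := by
  simp only [ev, coeff_mul_mul_pow]
  exact (tsum_mul_tsum_eq_tsum_sum_antidiagonal_of_summable_norm (ha q hq) (hb q hq)).symm

lemma PowerSeries.ev_X_pow_mul (d : ℕ) (a : PowerSeries ℂ) {q : ℂ} (hq : ‖q‖ < 1)
    (ha : (X ^ d * a).ConvDisc) : (X ^ d * a).ev q = q ^ d * a.ev q := by
  rw [ev, ← (ha q hq).of_norm.sum_add_tsum_nat_add d, Finset.sum_eq_zero, zero_add, ev,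
    ← tsum_mul_left]
  · refine tsum_congr fun m ↦ ?_
    rw [add_comm m d, coeff_X_pow_mul', if_pos (Nat.le_add_right _ _), Nat.add_sub_cancel_left]
    ring
  · intro i hi
    rw [coeff_X_pow_mul', if_neg (by simpa using hi), zero_mul]

lemma PowerSeries.ConvDisc.of_X_pow_mul {d : ℕ} (ha : (X ^ d * a).ConvDisc) : a.ConvDisc := by
  intro q hq
  by_cases h0 : q = 0
  · subst h0
    refine summable_of_ne_finset_zero (s := {0}) fun m hm ↦ ?_
    simp_all
  have h := (summable_nat_add_iff d).2 (ha q hq)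
  have h2 := h.mul_left (‖q‖ ^ d)⁻¹
  refine h2.congr fun m ↦ ?_
  rw [add_comm m d, coeff_X_pow_mul', if_pos (Nat.le_add_right _ _), Nat.add_sub_cancel_left,
    pow_add, norm_mul, norm_mul, norm_mul, norm_pow, norm_pow]
  field_simp [norm_ne_zero_iff.2 h0]

end PowerSeriesEval

section Growth

lemma exists_nome_eq {q : ℂ} (hq : q ≠ 0) (hq1 : ‖q‖ < 1) :
    ∃ τ : ℂ, 0 < τ.im ∧ nome τ = q ∧ τ.im = -Real.log ‖q‖ / (2 * Real.pi) := by
  have h2 : (2 * Real.pi * I : ℂ) ≠ 0 := by simp [Real.pi_ne_zero]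
  have hne : nome (Complex.log q / (2 * Real.pi * I)) = q := by
    rw [nome, mul_div_cancel₀ _ h2, Complex.exp_log hq]
  have hn := norm_nome (Complex.log q / (2 * Real.pi * I))
  rw [hne] at hn
  have him : (Complex.log q / (2 * Real.pi * I)).im = -Real.log ‖q‖ / (2 * Real.pi) := by
    rw [hn, Real.log_exp]
    field_simp
  refine ⟨_, ?_, hne, him⟩
  rw [him]
  exact div_pos (neg_pos.2 (Real.log_neg (norm_pos_iff.2 hq) hq1)) (by positivity)

lemma nome_add_one (τ : ℂ) : nome (τ + 1) = nome τ := by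
  rw [nome, nome, mul_add, mul_one, Complex.exp_add, Complex.exp_two_pi_mul_I, mul_one]

lemma im_fricke (τ : ℂ) : (-1 / (3 * τ)).im = τ.im / (3 * normSq τ) := by
  rw [Complex.div_im]
  simp [Complex.normSq_mul, show normSq (3 : ℂ) = 9 by norm_num [normSq_apply]]
  by_cases h : normSq τ = 0
  · simp [h]
  field_simp
  ring

lemma exists_shift_re (τ : ℂ) : ∃ N : ℤ, |(τ + N).re| ≤ 1 / 2 :=
  ⟨-round τ.re, by simpa [← sub_eq_add_neg] using abs_sub_round τ.re⟩

/-- A function on the upper half plane invariant under `τ ↦ τ + 1` and `τ ↦ -1/(3τ)` is bounded by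
its supremum over `Im τ ≥ 1/4`. -/
lemma le_of_fricke_invariant {φ : ℂ → ℝ} {C : ℝ} (h1 : ∀ τ, 0 < τ.im → φ (τ + 1) = φ τ)
    (hW : ∀ τ, 0 < τ.im → φ (-1 / (3 * τ)) = φ τ) (hC : ∀ τ, 1 / 4 ≤ τ.im → φ τ ≤ C)
    {τ : ℂ} (hτ : 0 < τ.im) : φ τ ≤ C := by
  have hshift : ∀ (N : ℤ) (τ : ℂ), 0 < τ.im → φ (τ + N) = φ τ := by
    intro N
    induction N using Int.induction_on with
    | zero => simp
    | succ i ih =>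
      intro τ hτ
      rw [← ih τ hτ, ← h1 (τ + (i : ℤ)) (by simpa using hτ)]
      push_cast
      congr 1
      ring
    | pred i ih =>
      intro τ hτ
      rw [← ih τ hτ, ← h1 (τ + ((-i - 1 : ℤ) : ℂ)) (by simpa using hτ)]
      push_cast
      congr 1
      ring
  have key : ∀ (N : ℕ) (τ : ℂ), 0 < τ.im → 1 / 4 * (15 / 16) ^ N ≤ τ.im → φ τ ≤ C := by
    intro N
    induction N with
    | zero => exact fun τ _ h ↦ hC τ (by simpa using h)
    | succ N ih =>
      intro τ hτ h
      obtain ⟨M, hM⟩ := exists_shift_re τ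
      rw [← hshift M τ hτ]
      set σ := τ + M with hσ
      have hσi : σ.im = τ.im := by simp [hσ]
      by_cases h4 : 1 / 4 ≤ σ.im
      · exact hC σ h4
      push Not at h4
      rw [← hW σ (hσi ▸ hτ)]
      have hn : normSq σ ≤ 5 / 16 := by
        rw [normSq_apply]
        have := sq_le_sq' (abs_le.1 hM).1 (abs_le.1 hM).2
        nlinarith [hσi]
      have hn0 : 0 < normSq σ := normSq_pos.2 fun h0 ↦ by simp [h0] at hσi; linarith
      have him : (-1 / (3 * σ)).im = σ.im / (3 * normSq σ) := im_fricke σ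
      refine ih _ (him ▸ div_pos (hσi ▸ hτ) (by positivity)) ?_
      rw [him, le_div_iff₀ (by positivity), hσi]
      refine le_trans ?_ h
      rw [pow_succ]
      have : (0 : ℝ) < (15 / 16) ^ N := by positivity
      nlinarith
  obtain ⟨N, hN⟩ := exists_pow_lt_of_lt_one (show 0 < 4 * τ.im by positivity)
    (show (15 / 16 : ℝ) < 1 by norm_num)
  exact key N τ hτ (by linarith)

/-- A holomorphic function on the disc tending to zero like a power of `-log |q|` at the boundary
vanishes. -/
lemma eq_zero_of_norm_le_im_pow {G : ℂ → ℂ} (hG : DifferentiableOn ℂ G (Metric.ball 0 1)) {e : ℕ}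
    (he : 0 < e) {C : ℝ} (h : ∀ τ : ℂ, 0 < τ.im → ‖G (nome τ)‖ ≤ C * τ.im ^ e) :
    ∀ q ∈ Metric.ball (0 : ℂ) 1, G q = 0 := by
  intro q hq
  have hq1 : ‖q‖ < 1 := by simpa using hq
  have hev : ∀ᶠ r in nhdsWithin (1 : ℝ) (Set.Iio 1),
      ‖G q‖ ≤ C * (-Real.log r / (2 * Real.pi)) ^ e := by
    filter_upwards [Ioo_mem_nhdsLT hq1] with r hr
    have hr0 : 0 < r := (norm_nonneg q).trans_lt hr.1
    have hd : DiffContOnCl ℂ G (Metric.ball 0 r) := by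
      apply DifferentiableOn.diffContOnCl
      rw [closure_ball _ hr0.ne']
      exact hG.mono fun z hz ↦ by
        simp only [Metric.mem_closedBall, dist_zero_right, Metric.mem_ball] at hz ⊢
        exact hz.trans_lt hr.2
    refine Complex.norm_le_of_forall_mem_frontier_norm_le Metric.isBounded_ball hd ?_
      (subset_closure (by simpa using hr.1))
    intro z hz
    rw [frontier_ball _ hr0.ne'] at hz
    have hz' : ‖z‖ = r := by simpa using hz
    obtain ⟨τ, hτ, h1, h2⟩ := exists_nome_eq (norm_pos_iff.1 (hz' ▸ hr0)) (hz' ▸ hr.2)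
    have := h τ hτ
    rwa [h1, h2, hz'] at this
  have hlim : Filter.Tendsto (fun r ↦ C * (-Real.log r / (2 * Real.pi)) ^ e)
      (nhdsWithin (1 : ℝ) (Set.Iio 1)) (nhds 0) := by
    have hc : ContinuousAt (fun r ↦ C * (-Real.log r / (2 * Real.pi)) ^ e) 1 := by
      have := Real.continuousAt_log (one_ne_zero (α := ℝ))
      fun_prop
    have := hc.tendsto
    simp only [Real.log_one, neg_zero, zero_div, zero_pow he.ne', mul_zero] at this
    exact this.mono_left nhdsWithin_le_nhds
  exact norm_le_zero_iff.1 (ge_of_tendsto hlim hev)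

end Growth

section EtaProduct

/-- The product `∏ (1 - q ^ n) ^ 24`. -/
def etaProd (q : ℂ) : ℂ := (∏' n : ℕ, (1 - q ^ (n + 1))) ^ 24

lemma differentiableOn_etaProd : DifferentiableOn ℂ etaProd (Metric.ball 0 1) :=
  ModularForm.differentiableOn_tprod_one_sub_pow.fun_pow 24

lemma etaProd_ne_zero {q : ℂ} (hq : ‖q‖ < 1) : etaProd q ≠ 0 := by
  refine pow_ne_zero _ ?_
  have h := tprod_one_add_ne_zero_of_summable (f := fun n : ℕ ↦ -q ^ (n + 1)) ?_ ?_
  · simpa [← sub_eq_add_neg] using h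
  · intro n h0
    have h1 : q ^ (n + 1) = 1 := by linear_combination -h0
    have h2 := congrArg norm h1
    rw [norm_pow, norm_one] at h2
    exact (pow_lt_one₀ (norm_nonneg q) hq n.succ_ne_zero).ne h2
  · simpa using (summable_nat_add_iff 1).mpr (summable_geometric_of_lt_one (norm_nonneg _) hq)

lemma eta_pow_eq (τ : ℂ) : ModularForm.eta τ ^ 24 = nome τ * etaProd (nome τ) := by
  simp only [ModularForm.eta, mul_pow, etaProd, ModularForm.eta_q_eq_pow, nome]
  congr 1
  rw [Function.Periodic.qParam, ← Complex.exp_nat_mul]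
  congr 1
  push_cast
  ring

lemma eta_pow_inv {τ : ℂ} (hτ : 0 < τ.im) :
    ModularForm.eta (-1 / τ) ^ 24 = τ ^ 12 * ModularForm.eta τ ^ 24 := by
  have h := ModularForm.eta_comp_eq_csqrt_I_inv (x := τ) hτ
  have hs : ∀ z : ℂ, z ≠ 0 → Complex.sqrt z ^ 24 = z ^ 12 := fun z hz ↦ by
    rw [sqrt_eq_exp hz, ← Complex.exp_nat_mul, ← Complex.exp_log hz,
      ← Complex.exp_nat_mul, Complex.exp_log hz]
    congr 1
    push_cast
    ring
  have h0 : τ ≠ 0 := fun h0 ↦ by simp [h0] at hτ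
  simp only [Function.comp_apply, Pi.smul_apply, Pi.mul_apply, smul_eq_mul] at h
  rw [h, mul_pow, mul_pow, inv_pow, hs _ I_ne_zero, hs τ h0, show (12 : ℕ) = 4 * 3 by rfl,
    pow_mul I, I_pow_four, one_pow, inv_one, one_mul]

end EtaProduct

section Uniqueness

variable {k l : ℕ} {a b : PowerSeries ℂ}

lemma norm_nome_fricke_lt_one {τ : ℂ} (hτ : 0 < τ.im) : ‖nome (-1 / (3 * τ))‖ < 1 := by
  have h0 : τ ≠ 0 := fun h0 ↦ by simp [h0] at hτ
  have := normSq_pos.2 h0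
  exact norm_nome_lt_one (im_fricke τ ▸ by positivity)

lemma IsFricke.mul (ha : IsFricke k a) (hb : IsFricke l b) : IsFricke (k + l) (a * b) where
  summable := PowerSeries.ConvDisc.mul ha.summable hb.summable
  fricke τ hτ := by
    rw [PowerSeries.ev_mul ha.summable hb.summable (norm_nome_lt_one hτ),
      PowerSeries.ev_mul ha.summable hb.summable (norm_nome_fricke_lt_one hτ), ha.fricke τ hτ,
      hb.fricke τ hτ]
    ring

lemma IsFricke.add (ha : IsFricke k a) (hb : IsFricke k b) : IsFricke k (a + b) where
  summable := PowerSeries.ConvDisc.add ha.summable hb.summable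
  fricke τ hτ := by
    rw [PowerSeries.ev_add ha.summable hb.summable (norm_nome_lt_one hτ),
      PowerSeries.ev_add ha.summable hb.summable (norm_nome_fricke_lt_one hτ), ha.fricke τ hτ,
      hb.fricke τ hτ]
    ring

lemma IsFricke.smul (c : ℂ) (ha : IsFricke k a) : IsFricke k (c • a) where
  summable := PowerSeries.ConvDisc.smul c ha.summable
  fricke τ hτ := by
    rw [PowerSeries.ev_smul, PowerSeries.ev_smul, ha.fricke τ hτ]
    ring

lemma isFricke_one : IsFricke 0 1 where
  summable q _ := summable_of_ne_finset_zero (s := {0}) fun m hm ↦ by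
    simp [PowerSeries.coeff_one, Finset.notMem_singleton.1 hm]
  fricke τ _ := by
    simp [PowerSeries.ev, PowerSeries.coeff_one]

lemma IsFricke.pow (ha : IsFricke k a) (j : ℕ) : IsFricke (k * j) (a ^ j) := by
  induction j with
  | zero => simpa using isFricke_one
  | succ j ih => simpa [pow_succ, mul_add] using ih.mul ha

/-- A Fricke form of weight `k` vanishing to order `d > k / 6` is zero. -/
theorem IsFricke.eq_zero (ha : IsFricke k a) {d : ℕ} (hd : k < 6 * d)
    (h : ∀ m < d, PowerSeries.coeff m a = 0) : a = 0 := by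
  obtain ⟨b, rfl⟩ := PowerSeries.X_pow_dvd_iff.2 h
  have hb : b.ConvDisc := PowerSeries.ConvDisc.of_X_pow_mul ha.summable
  have hev : ∀ {q : ℂ}, ‖q‖ < 1 → (PowerSeries.X ^ d * b).ev q = q ^ d * b.ev q :=
    fun hq ↦ PowerSeries.ev_X_pow_mul d b hq ha.summable
  set D : ℂ → ℂ := fun q ↦ etaProd q * etaProd (q ^ 3) with hD
  have hq3 : ∀ {q : ℂ}, ‖q‖ < 1 → ‖q ^ 3‖ < 1 := fun hq ↦ by
    rw [norm_pow]
    exact pow_lt_one₀ (norm_nonneg _) hq (by norm_num)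
  have hD0 : ∀ {q : ℂ}, ‖q‖ < 1 → D q ≠ 0 := fun hq ↦
    mul_ne_zero (etaProd_ne_zero hq) (etaProd_ne_zero (hq3 hq))
  have hDd : DifferentiableOn ℂ D (Metric.ball 0 1) :=
    differentiableOn_etaProd.mul (differentiableOn_etaProd.comp (by fun_prop)
      fun q hq ↦ by simpa using hq3 (by simpa using hq))
  have hDW : ∀ τ : ℂ, 0 < τ.im → nome (-1 / (3 * τ)) ^ 4 * D (nome (-1 / (3 * τ))) =
      3 ^ 12 * τ ^ 24 * (nome τ ^ 4 * D (nome τ)) := by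
    intro τ hτ
    have key : ∀ σ : ℂ, nome σ ^ 4 * D (nome σ) =
        ModularForm.eta σ ^ 24 * ModularForm.eta (3 * σ) ^ 24 := by
      intro σ
      have h3 : nome (3 * σ) = nome σ ^ 3 := by
        rw [nome, nome, ← Complex.exp_nat_mul]
        push_cast
        congr 1
        ring
      rw [eta_pow_eq, eta_pow_eq, h3, hD]
      ring
    have h0 : τ ≠ 0 := fun h0 ↦ by simp [h0] at hτ
    have hτ3 : 0 < (3 * τ).im := by simpa using hτ
    rw [key, key, eta_pow_inv hτ3, show 3 * (-1 / (3 * τ)) = -1 / τ by field_simp,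
      eta_pow_inv hτ]
    ring
  set G : ℂ → ℂ := fun q ↦ b.ev q ^ 4 / D q ^ d with hG
  have hGd : DifferentiableOn ℂ G (Metric.ball 0 1) :=
    (hb.differentiableOn.pow 4).div (hDd.pow d) fun q hq ↦
      pow_ne_zero _ (hD0 (by simpa using hq))
  set e := 12 * d - 2 * k with he
  have he' : 12 * d = e + 2 * k := by omega
  have hGW : ∀ τ : ℂ, 0 < τ.im →
      ‖G (nome (-1 / (3 * τ)))‖ * (3 * normSq τ) ^ e = ‖G (nome τ)‖ := by
    intro τ hτ
    have hq := norm_nome_lt_one hτ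
    have hq' := norm_nome_fricke_lt_one hτ
    have hf := ha.fricke τ hτ
    rw [hev hq, hev hq'] at hf
    have h0 : τ ≠ 0 := fun h0 ↦ by simp [h0] at hτ
    have hn0 : nome τ ≠ 0 := Complex.exp_ne_zero _
    have hn0' : nome (-1 / (3 * τ)) ≠ 0 := Complex.exp_ne_zero _
    have hG2 : ∀ {q : ℂ}, q ≠ 0 → ‖q‖ < 1 → G q = (q ^ d * b.ev q) ^ 4 / (q ^ 4 * D q) ^ d := by
      intro q hq0 hq
      have := hD0 hq
      rw [hG, mul_pow, mul_pow (q ^ 4), ← pow_mul, ← pow_mul, mul_comm 4 d]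
      field_simp
    rw [hG2 hn0' hq', hG2 hn0 hq, hf, hDW τ hτ]
    simp only [norm_div, norm_mul, norm_pow, mul_pow]
    have hx : 0 < ‖τ‖ := norm_pos_iff.2 h0
    have hD1 : 0 < ‖D (nome τ)‖ := norm_pos_iff.2 (hD0 hq)
    have hn1 : 0 < ‖nome τ‖ := norm_pos_iff.2 hn0
    have h3 : ‖((Real.sqrt 3 : ℝ) : ℂ)‖ ^ 2 = 3 := by
      rw [← norm_pow, ← Complex.ofReal_pow, Real.sq_sqrt (by norm_num)]
      simp
    have h3' : (‖((Real.sqrt 3 : ℝ) : ℂ)‖ ^ k) ^ 4 = 3 ^ (2 * k) := by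
      generalize ‖((Real.sqrt 3 : ℝ) : ℂ)‖ = s at h3
      rw [← h3]
      ring
    simp only [norm_I, div_one, mul_pow, h3', Complex.normSq_eq_norm_sq]
    have e1 : ((3 : ℝ) ^ 12) ^ d = 3 ^ e * 3 ^ (2 * k) := by
      rw [← pow_mul, he', pow_add]
    have e2 : (‖τ‖ ^ 24) ^ d = (‖τ‖ ^ 2) ^ e * (‖τ‖ ^ k) ^ 4 := by
      rw [← pow_mul, show 24 * d = 2 * e + k * 4 by omega, pow_add, pow_mul, pow_mul _ k 4]
    simp only [Complex.norm_ofNat, e1, e2]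
    field_simp
  obtain ⟨C, hC⟩ := (isCompact_closedBall (0 : ℂ) (Real.exp (-(Real.pi / 2)))).exists_bound_of_continuousOn
    (f := G) (hGd.continuousOn.mono fun z hz ↦ by
      have : Real.exp (-(Real.pi / 2)) < 1 := Real.exp_lt_one_iff.2 (by simp [Real.pi_pos])
      simpa using (by simpa using hz : ‖z‖ ≤ _).trans_lt this)
  have hC0 : 0 ≤ C := (norm_nonneg _).trans (hC 0 (by simp [Real.exp_nonneg]))
  have hbound : ∀ τ : ℂ, 0 < τ.im → ‖G (nome τ)‖ / τ.im ^ e ≤ C * 4 ^ e := by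
    intro τ hτ
    refine le_of_fricke_invariant (φ := fun τ ↦ ‖G (nome τ)‖ / τ.im ^ e) ?_ ?_ ?_ hτ
    · intro τ _
      simp [nome_add_one]
    · intro τ hτ
      have h0 : τ ≠ 0 := fun h0 ↦ by simp [h0] at hτ
      have := normSq_pos.2 h0
      rw [← hGW τ hτ, im_fricke, div_pow]
      field_simp
    · intro τ h4
      have hτ : 0 < τ.im := by linarith
      rw [div_le_iff₀ (by positivity), mul_assoc, ← mul_pow]
      refine (hC _ ?_).trans (le_mul_of_one_le_right hC0 (one_le_pow₀ (by linarith)))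
      simp only [Metric.mem_closedBall, dist_zero_right, norm_nome, Real.exp_le_exp]
      nlinarith [Real.pi_pos]
  have hG0 := eq_zero_of_norm_le_im_pow hGd (show 0 < e by omega) (C := C * 4 ^ e) fun τ hτ ↦ by
    have := hbound τ hτ
    rwa [div_le_iff₀ (by positivity)] at this
  rw [hb.eq_zero, mul_zero]
  intro q hq
  have := hG0 q hq
  rw [hG, div_eq_zero_iff] at this
  rcases this with h0 | h0
  · exact pow_eq_zero_iff (by norm_num) |>.1 h0
  · exact absurd h0 (pow_ne_zero _ (hD0 (by simpa using hq)))

end Uniqueness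

/-! ### The Fricke forms of weights one and six -/

section EisensteinSix

/-- The coefficients of the normalised Eisenstein series of weight six. -/
def eisCoeff (m : ℕ) : ℤ := if m = 0 then 1 else -504 * (ArithmeticFunction.sigma 5 m : ℤ)

/-- The `q`-expansion of the normalised Eisenstein series of weight six. -/
def eisSix : PowerSeries ℂ := PowerSeries.mk fun m ↦ (eisCoeff m : ℂ)

/-- The `q`-expansion of `E₆(3τ)`. -/
def eisSixThree : PowerSeries ℂ :=
  PowerSeries.mk fun m ↦ if 3 ∣ m then (eisCoeff (m / 3) : ℂ) else 0

lemma eisSix_convDisc : eisSix.ConvDisc := by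
  intro q hq
  have h : Summable fun m : ℕ ↦ ‖q‖ ^ m := summable_geometric_of_lt_one (norm_nonneg _) hq
  have h6 : Summable fun m : ℕ ↦ ‖((m : ℂ) ^ 6) * q ^ m‖ :=
    summable_norm_pow_mul_geometric_of_norm_lt_one 6 hq
  refine .of_nonneg_of_le (fun _ ↦ norm_nonneg _) (fun m ↦ ?_) (h.add (h6.mul_left 504))
  simp only [eisSix, PowerSeries.coeff_mk, eisCoeff]
  split_ifs with h0
  · simp [h0]
  · have hs : ((ArithmeticFunction.sigma 5 m : ℕ) : ℝ) ≤ (m : ℝ) ^ 6 := by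
      exact_mod_cast ArithmeticFunction.sigma_le_pow_succ 5 m
    simp only [Int.cast_mul, Int.cast_neg, Int.cast_ofNat, Int.cast_natCast, norm_mul, norm_neg,
      Complex.norm_ofNat, Complex.norm_natCast, norm_pow]
    have : 0 ≤ ‖q‖ ^ m := by positivity
    nlinarith [mul_le_mul_of_nonneg_right hs this]

lemma hasSum_eisSixThree {q : ℂ} (hq : ‖q‖ < 1) :
    (Summable fun m ↦ ‖PowerSeries.coeff m eisSixThree * q ^ m‖) ∧
      eisSixThree.ev q = eisSix.ev (q ^ 3) := by
  have hq3 : ‖q ^ 3‖ < 1 := by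
    rw [norm_pow]
    exact pow_lt_one₀ (norm_nonneg _) hq (by norm_num)
  have hinj : Function.Injective fun m : ℕ ↦ 3 * m := fun a b h ↦ by simpa using h
  have hsupp : ∀ m ∉ Set.range (fun m : ℕ ↦ 3 * m),
      PowerSeries.coeff m eisSixThree * q ^ m = 0 := by
    intro m hm
    rw [eisSixThree, PowerSeries.coeff_mk, if_neg, zero_mul]
    rintro ⟨k, rfl⟩
    exact hm ⟨k, rfl⟩
  have hcomp : ∀ m, PowerSeries.coeff (3 * m) eisSixThree * q ^ (3 * m) =
      PowerSeries.coeff m eisSix * (q ^ 3) ^ m := by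
    intro m
    simp [eisSixThree, eisSix, pow_mul]
  constructor
  · rw [← hinj.summable_iff fun m hm ↦ by rw [hsupp m hm, norm_zero]]
    exact (eisSix_convDisc _ hq3).congr fun m ↦ by rw [← hcomp, Function.comp_apply]
  · rw [PowerSeries.ev, PowerSeries.ev, ← hinj.tsum_eq]
    · exact tsum_congr hcomp
    · intro m hm
      by_contra h
      exact hm (hsupp m h)

lemma eisSix_ev {τ : ℂ} (hτ : 0 < τ.im) :
    eisSix.ev (nome τ) = ModularForm.E (k := 6) (by norm_num) ⟨τ, hτ⟩ := by
  have hs := eisSix_convDisc _ (norm_nome_lt_one hτ)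
  rw [EisensteinSeries.q_expansion_bernoulli (by norm_num) (by decide), PowerSeries.ev,
    hs.of_norm.tsum_eq_zero_add, show bernoulli 6 = 1 / 42 by decide +kernel]
  have h2 := tsum_pnat_eq_tsum_succ (f := fun m : ℕ ↦
    (ArithmeticFunction.sigma 5 m : ℂ) * nome τ ^ m)
  simp only [zpow_natCast]
  rw [show (∑' n : ℕ+, ((ArithmeticFunction.sigma (6 - 1) n : ℕ) : ℂ) *
    cexp (2 * Real.pi * I * τ) ^ (n : ℕ)) = _ from h2, sub_eq_add_neg, ← neg_mul, ← tsum_mul_left]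
  congr 1
  · simp [eisSix, eisCoeff]
  · refine tsum_congr fun m ↦ ?_
    simp only [eisSix, eisCoeff, PowerSeries.coeff_mk]
    push_cast
    simp
    ring

lemma eisSix_ev_inv {τ : ℂ} (hτ : 0 < τ.im) :
    eisSix.ev (nome (-1 / τ)) = τ ^ 6 * eisSix.ev (nome τ) := by
  have him : 0 < (-1 / τ).im := by
    have h0 : τ ≠ 0 := fun h0 ↦ by simp [h0] at hτ
    have := normSq_pos.2 h0
    rw [neg_div, one_div, Complex.neg_im, Complex.inv_im, neg_div, neg_neg]
    positivity
  have hS : (ModularForm.E (k := 6) (by norm_num)) (ModularGroup.S • (⟨τ, hτ⟩ : UpperHalfPlane)) =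
      UpperHalfPlane.denom ModularGroup.S (⟨τ, hτ⟩ : UpperHalfPlane) ^ ((6 : ℕ) : ℤ) *
        (ModularForm.E (k := 6) (by norm_num)) (⟨τ, hτ⟩ : UpperHalfPlane) :=
    SlashInvariantForm.slash_action_eqn'' (ModularForm.E (k := 6) (by norm_num))
      (MonoidHom.mem_range.2 ⟨ModularGroup.S, rfl⟩) _
  rw [ModularGroup.denom_S, zpow_natCast, UpperHalfPlane.modular_S_smul] at hS
  rw [eisSix_ev hτ, eisSix_ev him]
  convert hS using 3
  simp [neg_div, one_div]

/-- The weight six Fricke form `E₆(τ) - 27 E₆(3τ)`. -/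
def frickeSix : PowerSeries ℂ := eisSix + (-27 : ℂ) • eisSixThree

lemma isFricke_frickeSix : IsFricke 6 frickeSix := by
  have h3 : eisSixThree.ConvDisc := fun q hq ↦ (hasSum_eisSixThree hq).1
  have hnome : ∀ σ : ℂ, nome σ ^ 3 = nome (3 * σ) := by
    intro σ
    rw [nome, nome, ← Complex.exp_nat_mul]
    push_cast
    congr 1
    ring
  have hev : ∀ σ : ℂ, 0 < σ.im →
      frickeSix.ev (nome σ) = eisSix.ev (nome σ) - 27 * eisSix.ev (nome (3 * σ)) := by
    intro σ hσ
    have hq := norm_nome_lt_one hσ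
    rw [frickeSix, PowerSeries.ev_add eisSix_convDisc (h3.smul _) hq, PowerSeries.ev_smul,
      (hasSum_eisSixThree hq).2, hnome]
    ring
  refine ⟨eisSix_convDisc.add (h3.smul _), fun τ hτ ↦ ?_⟩
  have h0 : τ ≠ 0 := fun h0 ↦ by simp [h0] at hτ
  have hτ3 : 0 < (3 * τ).im := by simpa using hτ
  have hW : 0 < (-1 / (3 * τ)).im := by
    have := normSq_pos.2 h0
    exact im_fricke τ ▸ by positivity
  rw [hev τ hτ, hev _ hW, show 3 * (-1 / (3 * τ)) = -1 / τ by field_simp, eisSix_ev_inv hτ3,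
    eisSix_ev_inv hτ, div_pow, mul_pow, mul_pow _ τ]
  have hs : ((Real.sqrt 3 : ℝ) : ℂ) ^ 2 = 3 := by
    rw [← Complex.ofReal_pow, Real.sq_sqrt (by norm_num)]
    simp
  rw [show ((Real.sqrt 3 : ℝ) : ℂ) ^ 6 = (((Real.sqrt 3 : ℝ) : ℂ) ^ 2) ^ 3 by ring, hs,
    show I ^ 6 = -1 by rw [show I ^ 6 = (I ^ 2) ^ 3 by ring, I_sq]; norm_num]
  ring

end EisensteinSix

section Jets

open PowerSeries

/-- The first seven coefficients of `f` are the entries of the list `l`. -/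
def HasJet (f : PowerSeries ℂ) (l : List ℤ) : Prop := ∀ i < 7, coeff i f = (l.getD i 0 : ℤ)

/-- The product of two truncated power series. -/
def mulJet (l l' : List ℤ) : List ℤ :=
  (List.range 7).map fun i ↦ ((List.range (i + 1)).map fun j ↦ l.getD j 0 * l'.getD (i - j) 0).sum

lemma HasJet.mul {f g : PowerSeries ℂ} {l l' : List ℤ} (hf : HasJet f l) (hg : HasJet g l') :
    HasJet (f * g) (mulJet l l') := by
  intro i hi
  have h1 : (mulJet l l').getD i 0 = ∑ j ∈ Finset.range (i + 1), l.getD j 0 * l'.getD (i - j) 0 := by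
    simp only [mulJet, List.getD_eq_getElem?_getD, List.getElem?_map, List.getElem?_range hi,
      Option.map_some, Option.getD_some]
    rw [Finset.sum_eq_multiset_sum]
    rfl
  rw [h1, coeff_mul, Finset.Nat.sum_antidiagonal_eq_sum_range_succ
    fun a b ↦ coeff a f * coeff b g]
  push_cast
  refine Finset.sum_congr rfl fun j hj ↦ ?_
  have := Finset.mem_range.1 hj
  rw [hf j (by omega), hg (i - j) (by omega)]

/-- Powers of a truncated power series. -/
def powJet (l : List ℤ) : ℕ → List ℤ
  | 0 => [1]
  | n + 1 => mulJet (powJet l n) l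

lemma HasJet.pow {f : PowerSeries ℂ} {l : List ℤ} (hf : HasJet f l) (n : ℕ) :
    HasJet (f ^ n) (powJet l n) := by
  induction n with
  | zero =>
    intro i hi
    interval_cases i <;> simp [powJet, coeff_one]
  | succ n ih =>
    rw [pow_succ]
    exact ih.mul hf

/-- The theta series of the lattice `𝓞`. -/
def thetaOne : PowerSeries ℂ := theta (1 : Matrix (Fin 1) (Fin 1) Eis)

lemma uni_one (n : ℕ) : Uni (1 : Matrix (Fin n) (Fin n) Eis) where
  herm := conjTranspose_one
  pos := by
    rw [toM_one]
    exact PosDef.one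
  det := det_one

lemma isFricke_thetaOne : IsFricke 1 thetaOne := (uni_one 1).isFricke_theta

lemma rep_one_one {m : ℕ} (hm : m < 7) : rep (1 : Matrix (Fin 1) (Fin 1) Eis) m =
    ((Finset.Icc (-3 : ℤ) 3 ×ˢ Finset.Icc (-3 : ℤ) 3).filter
      fun p : ℤ × ℤ ↦ p.1 ^ 2 - p.1 * p.2 + p.2 ^ 2 = (m : ℤ)).card := by
  rw [rep, ← Nat.card_eq_finsetCard]
  refine Nat.card_congr (((Equiv.funUnique (Fin 1) Eis).trans Eis.equivProd.symm).subtypeEquiv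
    fun x ↦ ?_)
  obtain ⟨p, hp⟩ := Eis.equivProd.surjective (x 0)
  have h1 : hb (1 : Matrix (Fin 1) (Fin 1) Eis) x x =
      ((p.1 ^ 2 - p.1 * p.2 + p.2 ^ 2 : ℤ) : Eis) := by
    simp only [hb, one_mulVec, dotProduct, Fin.sum_univ_one, Pi.star_apply]
    rw [← hp, Eis.equivProd_apply, Eis.star_mk, Eis.mk_mul, Eis.intCast_eq_mk]
    congr 1 <;> ring
  have h2 : ((Equiv.funUnique (Fin 1) Eis).trans Eis.equivProd.symm) x = p := by
    rw [Equiv.trans_apply, Equiv.funUnique_apply, Equiv.symm_apply_eq, hp]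
    rfl
  rw [h1, h2, ← Int.cast_natCast, Int.cast_inj, Finset.mem_filter, Finset.mem_product,
    Finset.mem_Icc, Finset.mem_Icc]
  refine ⟨fun h ↦ ⟨?_, h⟩, fun h ↦ h.2⟩
  have hm' : (m : ℤ) < 7 := by exact_mod_cast hm
  refine ⟨⟨?_, ?_⟩, ⟨?_, ?_⟩⟩ <;>
    nlinarith [sq_nonneg (p.1 - 2 * p.2), sq_nonneg (p.2 - 2 * p.1)]

lemma hasJet_thetaOne : HasJet thetaOne [1, 6, 0, 6, 6, 0, 0] := by
  intro i hi
  rw [thetaOne, theta, coeff_mk, rep_one_one hi]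
  norm_cast
  revert i
  decide +kernel

/-- The cusp form of weight six. -/
def cuspSix : PowerSeries ℂ := (13 / 216 : ℂ) • (thetaOne ^ 6 + (1 / 26 : ℂ) • frickeSix)

lemma isFricke_cuspSix : IsFricke 6 cuspSix :=
  ((by simpa using isFricke_thetaOne.pow 6 : IsFricke 6 (thetaOne ^ 6)).add
    (isFricke_frickeSix.smul _)).smul _

lemma hasJet_frickeSix :
    HasJet frickeSix [-26, -504, -16632, -109368, -532728, -1575504, -3609144] := by
  intro i hi
  have hs : ∀ j < 7, eisCoeff j =
      [1, -504, -16632, -122976, -532728, -1575504, -4058208].getD j 0 := by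
    decide +kernel
  simp only [frickeSix, eisSix, eisSixThree, map_add, coeff_smul, coeff_mk, hs i hi,
    hs (i / 3) (by omega)]
  interval_cases i <;> norm_num

lemma hasJet_cuspSix : HasJet cuspSix [0, 1, -6, 9, 4, 6, -54] := by
  intro i hi
  have h6 := hasJet_thetaOne.pow 6
  rw [show powJet [1, 6, 0, 6, 6, 0, 0] 6 =
    [1, 36, 540, 4356, 20556, 60696, 137916] by decide +kernel] at h6
  rw [cuspSix, coeff_smul, map_add, coeff_smul, h6 i hi, hasJet_frickeSix i hi]
  interval_cases i <;> norm_num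

end Jets

section PID

variable {R : Type*} [CommRing R]

lemma Matrix.isUnit_det_of_basis {n : ℕ} (b : Module.Basis (Fin n) R (Fin n → R)) :
    IsUnit (Matrix.of b).det := by
  have h := (Pi.basisFun R (Fin n)).isUnit_det b
  rwa [Module.Basis.det_apply, ← det_transpose] at h

variable [IsDomain R] [IsPrincipalIdealRing R]

/-- A vector on which a linear form takes the value `1` extends to a basis by vectors of the
kernel. -/
lemma exists_isUnit_det_row {n : ℕ} (y : Fin (n + 1) → R) (φ : (Fin (n + 1) → R) →ₗ[R] R)
    (h : φ y = 1) : ∃ U : Matrix (Fin (n + 1)) (Fin (n + 1)) R,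
      IsUnit U.det ∧ U 0 = y ∧ ∀ i : Fin n, φ (U i.succ) = 0 := by
  obtain ⟨m, b⟩ := Submodule.basisOfPid (Pi.basisFun R (Fin (n + 1))) (LinearMap.ker φ)
  let b' := Module.Basis.mkFinCons y b
    (fun c x hx e => by
      have := congrArg φ e
      rw [map_add, map_smul, h, LinearMap.mem_ker.1 hx] at this
      simpa using this)
    (fun z => ⟨-φ z, by simp [h]⟩)
  obtain rfl : m = n := by
    have := Module.finrank_eq_card_basis b'
    simpa using this.symm
  have hb' : (b' : Fin (m + 1) → Fin (m + 1) → R) = Fin.cons y (Subtype.val ∘ b) :=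
    Module.Basis.coe_mkFinCons _ _ _ _
  refine ⟨Matrix.of b', isUnit_det_of_basis b', ?_, fun i => ?_⟩
  · change b' 0 = y
    rw [hb']
    rfl
  · change φ (b' i.succ) = 0
    rw [hb']
    exact (b i).2

/-- Every nonzero vector is a multiple of a member of a basis. -/
lemma exists_smul_row {n : ℕ} {v : Fin (n + 1) → R} (hv : v ≠ 0) :
    ∃ (U : Matrix (Fin (n + 1)) (Fin (n + 1)) R) (g : R), IsUnit U.det ∧ v = g • U 0 := by
  obtain ⟨g, hg⟩ := IsPrincipalIdealRing.principal (Ideal.span (Set.range v))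
  have h1 : ∀ i, ∃ w, v i = w * g := fun i => by
    have : v i ∈ Ideal.span (Set.range v) := Ideal.subset_span ⟨i, rfl⟩
    rw [hg] at this
    obtain ⟨w, hw⟩ := Submodule.mem_span_singleton.1 this
    exact ⟨w, hw.symm⟩
  choose w hw using h1
  have hg0 : g ≠ 0 := by
    rintro rfl
    exact hv (funext fun i => by simp [hw])
  have h2 : g ∈ Ideal.span (Set.range v) := by
    rw [hg]; exact Submodule.mem_span_singleton_self g
  obtain ⟨c, hc⟩ := (Ideal.mem_span_range_iff_exists_fun).1 h2
  let φ : (Fin (n + 1) → R) →ₗ[R] R := Fintype.linearCombination R c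
  have hφ : ∀ x, φ x = ∑ i, x i * c i := fun x => by simp [φ, Fintype.linearCombination_apply]
  have hφw : φ w = 1 := by
    apply mul_right_cancel₀ hg0
    rw [hφ, Finset.sum_mul, one_mul]
    conv_rhs => rw [← hc]
    refine Finset.sum_congr rfl fun i _ => ?_
    rw [hw i]
    ring
  obtain ⟨U, hU, h0, -⟩ := exists_isUnit_det_row w φ hφw
  exact ⟨U, g, hU, by rw [h0]; ext i; simp [hw i, mul_comm]⟩

end PID

lemma Eis.normSq_of_isUnit {u : Eis} (hu : IsUnit u) : Complex.normSq (u : ℂ) = 1 := by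
  obtain ⟨v, hv⟩ := hu.exists_right_inv
  have hu0 := Eis.one_le_normSq hu.ne_zero
  have hv0 := Eis.one_le_normSq (right_ne_zero_of_mul_eq_one hv)
  have : Complex.normSq (u : ℂ) * Complex.normSq (v : ℂ) = 1 := by
    rw [← Complex.normSq_mul]
    have := congrArg (fun z : Eis => (z : ℂ)) hv
    simp only [MulMemClass.coe_mul, OneMemClass.coe_one] at this
    rw [this, map_one]
  nlinarith

lemma vC_vecMul {m n : ℕ} (x : Fin m → Eis) (U : Matrix (Fin m) (Fin n) Eis) :
    vC (x ᵥ* U) = vC x ᵥ* toM U := by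
  ext i
  simp [vecMul, dotProduct]

lemma hq_conj {m n : ℕ} (H : Matrix (Fin n) (Fin n) ℂ) (U : Matrix (Fin m) (Fin n) ℂ)
    (x : Fin m → ℂ) : hq (U * H * Uᴴ) x = hq H (x ᵥ* U) := by
  rw [hq, hq, sum_eq_star_dotProduct, sum_eq_star_dotProduct, star_star, star_star,
    ← mulVec_mulVec, ← mulVec_mulVec, dotProduct_mulVec, star_vecMul]

lemma det_conj {n : ℕ} {U : Matrix (Fin n) (Fin n) Eis} (hU : IsUnit U.det)
    (H : Matrix (Fin n) (Fin n) ℂ) : (toM U * H * (toM U)ᴴ).det = H.det := by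
  rw [det_mul, det_mul, det_conjTranspose, det_toM, mul_right_comm, RCLike.star_def,
    Complex.mul_conj, Eis.normSq_of_isUnit hU]
  simp

lemma posDef_conj {n : ℕ} {U : Matrix (Fin n) (Fin n) Eis} (hU : U.det ≠ 0)
    {H : Matrix (Fin n) (Fin n) ℂ} (hH : H.PosDef) : (toM U * H * (toM U)ᴴ).PosDef := by
  refine posDef_iff_hq.2 ⟨isHermitian_mul_mul_conjTranspose _ hH.1, fun x hx => ?_⟩
  rw [hq_conj]
  refine (posDef_iff_hq.1 hH).2 _ fun h => hx ?_
  have hdet : (toM U).det ≠ 0 := by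
    rw [det_toM]
    intro h
    exact hU (Subtype.ext h)
  exact eq_zero_of_vecMul_eq_zero hdet h

lemma exists_min_hq {n : ℕ} {H : Matrix (Fin (n + 1)) (Fin (n + 1)) ℂ} (hH : H.PosDef) :
    ∃ v : Fin (n + 1) → Eis, v ≠ 0 ∧ ∀ x : Fin (n + 1) → Eis, x ≠ 0 →
      hq H (vC v) ≤ hq H (vC x) := by
  set e : Fin (n + 1) → Eis := Pi.single 0 1
  have hfin := (finite_hq_le hH (hq H (vC e))).inter_of_left {x | x ≠ 0}
  obtain ⟨v, hv, hmin⟩ := Set.exists_min_image _ (fun x => hq H (vC x)) hfin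
    ⟨e, (by simp : hq H (vC e) ≤ hq H (vC e)), (by simp [e] : e ≠ 0)⟩
  refine ⟨v, hv.2, fun x hx => ?_⟩
  by_cases h : hq H (vC x) ≤ hq H (vC e)
  · exact hmin x ⟨h, hx⟩
  · exact (le_of_not_ge h).trans' hv.1

/-- Hermite reduction: a lattice with bounded determinant has a basis of bounded vectors. -/
lemma exists_reduced_basis (n : ℕ) : ∀ m₀ : ℝ, 0 < m₀ → ∀ D : ℝ, ∃ B : ℝ, 0 ≤ B ∧
    ∀ H : Matrix (Fin n) (Fin n) ℂ, H.PosDef →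
      (∀ x : Fin n → Eis, x ≠ 0 → m₀ ≤ hq H (vC x)) → H.det.re ≤ D →
      ∃ U : Matrix (Fin n) (Fin n) Eis, IsUnit U.det ∧ ∀ i, hq H (vC (U i)) ≤ B := by
  induction n with
  | zero => exact fun _ _ _ => ⟨0, le_rfl, fun _ _ _ _ => ⟨1, by simp, fun i => i.elim0⟩⟩
  | succ n ih =>
  intro m₀ hm₀ D
  obtain ⟨B, hB, ih⟩ := ih (9 / 16 * m₀) (by positivity) (max D 0 / m₀)
  refine ⟨max D (16 / 9 * B) + B, by positivity, fun H hH hmin hdet => ?_⟩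
  obtain ⟨v, hv0, hv⟩ := exists_min_hq hH
  obtain ⟨U₁, g, hU₁, hvg⟩ := exists_smul_row hv0
  have hg0 : g ≠ 0 := by rintro rfl; simp at hvg; exact hv0 hvg
  have hw0 : U₁ 0 ≠ 0 := by intro h; rw [h] at hvg; simp at hvg; exact hv0 hvg
  have hpos := (posDef_iff_hq.1 hH).2
  have hvC0 : ∀ {k : ℕ} {x : Fin k → Eis}, x ≠ 0 → vC x ≠ 0 := fun hx h =>
    hx (vC_injective (h.trans vC_zero.symm))
  have hw : hq H (vC (U₁ 0)) ≤ hq H (vC v) := by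
    have e : vC v = (g : ℂ) • vC (U₁ 0) := by rw [hvg]; ext; simp
    rw [e, hq_smul]
    nlinarith [Eis.one_le_normSq hg0, hpos _ (hvC0 hw0)]
  set H₁ := toM U₁ * H * (toM U₁)ᴴ with hH₁
  have hH₁pos : H₁.PosDef := posDef_conj hU₁.ne_zero hH
  have hq₁ : ∀ x : Fin (n + 1) → Eis, hq H₁ (vC x) = hq H (vC (x ᵥ* U₁)) := fun x => by
    rw [hq_conj, vC_vecMul]
  have hinj : ∀ x : Fin (n + 1) → Eis, x ≠ 0 → x ᵥ* U₁ ≠ 0 := fun x hx h =>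
    hx (eq_zero_of_vecMul_eq_zero hU₁.ne_zero h)
  obtain ⟨hm, hm'⟩ := apply_zero_zero_pos hH₁pos
  set m := (H₁ 0 0).re with hmdef
  have hqm : m = hq H (vC (U₁ 0)) := by
    have := hq₁ (Pi.single 0 1)
    rw [single_one_vecMul] at this
    rw [hmdef]
    change _ = hq H (vC (U₁.row 0))
    rw [← this]
    simp [hq, Pi.single_apply, apply_ite]
  have hm₁ : ∀ x : Fin (n + 1) → Eis, x ≠ 0 → m ≤ hq H₁ (vC x) := fun x hx => by
    rw [hq₁, hqm]
    exact hw.trans (hv _ (hinj x hx))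
  have hmm₀ : m₀ ≤ m := by rw [hqm]; exact hmin _ hw0
  have hround : ∀ y : Fin n → Eis, ∃ a : Eis,
      hq H₁ (vC (Fin.cons a y : Fin (n + 1) → Eis)) ≤ 7 / 16 * m + hq (schur H₁) (vC y) := by
    intro y
    obtain ⟨a, ha⟩ := Eis.exists_normSq_sub_le (∑ i, vC y i * H₁ i.succ 0 / m)
    refine ⟨-a, ?_⟩
    rw [vC_cons, hq_cons hH₁pos]
    rw [← hmdef]
    have : ((-a : Eis) : ℂ) + ∑ i, vC y i * H₁ i.succ 0 / m =
      ∑ i, vC y i * H₁ i.succ 0 / m - a := by push_cast; ring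
    rw [this]
    nlinarith
  have hSmin : ∀ y : Fin n → Eis, y ≠ 0 → 9 / 16 * m ≤ hq (schur H₁) (vC y) := fun y hy => by
    obtain ⟨a, ha⟩ := hround y
    have := hm₁ (Fin.cons a y) (fun h => hy (funext fun i => by simpa using congrFun h i.succ))
    linarith
  have hdet₁ : H₁.det.re = m * (schur H₁).det.re := by
    rw [det_eq_mul_det_schur (by rw [← hm']; exact_mod_cast hm.ne'), ← hm',
      Complex.re_ofReal_mul]
  have hdetH : H₁.det = H.det := det_conj hU₁ H
  obtain ⟨U', hU', hUB⟩ := ih (schur H₁) (schur_posDef hH₁pos)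
    (fun y hy => (hSmin y hy).trans' (by linarith)) (by
      rw [le_div_iff₀ hm₀]
      rcases le_total 0 (schur H₁).det.re with h | h
      · refine le_max_of_le_left ?_
        rw [hdetH] at hdet₁
        nlinarith
      · refine le_max_of_le_right ?_
        nlinarith)
  have hmB : m ≤ max D (16 / 9 * B) := by
    rcases n with _ | n
    · refine le_max_of_le_left ?_
      rw [hdetH] at hdet₁
      rw [det_isEmpty (A := schur H₁), Complex.one_re, mul_one] at hdet₁
      linarith
    · refine le_max_of_le_right ?_
      have h0 : U' 0 ≠ 0 := fun h => hU'.ne_zero (det_eq_zero_of_row_eq_zero 0 (congrFun h))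
      have := hSmin _ h0
      have := hUB 0
      linarith
  choose a ha using fun i => hround (U' i)
  let U₂ : Matrix (Fin (n + 1)) (Fin (n + 1)) Eis :=
    Matrix.of (Fin.cons (Pi.single 0 1) fun i => Fin.cons (a i) (U' i))
  have hU₂ : U₂.det = U'.det := by
    rw [det_succ_row_zero, Finset.sum_eq_single 0]
    · simp only [U₂, of_apply, Fin.cons_zero, Pi.single_eq_same, Fin.val_zero, pow_zero, mul_one,
        one_mul]
      congr 1
    · intro j _ hj
      simp [U₂, Pi.single_eq_of_ne hj]
    · simp
  refine ⟨U₂ * U₁, by rw [det_mul, hU₂]; exact hU'.mul hU₁, fun i => ?_⟩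
  have e : (U₂ * U₁) i = U₂ i ᵥ* U₁ := rfl
  rw [e, ← hq₁]
  refine Fin.cases ?_ (fun i => ?_) i
  · have : hq H₁ (vC (U₂ 0)) = m := by
      rw [hqm, hq₁]
      change hq H (vC (Pi.single 0 1 ᵥ* U₁)) = _
      rw [single_one_vecMul]
      rfl
    rw [this]
    linarith
  · have := ha i
    have := hUB i
    change hq H₁ (vC (Fin.cons (a i) (U' i) : Fin (n + 1) → Eis)) ≤ _
    linarith

section Classes

variable {n : ℕ}

lemma conj_apply {m : ℕ} (P : Matrix (Fin m) (Fin n) Eis) (H : Matrix (Fin n) (Fin n) Eis)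
    (i j : Fin m) : (P * H * Pᴴ) i j = hb H (P i) (P j) := by
  rw [Matrix.mul_assoc, mul_apply_eq_vecMul, vecMul, hb]
  rfl

lemma hb_conj {m : ℕ} (P : Matrix (Fin m) (Fin n) Eis) (H : Matrix (Fin n) (Fin n) Eis)
    (x y : Fin m → Eis) : hb (P * H * Pᴴ) x y = hb H (x ᵥ* P) (y ᵥ* P) := by
  rw [hb, hb, ← mulVec_mulVec, ← mulVec_mulVec, dotProduct_mulVec, star_vecMul]

/-- Isometry of hermitian Gram matrices over the Eisenstein integers. -/
def Iso (H H' : Matrix (Fin n) (Fin n) Eis) : Prop :=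
  ∃ U : Matrix (Fin n) (Fin n) Eis, IsUnit U.det ∧ U * H * Uᴴ = H'

lemma transform_mul {l m : ℕ} (V : Matrix (Fin l) (Fin m) Eis) (U : Matrix (Fin m) (Fin n) Eis)
    (H : Matrix (Fin n) (Fin n) Eis) : (V * U) * H * (V * U)ᴴ = V * (U * H * Uᴴ) * Vᴴ := by
  rw [conjTranspose_mul]
  simp only [Matrix.mul_assoc]

lemma Iso.refl (H : Matrix (Fin n) (Fin n) Eis) : Iso H H := ⟨1, by simp, by simp⟩

lemma Iso.trans {H H' H'' : Matrix (Fin n) (Fin n) Eis} (h : Iso H H') (h' : Iso H' H'') :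
    Iso H H'' := by
  obtain ⟨U, hU, rfl⟩ := h
  obtain ⟨V, hV, rfl⟩ := h'
  exact ⟨V * U, by rw [det_mul]; exact hV.mul hU, transform_mul V U H⟩

lemma transform_inv {U H H' : Matrix (Fin n) (Fin n) Eis} (hU : IsUnit U.det) (h : U * H * Uᴴ = H') :
    U⁻¹ * H' * U⁻¹ᴴ = H := by
  rw [← h, ← transform_mul, nonsing_inv_mul _ hU]
  simp

lemma isUnit_det_inv {U : Matrix (Fin n) (Fin n) Eis} (hU : IsUnit U.det) : IsUnit U⁻¹.det := by
  rw [det_nonsing_inv]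
  exact hU.ringInverse

lemma Iso.symm {H H' : Matrix (Fin n) (Fin n) Eis} (h : Iso H H') : Iso H' H := by
  obtain ⟨U, hU, h⟩ := h
  exact ⟨U⁻¹, isUnit_det_inv hU, transform_inv hU h⟩

lemma Eis.mul_star_of_isUnit {u : Eis} (hu : IsUnit u) : u * star u = 1 := by
  apply Eis.coe_injective
  have := Complex.mul_conj (u : ℂ)
  rw [Eis.normSq_of_isUnit hu] at this
  simpa using this

lemma Uni.conj {H : Matrix (Fin n) (Fin n) Eis} (hH : Uni H) {U : Matrix (Fin n) (Fin n) Eis}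
    (hU : IsUnit U.det) : Uni (U * H * Uᴴ) where
  herm := by simp [conjTranspose_mul, hH.herm, Matrix.mul_assoc]
  pos := by
    rw [toM_mul, toM_mul, toM_conjTranspose]
    exact posDef_conj hU.ne_zero hH.pos
  det := by rw [det_mul, det_mul, det_conjTranspose, hH.det, mul_one, Eis.mul_star_of_isUnit hU]

/-- The order of the automorphism group. -/
def autC (H : Matrix (Fin n) (Fin n) Eis) : ℕ :=
  Nat.card {U : Matrix (Fin n) (Fin n) Eis // IsUnit U.det ∧ U * H * Uᴴ = H}

lemma Uni.finite_conj {H : Matrix (Fin n) (Fin n) Eis} (hH : Uni H) {m : ℕ}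
    (H' : Matrix (Fin m) (Fin m) Eis) :
    {P : Matrix (Fin m) (Fin n) Eis | P * H * Pᴴ = H'}.Finite := by
  refine (Set.Finite.pi' fun i => finite_hq_le hH.pos (H' i i : ℂ).re).subset fun (P : Matrix (Fin m) (Fin n) Eis) hP i => ?_
  have h : P * H * Pᴴ = H' := hP
  have := coe_hb_self hH.herm (P i)
  rw [← conj_apply, h] at this
  change hq _ (vC (P i)) ≤ _
  rw [this, Complex.ofReal_re]

lemma Uni.finite_iso {H : Matrix (Fin n) (Fin n) Eis} (hH : Uni H)
    (H' : Matrix (Fin n) (Fin n) Eis) :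
    Finite {U : Matrix (Fin n) (Fin n) Eis // IsUnit U.det ∧ U * H * Uᴴ = H'} :=
  ((hH.finite_conj H').subset fun _ h => h.2).to_subtype

lemma Uni.autC_pos {H : Matrix (Fin n) (Fin n) Eis} (hH : Uni H) : 0 < autC H := by
  have := hH.finite_iso H
  exact Nat.card_pos_iff.2 ⟨⟨⟨1, by simp, by simp⟩⟩, this⟩

lemma card_iso {H H' : Matrix (Fin n) (Fin n) Eis} (h : Iso H H') :
    Nat.card {U : Matrix (Fin n) (Fin n) Eis // IsUnit U.det ∧ U * H * Uᴴ = H'} = autC H := by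
  obtain ⟨V, hV, hVH⟩ := h
  refine Nat.card_congr
    { toFun U := ⟨V⁻¹ * U.1, by rw [det_mul]; exact (isUnit_det_inv hV).mul U.2.1, by
        rw [transform_mul, U.2.2, transform_inv hV hVH]⟩
      invFun U := ⟨V * U.1, by rw [det_mul]; exact hV.mul U.2.1, by rw [transform_mul, U.2.2, hVH]⟩
      left_inv U := Subtype.ext (by simp [mul_nonsing_inv_cancel_left _ _ hV])
      right_inv U := Subtype.ext (by simp [nonsing_inv_mul_cancel_left _ _ hV]) }

lemma Uni.normSq_hb_le {H : Matrix (Fin n) (Fin n) Eis} (hH : Uni H) {x y : Fin n → Eis} {B : ℕ}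
    (hB : 0 < B) (hx : normNat H x ≤ B) (hy : normNat H y ≤ B) :
    Complex.normSq (hb H x y : ℂ) ≤ B ^ 2 := by
  have h := hH.hb_self ((-star (hb H x y)) • x + (B : Eis) • y)
  rw [hb_add_left, hb_add_right, hb_add_right] at h
  simp only [hb_smul_left, hb_smul_right, ← hb_star hH.herm x y] at h
  rw [hH.hb_self x, hH.hb_self y] at h
  have h' := congrArg (fun z : Eis => (z : ℂ)) h
  simp only [AddMemClass.coe_add, MulMemClass.coe_mul, Eis.coe_natCast, star_neg, star_star,
    NegMemClass.coe_neg, star_natCast, Eis.coe_star] at h'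
  have hz : star (hb H x y : ℂ) = (starRingEnd ℂ) (hb H x y : ℂ) := rfl
  set z : ℂ := (hb H x y : ℂ)
  set N := normNat H ((-star (hb H x y)) • x + (B : Eis) • y)
  have hzz := Complex.mul_conj z
  rw [hz] at h'
  have e : ((Complex.normSq z * normNat H x - 2 * B * Complex.normSq z + B ^ 2 * normNat H y : ℝ) : ℂ)
      = (N : ℝ) := by
    push_cast
    rw [← hzz, ← h']
    ring
  have e' := Complex.ofReal_injective e
  have hN : (0 : ℝ) ≤ N := by positivity
  have hx' : (normNat H x : ℝ) ≤ B := by exact_mod_cast hx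
  have hy' : (normNat H y : ℝ) ≤ B := by exact_mod_cast hy
  have hBpos : (0 : ℝ) < B := by exact_mod_cast hB
  have hnn := Complex.normSq_nonneg z
  have h1 : Complex.normSq z * normNat H x ≤ Complex.normSq z * B :=
    mul_le_mul_of_nonneg_left hx' hnn
  have h2 : (B : ℝ) ^ 2 * normNat H y ≤ B ^ 2 * B := mul_le_mul_of_nonneg_left hy' (by positivity)
  have h3 : Complex.normSq z * B ≤ B ^ 2 * B := by nlinarith
  exact le_of_mul_le_mul_right h3 hBpos

/-- Isometry as a relation on unimodular Gram matrices. -/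
def uniSetoid (n : ℕ) : Setoid {H : Matrix (Fin n) (Fin n) Eis // Uni H} where
  r H H' := Iso H.1 H'.1
  iseqv := ⟨fun _ => Iso.refl _, Iso.symm, Iso.trans⟩

/-- Isometry classes of unimodular lattices of rank `n`. -/
abbrev UniClass (n : ℕ) : Type := Quotient (uniSetoid n)

lemma normNat_pos {H : Matrix (Fin n) (Fin n) Eis} (hH : Uni H) {x : Fin n → Eis} (hx : x ≠ 0) :
    1 ≤ normNat H x := by
  have := (posDef_iff_hq.1 hH.pos).2 (vC x) fun h => hx (vC_injective (h.trans vC_zero.symm))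
  rw [hH.hq_eq] at this
  exact_mod_cast this

instance (n : ℕ) : Finite (UniClass n) := by
  obtain ⟨B, -, hB⟩ := exists_reduced_basis n 1 one_pos 1
  set C := ⌈B⌉₊ + 1
  have hfin : {H : Matrix (Fin n) (Fin n) Eis |
      ∀ i, H i ∈ {r : Fin n → Eis | ∀ j, r j ∈ {z : Eis | Complex.normSq (z : ℂ) ≤ C ^ 2}}}.Finite :=
    Set.Finite.pi' fun i => Set.Finite.pi' fun j => Eis.finite_normSq_le _
  have := (hfin.inter_of_left {H | Uni H}).to_subtype
  refine Finite.of_surjective (α := ↥({H : Matrix (Fin n) (Fin n) Eis |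
      ∀ i, H i ∈ {r : Fin n → Eis | ∀ j, r j ∈ {z : Eis | Complex.normSq (z : ℂ) ≤ C ^ 2}}} ∩
      {H | Uni H})) (fun H => Quotient.mk (uniSetoid n) ⟨H.1, H.2.2⟩) fun c => ?_
  induction c using Quotient.inductionOn with | _ H
  obtain ⟨H, hH⟩ := H
  obtain ⟨U, hU, hUB⟩ := hB (toM H) hH.pos
    (fun x hx => by rw [hH.hq_eq]; exact_mod_cast normNat_pos hH hx)
    (by rw [det_toM, hH.det]; simp)
  refine ⟨⟨U * H * Uᴴ, fun i j => ?_, hH.conj hU⟩, Quotient.sound (Iso.symm ⟨U, hU, rfl⟩)⟩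
  change Complex.normSq (((U * H * Uᴴ) i j : Eis) : ℂ) ≤ C ^ 2
  rw [conj_apply]
  have hb : ∀ i, normNat H (U i) ≤ C := fun i => by
    have := hUB i
    rw [hH.hq_eq] at this
    have h2 : (normNat H (U i) : ℝ) ≤ ⌈B⌉₊ := this.trans (Nat.le_ceil B)
    have h3 : normNat H (U i) ≤ ⌈B⌉₊ := by exact_mod_cast h2
    omega
  exact hH.normSq_hb_le (Nat.succ_pos _) (hb i) (hb j)

instance (n : ℕ) : Fintype (UniClass n) := Fintype.ofFinite _

/-- A Gram matrix representing a class. -/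
def classGram (c : UniClass n) : Matrix (Fin n) (Fin n) Eis := (Quotient.out c).1

lemma gram_uni (c : UniClass n) : Uni (classGram c) := (Quotient.out c).2

lemma Uni.exists_iso_gram {H : Matrix (Fin n) (Fin n) Eis} (hH : Uni H) :
    ∃ c, Iso (classGram c) H :=
  ⟨Quotient.mk (uniSetoid n) ⟨H, hH⟩,
    Quotient.exact (s := uniSetoid n) (Quotient.out_eq (Quotient.mk (uniSetoid n) ⟨H, hH⟩))⟩

lemma eq_of_iso_gram {a b : UniClass n} (h : Iso (classGram a) (classGram b)) : a = b :=
  Quotient.out_equiv_out.1 h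

/-- The sum of `f` over the classes, weighted by inverse orders of automorphism groups. -/
def avg (n : ℕ) (f : Matrix (Fin n) (Fin n) Eis → ℚ) : ℚ := ∑ c : UniClass n, f (classGram c) / autC (classGram c)

lemma autC_gram_ne_zero (c : UniClass n) : (autC (classGram c) : ℚ) ≠ 0 := by
  exact_mod_cast (gram_uni c).autC_pos.ne'

end Classes

/-- Counting by fibres which are torsors under groups of order `G c`. -/
lemma sum_card_div {ι X : Type*} [Fintype ι] (T : ι → Type*) [∀ c, Finite (T c)]
    (G : ι → ℕ) (f : ∀ c, T c → X)
    (h : ∀ x, ∃ c, G c ≠ 0 ∧ Nat.card {t : T c // f c t = x} = G c ∧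
      ∀ c', c' ≠ c → ∀ t : T c', f c' t ≠ x) :
    ∑ c, (Nat.card (T c) : ℚ) / G c = Nat.card X := by
  classical
  have hsurj : Function.Surjective fun s : Sigma T => f s.1 s.2 := fun x => by
    obtain ⟨c, h0, hc, -⟩ := h x
    obtain ⟨t⟩ := (Nat.card_ne_zero.1 (hc ▸ h0)).1
    exact ⟨⟨c, t.1⟩, t.2⟩
  have := Finite.of_surjective _ hsurj
  have := Fintype.ofFinite X
  have h1 : ∀ c, Nat.card (T c) = ∑ x, Nat.card {t : T c // f c t = x} := fun c => by
    rw [← Nat.card_sigma]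
    exact Nat.card_congr (Equiv.sigmaFiberEquiv (f c)).symm
  simp_rw [h1, Nat.cast_sum, Finset.sum_div]
  rw [Finset.sum_comm, Nat.card_eq_fintype_card, Fintype.card_eq_sum_ones, Nat.cast_sum]
  refine Finset.sum_congr rfl fun x _ => ?_
  obtain ⟨c, h0, hc, hc'⟩ := h x
  rw [Finset.sum_eq_single c, hc, div_self (by exact_mod_cast h0), Nat.cast_one]
  · intro c' _ hcc
    have : IsEmpty {t : T c' // f c' t = x} := ⟨fun t => hc' c' hcc t.1 t.2⟩
    simp
  · simp

section OneAdd

variable {n : ℕ}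

/-- The orthogonal sum of the unit form of rank one and `K`. -/
def oneAdd {R : Type*} [CommRing R] (K : Matrix (Fin n) (Fin n) R) :
    Matrix (Fin (n + 1)) (Fin (n + 1)) R :=
  Matrix.of (Fin.cons (Pi.single 0 1) fun i => Fin.cons 0 (K i))

lemma oneAdd_ext {R : Type*} {A B : Matrix (Fin (n + 1)) (Fin (n + 1)) R} (h00 : A 0 0 = B 0 0)
    (h0 : ∀ j : Fin n, A 0 j.succ = B 0 j.succ) (h1 : ∀ i : Fin n, A i.succ 0 = B i.succ 0)
    (h2 : ∀ i j : Fin n, A i.succ j.succ = B i.succ j.succ) : A = B := by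
  ext i j
  refine Fin.cases ?_ (fun i => ?_) i <;> refine Fin.cases ?_ (fun j => ?_) j
  exacts [h00, h0 j, h1 i, h2 i j]

section Ring

variable {R : Type*} [CommRing R] (K V : Matrix (Fin n) (Fin n) R)

@[simp] lemma oneAdd_zero_zero : oneAdd K 0 0 = 1 := rfl

@[simp] lemma oneAdd_zero_succ (j : Fin n) : oneAdd K 0 j.succ = 0 := rfl

@[simp] lemma oneAdd_succ_zero (i : Fin n) : oneAdd K i.succ 0 = 0 := rfl

@[simp] lemma oneAdd_succ_succ (i j : Fin n) : oneAdd K i.succ j.succ = K i j := rfl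

lemma oneAdd_row_zero : oneAdd K 0 = Pi.single 0 1 := rfl

lemma oneAdd_mul : oneAdd K * oneAdd V = oneAdd (K * V) := by
  apply oneAdd_ext <;> intros <;> simp [Matrix.mul_apply, Fin.sum_univ_succ]

lemma det_oneAdd : (oneAdd K).det = K.det := by
  rw [det_succ_row_zero, Finset.sum_eq_single 0]
  · simp only [oneAdd_zero_zero, Fin.val_zero, pow_zero, one_mul]
    congr 1
  · intro j _ hj
    obtain ⟨k, rfl⟩ := Fin.exists_succ_eq.2 hj
    simp
  · simp

variable {K V} in
lemma oneAdd_injective (h : oneAdd K = oneAdd V) : K = V := by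
  ext i j
  exact congrFun (congrFun h i.succ) j.succ

lemma oneAdd_conjTranspose [StarRing R] : (oneAdd K)ᴴ = oneAdd Kᴴ := by
  apply oneAdd_ext <;> intros <;> simp

end Ring

lemma toM_oneAdd (K : Matrix (Fin n) (Fin n) Eis) : toM (oneAdd K) = oneAdd (toM K) := by
  apply oneAdd_ext <;> intros <;> simp

lemma hq_oneAdd (K : Matrix (Fin n) (Fin n) ℂ) (x : Fin (n + 1) → ℂ) :
    hq (oneAdd K) x = Complex.normSq (x 0) + hq K (fun i => x i.succ) := by
  simp [hq, Fin.sum_univ_succ, Complex.mul_conj, Complex.normSq_apply]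

lemma uni_oneAdd_iff {K : Matrix (Fin n) (Fin n) Eis} : Uni (oneAdd K) ↔ Uni K := by
  constructor
  · intro h
    refine ⟨oneAdd_injective (by rw [← oneAdd_conjTranspose, h.herm]), ?_, by
      rw [← det_oneAdd, h.det]⟩
    have hp := h.pos
    rw [toM_oneAdd, posDef_iff_hq] at hp
    refine posDef_iff_hq.2 ⟨oneAdd_injective ((oneAdd_conjTranspose _).symm.trans hp.1),
      fun x hx => ?_⟩
    have := hp.2 (Fin.cons 0 x) fun h => hx (funext fun i => by simpa using congrFun h i.succ)
    simpa [hq_oneAdd] using this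
  · intro h
    refine ⟨by rw [oneAdd_conjTranspose, h.herm], ?_, by rw [det_oneAdd, h.det]⟩
    have hp := posDef_iff_hq.1 h.pos
    rw [toM_oneAdd]
    refine posDef_iff_hq.2 ⟨(oneAdd_conjTranspose _).trans (congrArg oneAdd hp.1), fun x hx => ?_⟩
    rw [hq_oneAdd]
    by_cases h0 : (fun i : Fin n => x i.succ) = 0
    · rw [h0, hq_zero, add_zero]
      refine Complex.normSq_pos.2 fun hx0 => hx (funext fun i => ?_)
      exact Fin.cases hx0 (fun i => congrFun h0 i) i
    · exact add_pos_of_nonneg_of_pos (Complex.normSq_nonneg _) (hp.2 _ h0)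

lemma hb_single_right (H : Matrix (Fin (n + 1)) (Fin (n + 1)) Eis) (x : Fin (n + 1) → Eis) :
    hb H x (Pi.single 0 1) = (x ᵥ* H) 0 := by
  rw [hb, ← Pi.single_star, star_one, mulVec_single_one, dotProduct]
  rfl

/-- An isometry of orthogonal sums fixing the first vector splits. -/
lemma eq_oneAdd_of_row {K K' : Matrix (Fin n) (Fin n) Eis}
    {W : Matrix (Fin (n + 1)) (Fin (n + 1)) Eis} (hW : W * oneAdd K * Wᴴ = oneAdd K')
    (h0 : W 0 = Pi.single 0 1) : ∃ V, W = oneAdd V ∧ V * K * Vᴴ = K' := by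
  have h1 : ∀ i : Fin n, W i.succ 0 = 0 := fun i => by
    have := conj_apply W (oneAdd K) i.succ 0
    rw [hW, h0, hb_single_right, oneAdd_succ_zero] at this
    rw [this]
    simp [vecMul, dotProduct, Fin.sum_univ_succ]
  have hV : W = oneAdd (W.submatrix Fin.succ Fin.succ) := by
    apply oneAdd_ext <;> intros <;> simp [h0, h1]
  refine ⟨_, hV, ?_⟩
  rw [hV, oneAdd_conjTranspose, oneAdd_mul, oneAdd_mul] at hW
  exact oneAdd_injective hW

/-- Splitting off a vector of norm one. -/
lemma Uni.exists_split {H : Matrix (Fin (n + 1)) (Fin (n + 1)) Eis} (hH : Uni H)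
    {v : Fin (n + 1) → Eis} (hv : hb H v v = 1) :
    ∃ (b : UniClass n) (U : Matrix (Fin (n + 1)) (Fin (n + 1)) Eis),
      IsUnit U.det ∧ U * H * Uᴴ = oneAdd (classGram b) ∧ U 0 = v := by
  obtain ⟨U, hU, hU0, hUi⟩ := exists_isUnit_det_row v
    { toFun x := hb H x v
      map_add' x y := hb_add_left x y v
      map_smul' c x := hb_smul_left c x v } hv
  have hUi' : ∀ i : Fin n, hb H (U i.succ) v = 0 := hUi
  set K := (U * H * Uᴴ).submatrix Fin.succ Fin.succ
  have hK : U * H * Uᴴ = oneAdd K := by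
    apply oneAdd_ext
    · rw [conj_apply, hU0, hv]; rfl
    · intro j
      rw [conj_apply, hU0, ← hb_star hH.herm, hUi']
      simp
    · intro i
      rw [conj_apply, hU0, hUi']
      rfl
    · intro i j
      rfl
  have hKu : Uni K := uni_oneAdd_iff.1 (hK ▸ hH.conj hU)
  obtain ⟨b, hb⟩ := hKu.exists_iso_gram
  obtain ⟨V, hV, hVK⟩ := hb.symm
  refine ⟨b, oneAdd V * U, by rw [det_mul, det_oneAdd]; exact hV.mul hU, ?_, ?_⟩
  · rw [transform_mul, hK, oneAdd_conjTranspose, oneAdd_mul, oneAdd_mul, hVK]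
  · change oneAdd V 0 ᵥ* U = v
    rw [oneAdd_row_zero, single_one_vecMul]
    exact hU0

/-- Transporters from `H` to `H'`. -/
abbrev IsoSet {n : ℕ} (H H' : Matrix (Fin n) (Fin n) Eis) : Type :=
  {U : Matrix (Fin n) (Fin n) Eis // IsUnit U.det ∧ U * H * Uᴴ = H'}

lemma Uni.sum_card_trans_right {H : Matrix (Fin (n + 1)) (Fin (n + 1)) Eis} (hH : Uni H) :
    ∑ b : UniClass n, (Nat.card (IsoSet H (oneAdd (classGram b))) : ℚ) / autC (classGram b) = rep H 1 := by
  have h2 := fun b : UniClass n => hH.finite_iso (oneAdd (classGram b))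
  refine sum_card_div (X := {x : Fin (n + 1) → Eis // hb H x x = (1 : ℕ)}) _ _
    (fun b U => ⟨U.1 0, by rw [← conj_apply, U.2.2]; simp⟩) fun ⟨v, hv⟩ => ?_
  rw [Nat.cast_one] at hv
  obtain ⟨b, U, hU, hUH, hU0⟩ := hH.exists_split hv
  have key : ∀ {b' : UniClass n} (U' : IsoSet H (oneAdd (classGram b'))), U'.1 0 = v →
      ∃ V, IsUnit V.det ∧ U'.1 = oneAdd V * U ∧ V * classGram b * Vᴴ = classGram b' := by
    intro b' U' h'
    have hW : (U'.1 * U⁻¹) * oneAdd (classGram b) * (U'.1 * U⁻¹)ᴴ = oneAdd (classGram b') := by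
      rw [transform_mul, transform_inv hU hUH, U'.2.2]
    obtain ⟨V, hV, hVb⟩ := eq_oneAdd_of_row hW (by
      change U'.1 0 ᵥ* U⁻¹ = _
      rw [h', ← hU0]
      change (U * U⁻¹) 0 = _
      rw [mul_nonsing_inv _ hU]
      ext j
      simp [one_apply, Pi.single_apply, eq_comm])
    refine ⟨V, ?_, by rw [← hV, nonsing_inv_mul_cancel_right _ _ hU], hVb⟩
    rw [← det_oneAdd, ← hV, det_mul]
    exact U'.2.1.mul (isUnit_det_inv hU)
  refine ⟨b, (gram_uni b).autC_pos.ne', ?_, ?_⟩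
  · symm
    refine Nat.card_congr (Equiv.ofBijective (fun V => ⟨⟨oneAdd V.1 * U, ?_, ?_⟩, ?_⟩) ⟨?_, ?_⟩)
    · rw [det_mul, det_oneAdd]; exact V.2.1.mul hU
    · rw [transform_mul, hUH, oneAdd_conjTranspose, oneAdd_mul, oneAdd_mul, V.2.2]
    · refine Subtype.ext ?_
      change oneAdd V.1 0 ᵥ* U = v
      rw [oneAdd_row_zero, single_one_vecMul]
      exact hU0
    · intro V V' h
      have h' : oneAdd V.1 * U = oneAdd V'.1 * U := congrArg (fun t => t.1.1) h
      refine Subtype.ext (oneAdd_injective ?_)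
      rw [← mul_nonsing_inv_cancel_right U (oneAdd V.1) hU, h',
        mul_nonsing_inv_cancel_right _ _ hU]
    · intro ⟨U', h'⟩
      obtain ⟨V, hV, hVU, hVb⟩ := key U' (congrArg Subtype.val h')
      exact ⟨⟨V, hV, hVb⟩, Subtype.ext (Subtype.ext hVU.symm)⟩
  · intro b' hb' U' h'
    obtain ⟨V, hV, -, hVb⟩ := key U' (congrArg Subtype.val h')
    exact hb' (eq_of_iso_gram ⟨V, hV, hVb⟩).symm

lemma Uni.sum_card_trans_left {H : Matrix (Fin n) (Fin n) Eis} (hH : Uni H) :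
    ∑ a : UniClass n, (Nat.card (IsoSet (classGram a) H) : ℚ) / autC (classGram a) = 1 := by
  obtain ⟨a, ha⟩ := hH.exists_iso_gram
  rw [Finset.sum_eq_single a, card_iso ha, div_self (autC_gram_ne_zero a)]
  · intro a' _ ha'
    have : IsEmpty (IsoSet (classGram a') H) :=
      ⟨fun U => ha' (eq_of_iso_gram (Iso.trans ⟨U.1, U.2⟩ ha.symm))⟩
    simp
  · simp

/-- The average number of vectors of norm one is the mass one rank below. -/
theorem avg_rep_one (n : ℕ) : avg (n + 1) (fun H => rep H 1) = avg n fun _ => 1 := by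
  have h1 : ∀ a : UniClass (n + 1), (rep (classGram a) 1 : ℚ) / autC (classGram a) =
      ∑ b : UniClass n, (Nat.card (IsoSet (classGram a) (oneAdd (classGram b))) : ℚ) / autC (classGram a) *
        (1 / autC (classGram b)) := fun a => by
    rw [← (gram_uni a).sum_card_trans_right, Finset.sum_div]
    refine Finset.sum_congr rfl fun b _ => ?_
    ring
  rw [avg, Finset.sum_congr rfl fun a _ => h1 a, Finset.sum_comm, avg]
  refine Finset.sum_congr rfl fun b _ => ?_
  rw [← Finset.sum_mul, (uni_oneAdd_iff.2 (gram_uni b)).sum_card_trans_left, one_mul]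

theorem avg_zero : avg 0 (fun _ => 1) = 1 := by
  have hU : Uni (1 : Matrix (Fin 0) (Fin 0) Eis) := uni_one 0
  have h := hU.sum_card_trans_left
  refine Eq.trans ?_ h
  refine Finset.sum_congr rfl fun a _ => ?_
  have : Nat.card (IsoSet (classGram a) 1) = 1 := by
    refine Nat.card_eq_one_iff_unique.2 ⟨inferInstance, ⟨⟨1, by simp, Subsingleton.elim _ _⟩⟩⟩
  rw [this, Nat.cast_one]

end OneAdd

namespace Eis

lemma three_dvd_root_mul_iff {z : Eis} : 3 ∣ root * z ↔ res z = 0 := by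
  rw [← root_mul_star_root, mul_dvd_mul_iff_left root_ne_zero, star_root, neg_dvd, res_eq_zero_iff]
  rfl

lemma res_three : res 3 = 0 := by
  rw [← root_mul_star_root, map_mul, res_root, zero_mul]

lemma res_eq_zero_of_dvd {z : Eis} (h : 3 ∣ z) : res z = 0 := by
  obtain ⟨w, rfl⟩ := h
  rw [map_mul, res_three, zero_mul]

lemma three_dvd_of_star_eq {z : Eis} (h : star z = z) (h0 : res z = 0) : 3 ∣ z := by
  obtain ⟨k, rfl⟩ := exists_int_of_star_eq h
  rw [res_intCast, ZMod.intCast_zmod_eq_zero_iff_dvd] at h0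
  obtain ⟨l, rfl⟩ := h0
  exact ⟨l, by push_cast; rfl⟩

lemma three_ne_zero' : (3 : Eis) ≠ 0 := by
  rw [← root_mul_star_root]
  exact mul_ne_zero root_ne_zero (by rw [star_root]; exact neg_ne_zero.2 root_ne_zero)

end Eis

open Eis (res root)

section Red

variable {n : ℕ}

/-- Reduction of vectors modulo `√-3`. -/
def red (x : Fin n → Eis) : Fin n → ZMod 3 := fun i => res (x i)

@[simp] lemma red_add (x y : Fin n → Eis) : red (x + y) = red x + red y := by ext; simp [red]

@[simp] lemma red_sub (x y : Fin n → Eis) : red (x - y) = red x - red y := by ext; simp [red]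

@[simp] lemma red_smul (c : Eis) (x : Fin n → Eis) : red (c • x) = res c • red x := by
  ext; simp [red]

@[simp] lemma red_zero : red (0 : Fin n → Eis) = 0 := by ext; simp [red]

lemma red_surjective : Function.Surjective (red (n := n)) := fun x => by
  choose y hy using fun i => Eis.res_surjective (x i)
  exact ⟨y, funext hy⟩

lemma red_eq_zero_iff {x : Fin n → Eis} : red x = 0 ↔ ∃ w, x = root • w := by
  constructor
  · intro h
    choose w hw using fun i => Eis.res_eq_zero_iff.1 (congrFun h i)
    exact ⟨w, funext hw⟩
  · rintro ⟨w, rfl⟩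
    rw [red_smul, Eis.res_root, zero_smul]

lemma red_eq_iff {x y : Fin n → Eis} : red x = red y ↔ ∃ w, x = y + root • w := by
  rw [← sub_eq_zero, ← red_sub, red_eq_zero_iff]
  exact exists_congr fun w => sub_eq_iff_eq_add'

lemma red_vecMul {m : ℕ} (x : Fin m → Eis) (P : Matrix (Fin m) (Fin n) Eis) :
    red (x ᵥ* P) = red x ᵥ* P.map res := by
  ext i
  simp [red, vecMul, dotProduct]

lemma red_mulVec {m : ℕ} (P : Matrix (Fin m) (Fin n) Eis) (x : Fin n → Eis) :
    red (P *ᵥ x) = P.map res *ᵥ red x := by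
  ext i
  simp [red, mulVec, dotProduct]

lemma red_star (x : Fin n → Eis) : red (star x) = red x := by
  ext i
  simp [red, Eis.res_star]

lemma res_hb (H : Matrix (Fin n) (Fin n) Eis) (x y : Fin n → Eis) :
    res (hb H x y) = red x ⬝ᵥ H.map res *ᵥ red y := by
  rw [← red_star y, ← red_mulVec, hb, dotProduct, map_sum]
  simp [red, dotProduct]

end Red

section Neighbour

variable {n : ℕ} {H : Matrix (Fin n) (Fin n) Eis} {x z : Fin n → Eis}

lemma hb_sub_left (H : Matrix (Fin n) (Fin n) Eis) (x y z : Fin n → Eis) :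
    hb H (x - y) z = hb H x z - hb H y z := sub_dotProduct _ _ _

lemma Uni.isUnit_det (hH : Uni H) : IsUnit H.det := by rw [hH.det]; exact isUnit_one

lemma Uni.res_hb_comm (hH : Uni H) (x y : Fin n → Eis) : res (hb H x y) = res (hb H y x) := by
  rw [← hb_star hH.herm, Eis.res_star]

/-- Vectors defining a neighbour at `√-3`. -/
structure IsNbrVec (H : Matrix (Fin n) (Fin n) Eis) (x : Fin n → Eis) : Prop where
  red_ne : red x ≠ 0
  res_eq : res (hb H x x) = 0

lemma IsNbrVec.three_dvd (hH : Uni H) (hx : IsNbrVec H x) : 3 ∣ hb H x x :=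
  Eis.three_dvd_of_star_eq (hb_star hH.herm x x) hx.res_eq

/-- The sublattice `𝓞 x + √-3 {y | h(y, x) ∈ √-3 𝓞}`. -/
def nbr (H : Matrix (Fin n) (Fin n) Eis) (x : Fin n → Eis) : Submodule Eis (Fin n → Eis) where
  carrier := {z | ∃ (c : Eis) (y : Fin n → Eis), z = c • x + root • y ∧ res (hb H y x) = 0}
  zero_mem' := ⟨0, 0, by simp, by simp [hb]⟩
  add_mem' := by
    rintro _ _ ⟨c, y, rfl, h⟩ ⟨c', y', rfl, h'⟩
    exact ⟨c + c', y + y', by module, by rw [hb_add_left, map_add, h, h', add_zero]⟩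
  smul_mem' := by
    rintro a _ ⟨c, y, rfl, h⟩
    exact ⟨a * c, a • y, by module, by rw [hb_smul_left, map_mul, h, mul_zero]⟩

lemma self_mem_nbr (H : Matrix (Fin n) (Fin n) Eis) (x : Fin n → Eis) : x ∈ nbr H x :=
  ⟨1, 0, by simp, by simp [hb]⟩

lemma three_dvd_hb_of_mem_nbr (hH : Uni H) (hx : IsNbrVec H x) {u v : Fin n → Eis}
    (hu : u ∈ nbr H x) (hv : v ∈ nbr H x) : 3 ∣ hb H u v := by
  obtain ⟨c, y, rfl, h⟩ := hu
  obtain ⟨c', y', rfl, h'⟩ := hv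
  simp only [hb_add_left, hb_add_right, hb_smul_left, hb_smul_right]
  rw [hH.res_hb_comm] at h'
  have h1 := Eis.three_dvd_root_mul_iff.2 h
  have h2 := Eis.three_dvd_root_mul_iff.2 h'
  have h3 := hx.three_dvd hH
  have h4 : (3 : Eis) ∣ root * (star root * hb H y y') := ⟨hb H y y', by
    rw [← mul_assoc, Eis.root_mul_star_root]⟩
  have e : c * (star c' * hb H x x + star root * hb H x y') +
      root * (star c' * hb H y x + star root * hb H y y') =
      c * star c' * hb H x x + star c' * (root * hb H y x) + -c * (root * hb H x y') +
        root * (star root * hb H y y') := by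
    rw [Eis.star_root]; ring
  convert dvd_add (dvd_add (dvd_add (h3.mul_left (c * star c')) (h1.mul_left (star c')))
    (h2.mul_left (-c))) h4 using 1
  rw [← e]
  ring

lemma mem_nbr_iff (hH : Uni H) (hx : IsNbrVec H x) :
    z ∈ nbr H x ↔ (∃ c : ZMod 3, red z = c • red x) ∧ 3 ∣ hb H z x := by
  refine ⟨fun h => ⟨?_, three_dvd_hb_of_mem_nbr hH hx h (self_mem_nbr H x)⟩, ?_⟩
  · obtain ⟨c, y, rfl, -⟩ := h
    exact ⟨res c, by simp [Eis.res_root]⟩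
  · rintro ⟨⟨c, hc⟩, h⟩
    obtain ⟨c, rfl⟩ := Eis.res_surjective c
    rw [← red_smul, red_eq_iff] at hc
    obtain ⟨y, rfl⟩ := hc
    refine ⟨c, y, rfl, ?_⟩
    rw [hb_add_left, hb_smul_left, hb_smul_left] at h
    exact Eis.three_dvd_root_mul_iff.1 ((dvd_add_right ((hx.three_dvd hH).mul_left c)).1 h)

lemma nbr_eq_of_mem (hH : Uni H) (hx : IsNbrVec H x) (hz : z ∈ nbr H x) (h0 : red z ≠ 0) :
    IsNbrVec H z ∧ nbr H z = nbr H x := by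
  have key : ∀ {x z : Fin n → Eis}, IsNbrVec H x → z ∈ nbr H x → red z ≠ 0 →
      IsNbrVec H z ∧ nbr H x ≤ nbr H z := by
    intro x z hx hz h0
    have hz' : IsNbrVec H z :=
      ⟨h0, Eis.res_eq_zero_of_dvd (three_dvd_hb_of_mem_nbr hH hx hz hz)⟩
    refine ⟨hz', fun u hu => (mem_nbr_iff hH hz').2 ⟨?_, three_dvd_hb_of_mem_nbr hH hx hu hz⟩⟩
    obtain ⟨c, hc⟩ := ((mem_nbr_iff hH hx).1 hz).1
    obtain ⟨d, hd⟩ := ((mem_nbr_iff hH hx).1 hu).1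
    have hc0 : c ≠ 0 := by rintro rfl; simp at hc; exact h0 hc
    exact ⟨d * c⁻¹, by rw [hc, hd, smul_smul, mul_assoc, inv_mul_cancel₀ hc0, mul_one]⟩
  obtain ⟨h1, h2⟩ := key hx hz h0
  exact ⟨h1, le_antisymm (key h1 (h2 (self_mem_nbr H x)) hx.red_ne).2 h2⟩

lemma Uni.red_eq_zero (hH : Uni H) {w : Fin n → Eis} (h : ∀ y, res (hb H w y) = 0) :
    red w = 0 := by
  have h1 : red (w ᵥ* H) = 0 := by
    ext j
    have := h (Pi.single j 1)
    rw [hb, ← Pi.single_star, star_one, mulVec_single_one] at this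
    exact this
  rw [red_eq_zero_iff] at h1 ⊢
  obtain ⟨v, hv⟩ := h1
  refine ⟨v ᵥ* H⁻¹, ?_⟩
  rw [← smul_vecMul, ← hv, vecMul_vecMul, mul_nonsing_inv _ hH.isUnit_det, vecMul_one]

lemma Uni.exists_res_hb_eq_one (hH : Uni H) (h : red x ≠ 0) : ∃ y, res (hb H y x) = 1 := by
  have : ¬ ∀ y, res (hb H x y) = 0 := fun h' => h (hH.red_eq_zero h')
  push Not at this
  obtain ⟨y, hy⟩ := this
  obtain ⟨c, hc⟩ := Eis.res_surjective (res (hb H x y))⁻¹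
  refine ⟨c • y, ?_⟩
  rw [hb_smul_left, map_mul, hc, hH.res_hb_comm, inv_mul_cancel₀ (by rwa [hH.res_hb_comm])]

lemma mem_nbr_of_dual (hH : Uni H) (hx : IsNbrVec H x) (h : ∀ u ∈ nbr H x, 3 ∣ hb H z u) :
    z ∈ nbr H x := by
  refine (mem_nbr_iff hH hx).2 ⟨?_, h _ (self_mem_nbr H x)⟩
  obtain ⟨y₀, hy₀⟩ := hH.exists_res_hb_eq_one hx.red_ne
  obtain ⟨c, hc⟩ := Eis.res_surjective (res (hb H z y₀))
  refine ⟨res c, ?_⟩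
  rw [← red_smul, ← sub_eq_zero, ← red_sub]
  refine hH.red_eq_zero fun y => ?_
  obtain ⟨s, hs⟩ := Eis.res_surjective (res (hb H y x))
  have h1 := h (root • (y - s • y₀)) ⟨0, y - s • y₀, by simp, by
    rw [hb_sub_left, hb_smul_left, map_sub, map_mul, hy₀, hs, mul_one, sub_self]⟩
  rw [hb_smul_right, Eis.star_root, neg_mul, dvd_neg, Eis.three_dvd_root_mul_iff,
    hH.res_hb_comm, hb_sub_left, hb_smul_left, map_sub, map_mul, hs,
    hH.res_hb_comm y₀, ← hc, hH.res_hb_comm y z] at h1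
  rw [hb_sub_left, hb_smul_left, map_sub, map_mul, hH.res_hb_comm x y, mul_comm]
  exact h1

lemma exists_range_eq (N : Submodule Eis (Fin n → Eis)) (hN : ∀ v, (3 : Eis) • v ∈ N) :
    ∃ P A : Matrix (Fin n) (Fin n) Eis, LinearMap.range P.vecMulLinear = N ∧
      A * P = (3 : Eis) • 1 := by
  obtain ⟨m, b⟩ := Submodule.basisOfPid (Pi.basisFun Eis (Fin n)) N
  obtain rfl : m = n := by
    have hb := Module.finrank_eq_card_basis b
    rw [Fintype.card_fin] at hb
    have h1 := LinearMap.finrank_le_finrank_of_injective (f := N.subtype) N.subtype_injective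
    have h2 := LinearMap.finrank_le_finrank_of_injective
      (f := LinearMap.codRestrict N (LinearMap.lsmul Eis (Fin n → Eis) 3) hN) (fun u v h => by
        have : (3 : Eis) • u = (3 : Eis) • v := congrArg Subtype.val h
        exact smul_right_injective _ Eis.three_ne_zero' this)
    rw [Module.finrank_fintype_fun_eq_card, Fintype.card_fin] at h1 h2
    omega
  have hmem : ∀ z ∈ N, ∃ y : Fin m → Eis, y ᵥ* Matrix.of (fun i => (b i : Fin m → Eis)) = z := by
    intro z hz
    refine ⟨b.repr ⟨z, hz⟩, ?_⟩
    have := congrArg Subtype.val (b.sum_repr ⟨z, hz⟩)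
    rw [vecMul_eq_sum]
    simp only [AddSubmonoidClass.coe_finsetSum, Submodule.coe_smul] at this
    exact this
  choose! y hy using hmem
  refine ⟨Matrix.of fun i => (b i : Fin m → Eis),
    Matrix.of fun i => y ((3 : Eis) • Pi.single i 1), ?_, ?_⟩
  · ext z
    rw [LinearMap.mem_range]
    refine ⟨?_, fun hz => ⟨y z, hy z hz⟩⟩
    rintro ⟨u, rfl⟩
    rw [vecMulLinear_apply, vecMul_eq_sum]
    exact N.sum_mem fun i _ => N.smul_mem _ (b i).2
  · refine Matrix.ext fun i j => ?_
    have := congrFun (hy _ (hN (Pi.single i 1))) j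
    change (y ((3 : Eis) • Pi.single i 1) ᵥ* Matrix.of (fun i => (b i : Fin m → Eis))) j = _
    rw [this]
    simp [one_apply, Pi.single_apply, eq_comm]

end Neighbour

section NbrMat

variable {n : ℕ} {H H' : Matrix (Fin n) (Fin n) Eis} {x : Fin n → Eis}

lemma det_ne_zero_of_mul_eq_three {A P : Matrix (Fin n) (Fin n) Eis}
    (h : A * P = (3 : Eis) • 1) : A.det ≠ 0 ∧ P.det ≠ 0 := by
  have := congrArg det h
  rw [det_mul, det_smul, det_one, mul_one] at this
  exact mul_ne_zero_iff.1 (this ▸ pow_ne_zero _ Eis.three_ne_zero')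

lemma mul_comm_eq_three {A P : Matrix (Fin n) (Fin n) Eis} (h : A * P = (3 : Eis) • 1) :
    P * A = (3 : Eis) • 1 := by
  have hA := (det_ne_zero_of_mul_eq_three h).1
  have e : A * (P * A - (3 : Eis) • 1) = 0 := by
    rw [Matrix.mul_sub, ← Matrix.mul_assoc, h]
    simp
  have : A.adjugate * A * (P * A - (3 : Eis) • 1) = 0 := by
    rw [Matrix.mul_assoc, e, Matrix.mul_zero]
  rw [adjugate_mul, smul_mul, Matrix.one_mul, smul_eq_zero] at this
  exact sub_eq_zero.1 (this.resolve_left hA)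

lemma eq_of_mul_right_eq {l : ℕ} {P : Matrix (Fin n) (Fin n) Eis} (hP : P.det ≠ 0)
    {A B : Matrix (Fin l) (Fin n) Eis} (h : A * P = B * P) : A = B := by
  have h2 := congrArg (· * P.adjugate) h
  simp only [Matrix.mul_assoc, mul_adjugate, Matrix.mul_smul, Matrix.mul_one] at h2
  exact smul_right_injective _ hP h2

lemma vecMul_injective_of_det {P : Matrix (Fin n) (Fin n) Eis} (hP : P.det ≠ 0)
    {u v : Fin n → Eis} (h : u ᵥ* P = v ᵥ* P) : u = v := by
  rw [← sub_eq_zero, ← sub_vecMul] at h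
  exact sub_eq_zero.1 (eq_zero_of_vecMul_eq_zero hP h)

lemma hb_smul_form (c : Eis) (u v : Fin n → Eis) : hb (c • H) u v = c * hb H u v := by
  rw [hb, smul_mulVec, dotProduct_smul, smul_eq_mul]
  rfl

lemma det_eq_one_of_isUnit (hH : Hᴴ = H) (hpos : (toM H).PosDef) (hU : IsUnit H.det) :
    H.det = 1 := by
  obtain ⟨k, hk⟩ := Eis.exists_int_of_star_eq (z := H.det) (by rw [← det_conjTranspose, hH])
  have h1 := hpos.det_pos
  rw [det_toM, hk, Eis.coe_intCast] at h1
  have h2 : 0 < k := by exact_mod_cast h1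
  have h3 := Eis.normSq_of_isUnit hU
  rw [hk, Eis.coe_intCast, ← Complex.ofReal_intCast, Complex.normSq_ofReal] at h3
  have h4 : k * k = 1 := by exact_mod_cast h3
  have : k = 1 := by nlinarith
  rw [hk, this, Int.cast_one]

/-- A basis of a neighbour has Gram matrix three times a unimodular one. -/
lemma exists_uni_of_range_eq (hH : Uni H) (hx : IsNbrVec H x) {P A : Matrix (Fin n) (Fin n) Eis}
    (hP : LinearMap.range P.vecMulLinear = nbr H x) (hA : A * P = (3 : Eis) • 1) :
    ∃ K, Uni K ∧ P * H * Pᴴ = (3 : Eis) • K := by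
  obtain ⟨-, hP0⟩ := det_ne_zero_of_mul_eq_three hA
  have hmem : ∀ i, P i ∈ nbr H x := fun i => by
    rw [← hP]
    exact ⟨Pi.single i 1, by rw [vecMulLinear_apply, single_one_vecMul]; rfl⟩
  choose K hK using fun i j => three_dvd_hb_of_mem_nbr hH hx (hmem i) (hmem j)
  have hPK : P * H * Pᴴ = (3 : Eis) • (Matrix.of K) := by
    ext i j
    rw [conj_apply, hK]
    rfl
  have hherm : (Matrix.of K)ᴴ = Matrix.of K := by
    refine smul_right_injective _ Eis.three_ne_zero' ?_
    change (3 : Eis) • (Matrix.of K)ᴴ = (3 : Eis) • Matrix.of K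
    rw [← hPK, ← star_ofNat (R := Eis) 3, ← conjTranspose_smul, ← hPK]
    simp [conjTranspose_mul, hH.herm, Matrix.mul_assoc]
  have hpos : (toM (Matrix.of K)).PosDef := by
    have h1 := posDef_conj hP0 hH.pos
    rw [← toM_conjTranspose, ← toM_mul, ← toM_mul, hPK] at h1
    have h2 : toM ((3 : Eis) • Matrix.of K) = (3 : ℝ) • toM (Matrix.of K) := by
      refine Matrix.ext fun i j => ?_
      simp only [toM_apply, Matrix.smul_apply, of_apply, smul_eq_mul, Complex.real_smul]
      rfl
    rw [h2] at h1
    have h3 := h1.smul (show (0 : ℝ) < 3⁻¹ by norm_num)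
    rwa [smul_smul, inv_mul_cancel₀ (by norm_num), one_smul] at h3
  refine ⟨Matrix.of K, ⟨hherm, hpos, det_eq_one_of_isUnit hherm hpos ?_⟩, hPK⟩
  have hZ : ∀ i, (Aᴴ * H⁻¹) i ∈ LinearMap.range P.vecMulLinear := fun i => by
    rw [hP]
    refine mem_nbr_of_dual hH hx fun u hu => ?_
    rw [← hP] at hu
    obtain ⟨y, rfl⟩ := hu
    rw [vecMulLinear_apply, hb, star_vecMul, mulVec_mulVec, dotProduct_mulVec]
    change 3 ∣ ((Aᴴ * H⁻¹) * (H * Pᴴ)) i ⬝ᵥ star y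
    rw [← Matrix.mul_assoc, nonsing_inv_mul_cancel_right _ _ hH.isUnit_det, ← conjTranspose_mul,
      mul_comm_eq_three hA, conjTranspose_smul, star_ofNat, conjTranspose_one]
    change 3 ∣ ((3 : Eis) • (1 : Matrix (Fin n) (Fin n) Eis) i) ⬝ᵥ star y
    rw [smul_dotProduct]
    exact ⟨_, rfl⟩
  choose W hW using hZ
  have hW' : Matrix.of W * P = Aᴴ * H⁻¹ := by
    ext i j
    exact congrArg Subtype.val (congrFun (hW i) j)
  have h3 : Matrix.of W * ((3 : Eis) • Matrix.of K) = (3 : Eis) • 1 := by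
    rw [← hPK, ← Matrix.mul_assoc, ← Matrix.mul_assoc, hW',
      nonsing_inv_mul_cancel_right _ _ hH.isUnit_det, ← conjTranspose_mul,
      mul_comm_eq_three hA, conjTranspose_smul, star_ofNat, conjTranspose_one]
  rw [Matrix.mul_smul] at h3
  have h4 : Matrix.of W * Matrix.of K = 1 := smul_right_injective _ Eis.three_ne_zero' h3
  exact (Matrix.isUnit_det_of_left_inverse h4)

/-- Matrices whose rows span a neighbour of `H` isometric to `H'`. -/
abbrev NbrMat (H H' : Matrix (Fin n) (Fin n) Eis) : Type :=
  {P : Matrix (Fin n) (Fin n) Eis // P * H * Pᴴ = (3 : Eis) • H' ∧ P.map res ≠ 0 ∧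
    ∃ u w, P.map res = vecMulVec u w}

lemma finite_nbrMat (hH : Uni H) (H' : Matrix (Fin n) (Fin n) Eis) : Finite (NbrMat H H') :=
  ((hH.finite_conj ((3 : Eis) • H')).subset fun _ h => h.1).to_subtype

lemma NbrMat.mul_eq (hH' : Uni H') (P : NbrMat H H') :
    (H * P.1ᴴ * H'⁻¹) * P.1 = (3 : Eis) • 1 ∧ P.1 * (H * P.1ᴴ * H'⁻¹) = (3 : Eis) • 1 := by
  have h : P.1 * (H * P.1ᴴ * H'⁻¹) = (3 : Eis) • 1 := by
    rw [← Matrix.mul_assoc, ← Matrix.mul_assoc, P.2.1, smul_mul, mul_nonsing_inv _ hH'.isUnit_det]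
  exact ⟨mul_comm_eq_three h, h⟩

/-- Passing to the inverse neighbour relation. -/
def NbrMat.symm (hH : Uni H) (hH' : Uni H') (P : NbrMat H H') : NbrMat H' H where
  val := H * P.1ᴴ * H'⁻¹
  property := by
    have hinv : H'⁻¹ᴴ = H'⁻¹ := by rw [conjTranspose_nonsing_inv, hH'.herm]
    obtain ⟨u, w, huw⟩ := P.2.2.2
    have hst : P.1ᴴ.map res = vecMulVec w u := by
      ext i j
      have := congrFun (congrFun huw j) i
      simp only [map_apply, conjTranspose_apply, Eis.res_star, vecMulVec_apply] at this ⊢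
      rw [this, mul_comm]
    have hmap : (H * P.1ᴴ * H'⁻¹).map res = H.map res * P.1ᴴ.map res * (H'⁻¹).map res := by
      rw [Matrix.map_mul, Matrix.map_mul]
    refine ⟨?_, ?_, H.map res *ᵥ w, u ᵥ* (H'⁻¹).map res, ?_⟩
    · rw [conjTranspose_mul, conjTranspose_mul, conjTranspose_conjTranspose, hH.herm, hinv]
      rw [nonsing_inv_mul_cancel_right _ _ hH'.isUnit_det]
      calc H * P.1ᴴ * (H'⁻¹ * (P.1 * H)) = ((H * P.1ᴴ * H'⁻¹) * P.1) * H := by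
            simp only [Matrix.mul_assoc]
        _ = _ := by rw [(P.mul_eq hH').1, smul_mul, Matrix.one_mul]
    · intro h0
      refine P.2.2.1 ?_
      have e : P.1ᴴ = H⁻¹ * (H * P.1ᴴ * H'⁻¹) * H' := by
        rw [Matrix.mul_assoc H, nonsing_inv_mul_cancel_left _ _ hH.isUnit_det,
          nonsing_inv_mul_cancel_right _ _ hH'.isUnit_det]
      have e2 : P.1ᴴ.map res = 0 := by
        rw [e, Matrix.map_mul, Matrix.map_mul, h0]
        simp
      ext i j
      have := congrFun (congrFun e2 j) i
      simpa [Eis.res_star] using this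
    · rw [hmap, hst, mul_vecMulVec, vecMulVec_mul]

lemma card_nbrMat_symm (hH : Uni H) (hH' : Uni H') :
    Nat.card (NbrMat H H') = Nat.card (NbrMat H' H) := by
  have key : ∀ {H H' : Matrix (Fin n) (Fin n) Eis} (hH : Uni H) (hH' : Uni H') (P : NbrMat H H'),
      NbrMat.symm hH' hH (NbrMat.symm hH hH' P) = P := by
    intro H H' hH hH' P
    refine Subtype.ext ?_
    change H' * (H * P.1ᴴ * H'⁻¹)ᴴ * H⁻¹ = P.1
    have hinv : H'⁻¹ᴴ = H'⁻¹ := by rw [conjTranspose_nonsing_inv, hH'.herm]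
    rw [conjTranspose_mul, conjTranspose_mul, conjTranspose_conjTranspose, hH.herm, hinv,
      mul_nonsing_inv_cancel_left _ _ hH'.isUnit_det,
      mul_nonsing_inv_cancel_right _ _ hH.isUnit_det]
  exact Nat.card_congr ⟨NbrMat.symm hH hH', NbrMat.symm hH' hH, key hH hH', key hH' hH⟩

lemma row_mem_range (P : Matrix (Fin n) (Fin n) Eis) (i : Fin n) :
    P i ∈ LinearMap.range P.vecMulLinear :=
  ⟨Pi.single i 1, by rw [vecMulLinear_apply, single_one_vecMul]; rfl⟩

lemma NbrMat.exists_nbr (hH : Uni H) (hH' : Uni H') (P : NbrMat H H') :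
    ∃ x, IsNbrVec H x ∧ LinearMap.range P.1.vecMulLinear = nbr H x := by
  obtain ⟨P, hP, h0, u, w, huw⟩ := P
  have hred : ∀ i, red (P i) = u i • w := fun i => by
    ext j
    exact congrFun (congrFun huw i) j
  have hu : ∃ i, red (P i) ≠ 0 := by
    by_contra! h
    exact h0 (by ext i j; exact congrFun (h i) j)
  obtain ⟨i, hi⟩ := hu
  have hui : u i ≠ 0 := by
    intro h
    rw [hred, h, zero_smul] at hi
    exact hi rfl
  have hdvd : ∀ j k, 3 ∣ hb H (P j) (P k) := fun j k => by
    rw [← conj_apply, hP]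
    exact ⟨_, rfl⟩
  have hx : IsNbrVec H (P i) := ⟨hi, Eis.res_eq_zero_of_dvd (hdvd i i)⟩
  have hle : LinearMap.range P.vecMulLinear ≤ nbr H (P i) := by
    rintro _ ⟨y, rfl⟩
    rw [vecMulLinear_apply, vecMul_eq_sum]
    refine Submodule.sum_mem _ fun j _ => Submodule.smul_mem _ _ ((mem_nbr_iff hH hx).2
      ⟨⟨u j * (u i)⁻¹, ?_⟩, hdvd j i⟩)
    rw [hred j, hred i, smul_smul, inv_mul_cancel_right₀ hui]
  refine ⟨P i, hx, le_antisymm hle fun z hz => ?_⟩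
  have hz3 : ∀ j, 3 ∣ hb H z (P j) := fun j =>
    three_dvd_hb_of_mem_nbr hH hx hz (hle (row_mem_range P j))
  choose r hr using hz3
  have hdet : (H * Pᴴ).det ≠ 0 := by
    have h3 := NbrMat.mul_eq hH' (⟨P, hP, h0, u, w, huw⟩ : NbrMat H H')
    have h4 := (det_ne_zero_of_mul_eq_three h3.1).1
    rw [det_mul] at h4
    exact left_ne_zero_of_mul h4
  refine ⟨r ᵥ* H'⁻¹, vecMul_injective_of_det hdet ?_⟩
  change r ᵥ* H'⁻¹ ᵥ* P ᵥ* (H * Pᴴ) = _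
  rw [vecMul_vecMul, vecMul_vecMul, ← Matrix.mul_assoc P, hP, Matrix.mul_smul,
    nonsing_inv_mul _ hH'.isUnit_det, vecMul_smul, vecMul_one]
  ext j
  have : (z ᵥ* (H * Pᴴ)) j = hb H z (P j) := by
    rw [← vecMul_vecMul, hb, dotProduct_mulVec]
    rfl
  rw [this, hr]
  rfl

lemma nbrMat_of_range_eq (hH : Uni H) (hx : IsNbrVec H x) {P : Matrix (Fin n) (Fin n) Eis}
    (hP : LinearMap.range P.vecMulLinear = nbr H x) :
    P.map res ≠ 0 ∧ ∃ u w, P.map res = vecMulVec u w := by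
  constructor
  · intro h0
    obtain ⟨y, hy⟩ := hP.symm ▸ self_mem_nbr H x
    refine hx.red_ne ?_
    rw [← hy, vecMulLinear_apply, red_vecMul, h0, vecMul_zero]
  · choose u hu using fun i => ((mem_nbr_iff hH hx).1 (hP ▸ row_mem_range P i)).1
    refine ⟨u, red x, ?_⟩
    ext i j
    exact congrFun (hu i) j

end NbrMat

section NbrSum

variable {n : ℕ} {H H' : Matrix (Fin n) (Fin n) Eis} {x : Fin n → Eis}

lemma range_le_of_left_mul (V P : Matrix (Fin n) (Fin n) Eis) :
    LinearMap.range (V * P).vecMulLinear ≤ LinearMap.range P.vecMulLinear := by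
  rintro _ ⟨y, rfl⟩
  exact ⟨y ᵥ* V, by rw [vecMulLinear_apply, vecMulLinear_apply, vecMul_vecMul]⟩

lemma range_unit_mul {V : Matrix (Fin n) (Fin n) Eis} (hV : IsUnit V.det)
    (P : Matrix (Fin n) (Fin n) Eis) :
    LinearMap.range (V * P).vecMulLinear = LinearMap.range P.vecMulLinear := by
  refine le_antisymm (range_le_of_left_mul V P) ?_
  have := range_le_of_left_mul V⁻¹ (V * P)
  rwa [nonsing_inv_mul_cancel_left _ _ hV] at this

lemma exists_mul_eq_of_range_le {P P' : Matrix (Fin n) (Fin n) Eis}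
    (h : LinearMap.range P.vecMulLinear ≤ LinearMap.range P'.vecMulLinear) :
    ∃ V, P = V * P' := by
  choose V hV using fun i => h (row_mem_range P i)
  refine ⟨Matrix.of V, Matrix.ext fun i j => ?_⟩
  exact (congrFun (hV i) j).symm

lemma exists_unit_mul_eq_of_range_eq {P P' : Matrix (Fin n) (Fin n) Eis} (hP : P.det ≠ 0)
    (h : LinearMap.range P.vecMulLinear = LinearMap.range P'.vecMulLinear) :
    ∃ V, IsUnit V.det ∧ P = V * P' := by
  obtain ⟨V, hV⟩ := exists_mul_eq_of_range_le h.le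
  obtain ⟨W, hW⟩ := exists_mul_eq_of_range_le h.ge
  refine ⟨V, ?_, hV⟩
  have h1 : V * W = 1 := by
    refine eq_of_mul_right_eq hP ?_
    rw [Matrix.mul_assoc, ← hW, ← hV, Matrix.one_mul]
  exact Matrix.isUnit_det_of_right_inverse h1

lemma three_smul_mem_nbr (hH : Uni H) (hx : IsNbrVec H x) (v : Fin n → Eis) :
    (3 : Eis) • v ∈ nbr H x := by
  refine (mem_nbr_iff hH hx).2 ⟨⟨0, ?_⟩, ?_⟩
  · rw [red_smul, Eis.res_three, zero_smul, zero_smul]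
  · rw [hb_smul_left]
    exact ⟨_, rfl⟩

/-- The neighbours of `H` at `√-3`. -/
def IsNbr (H : Matrix (Fin n) (Fin n) Eis) (N : Submodule Eis (Fin n → Eis)) : Prop :=
  ∃ x, IsNbrVec H x ∧ N = nbr H x

/-- Vectors of norm `3 m` in neighbours of `H`. -/
abbrev NbrPt (H : Matrix (Fin n) (Fin n) Eis) (m : ℕ) : Type :=
  {p : Submodule Eis (Fin n → Eis) × (Fin n → Eis) //
    IsNbr H p.1 ∧ p.2 ∈ p.1 ∧ hb H p.2 p.2 = ((3 * m : ℕ) : Eis)}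

lemma IsNbr.exists_nbrMat (hH : Uni H) {N : Submodule Eis (Fin n → Eis)} (hN : IsNbr H N) :
    ∃ (b : UniClass n) (P : NbrMat H (classGram b)), LinearMap.range P.1.vecMulLinear = N := by
  obtain ⟨x, hx, rfl⟩ := hN
  obtain ⟨P, A, hP, hA⟩ := exists_range_eq _ (three_smul_mem_nbr hH hx)
  obtain ⟨K, hK, hPK⟩ := exists_uni_of_range_eq hH hx hP hA
  obtain ⟨b, U, hU, hUK⟩ := hK.exists_iso_gram
  have hr := (range_unit_mul (isUnit_det_inv hU) P).trans hP
  refine ⟨b, ⟨U⁻¹ * P, ?_, nbrMat_of_range_eq hH hx hr⟩, hr⟩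
  rw [transform_mul, hPK, Matrix.mul_smul, smul_mul, transform_inv hU hUK]

lemma NbrMat.hb_eq_iff (P : NbrMat H H') (y : Fin n → Eis) (m : ℕ) :
    hb H (y ᵥ* P.1) (y ᵥ* P.1) = ((3 * m : ℕ) : Eis) ↔ hb H' y y = m := by
  rw [← hb_conj, P.2.1, hb_smul_form, Nat.cast_mul]
  exact mul_right_inj' Eis.three_ne_zero'

lemma NbrMat.det_ne_zero (hH' : Uni H') (P : NbrMat H H') : P.1.det ≠ 0 :=
  (det_ne_zero_of_mul_eq_three (P.mul_eq hH').1).2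

/-- The point of a neighbour with given coordinates. -/
def NbrMat.toPt (hH : Uni H) (hH' : Uni H') {m : ℕ}
    (t : NbrMat H H' × {y : Fin n → Eis // hb H' y y = m}) : NbrPt H m where
  val := (LinearMap.range t.1.1.vecMulLinear, t.2.1 ᵥ* t.1.1)
  property := ⟨NbrMat.exists_nbr hH hH' t.1, ⟨t.2.1, rfl⟩, (t.1.hb_eq_iff _ _).2 t.2.2⟩

lemma NbrMat.exists_transform {K : Matrix (Fin n) (Fin n) Eis} (hK : Uni K) (P : NbrMat H K) (P' : NbrMat H H')
    (h : LinearMap.range P.1.vecMulLinear = LinearMap.range P'.1.vecMulLinear) :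
    ∃ V, IsUnit V.det ∧ P.1 = V * P'.1 ∧ V * H' * Vᴴ = K := by
  obtain ⟨V, hV, hPV⟩ := exists_unit_mul_eq_of_range_eq (P.det_ne_zero hK) h
  refine ⟨V, hV, hPV, smul_right_injective _ Eis.three_ne_zero' ?_⟩
  change (3 : Eis) • (V * H' * Vᴴ) = (3 : Eis) • K
  rw [← P.2.1, hPV, transform_mul, P'.2.1, Matrix.mul_smul, smul_mul]

lemma sum_nbrMat_rep (hH : Uni H) (m : ℕ) :
    ∑ b : UniClass n, (Nat.card (NbrMat H (classGram b)) * rep (classGram b) m : ℚ) /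
      autC (classGram b) = Nat.card (NbrPt H m) := by
  have hfin : ∀ b : UniClass n,
      Finite (NbrMat H (classGram b) × {y : Fin n → Eis // hb (classGram b) y y = m}) := fun b => by
    have := finite_nbrMat hH (classGram b)
    have := (gram_uni b).finite_norm m
    infer_instance
  rw [← sum_card_div
    (fun b : UniClass n => NbrMat H (classGram b) × {y : Fin n → Eis // hb (classGram b) y y = m})
    (fun b => autC (classGram b)) (fun b => NbrMat.toPt hH (gram_uni b)) ?_]
  · refine Finset.sum_congr rfl fun b _ => ?_
    rw [Nat.card_prod, Nat.cast_mul]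
    rfl
  rintro ⟨⟨N, z⟩, hN, hz, hzz⟩
  obtain ⟨b, P, rfl⟩ := hN.exists_nbrMat hH
  have hz' : ∃ y, y ᵥ* P.1 = z := hz
  obtain ⟨y, rfl⟩ := hz'
  have hy := (P.hb_eq_iff y m).1 hzz
  refine ⟨b, (gram_uni b).autC_pos.ne', ?_, ?_⟩
  · symm
    refine Nat.card_eq_of_bijective (fun U => ⟨⟨⟨U.1 * P.1, ?_, ?_⟩, y ᵥ* U.1⁻¹, ?_⟩, ?_⟩) ⟨?_, ?_⟩
    · rw [transform_mul, P.2.1, Matrix.mul_smul, smul_mul, U.2.2]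
    · obtain ⟨x, hx, h⟩ := P.exists_nbr hH (gram_uni b)
      exact nbrMat_of_range_eq hH hx ((range_unit_mul U.2.1 P.1).trans h)
    · rw [← hb_conj, transform_inv U.2.1 U.2.2, hy]
    · refine Subtype.ext (Prod.ext (range_unit_mul U.2.1 P.1) ?_)
      change y ᵥ* U.1⁻¹ ᵥ* (U.1 * P.1) = y ᵥ* P.1
      rw [vecMul_vecMul, nonsing_inv_mul_cancel_left _ _ U.2.1]
    · intro U U' h
      have h1 : U.1 * P.1 = U'.1 * P.1 := congrArg (fun t => t.1.1.1) h
      exact Subtype.ext (eq_of_mul_right_eq (P.det_ne_zero (gram_uni b)) h1)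
    · rintro ⟨⟨Q, v⟩, h⟩
      have h1 : LinearMap.range Q.1.vecMulLinear = LinearMap.range P.1.vecMulLinear :=
        congrArg (fun t => t.1.1) h
      have h2 : v.1 ᵥ* Q.1 = y ᵥ* P.1 := congrArg (fun t => t.1.2) h
      obtain ⟨V, hV, hQV, hVb⟩ := Q.exists_transform (gram_uni b) P h1
      refine ⟨⟨V, hV, hVb⟩, Subtype.ext (Prod.ext (Subtype.ext hQV.symm) (Subtype.ext ?_))⟩
      change y ᵥ* V⁻¹ = v.1
      refine vecMul_injective_of_det (Q.det_ne_zero (gram_uni b)) ?_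
      rw [h2, hQV, vecMul_vecMul, nonsing_inv_mul_cancel_left _ _ hV]
  · rintro b' hb' ⟨Q, v⟩ h
    have h1 : LinearMap.range Q.1.vecMulLinear = LinearMap.range P.1.vecMulLinear :=
      congrArg (fun t => t.1.1) h
    obtain ⟨V, hV, -, hVb⟩ := Q.exists_transform (gram_uni b') P h1
    exact hb' (eq_of_iso_gram ⟨V, hV, hVb⟩).symm

/-- Double counting of neighbours. -/
lemma avg_sum_nbrMat (f : Matrix (Fin n) (Fin n) Eis → ℚ) :
    avg n (fun H => ∑ b : UniClass n, (Nat.card (NbrMat H (classGram b)) * f (classGram b)) /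
      autC (classGram b)) =
    avg n fun H => f H * ∑ b : UniClass n, (Nat.card (NbrMat H (classGram b)) : ℚ) /
      autC (classGram b) := by
  simp only [avg, Finset.sum_div, Finset.mul_sum]
  rw [Finset.sum_comm]
  refine Finset.sum_congr rfl fun b _ => Finset.sum_congr rfl fun a _ => ?_
  rw [card_nbrMat_symm (gram_uni a) (gram_uni b)]
  ring

end NbrSum

section ZModThree

/-- The quadratic character modulo three. -/
def chi (x : ZMod 3) : ℤ := if x = 0 then 0 else if x = 1 then 1 else -1

/-- The deviation of the number of solutions of a diagonal quadratic equation over the field with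
three elements from its mean, scaled by three. -/
def gaussTerm : ℕ → ZMod 3 → ℤ
  | 0, t => if t = 0 then 2 else -1
  | 1, t => 3 * chi t
  | n + 2, t => -3 * gaussTerm n t

lemma gaussTerm_succ : ∀ (n : ℕ) {q : ZMod 3}, q ≠ 0 → ∀ t : ZMod 3,
    gaussTerm (n + 1) t = chi q * (gaussTerm n t + 2 * gaussTerm n (t - q))
  | 0, q => by unfold gaussTerm; revert q; decide
  | 1, q => by unfold gaussTerm gaussTerm; revert q; decide
  | n + 2, _ => fun hq t => by
    have := gaussTerm_succ n hq t
    simp only [gaussTerm] at this ⊢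
    rw [this]
    ring

lemma sum_sq_zmod_three {q : ZMod 3} (f : ZMod 3 → ℤ) :
    ∑ a : ZMod 3, f (q * a ^ 2) = f 0 + 2 * f q := by
  have hu : (Finset.univ : Finset (ZMod 3)) = {0, 1, 2} := by decide
  rw [hu, Finset.sum_insert (by decide), Finset.sum_insert (by decide), Finset.sum_singleton,
    show (2 : ZMod 3) ^ 2 = 1 by decide, one_pow, zero_pow two_ne_zero, mul_zero, mul_one]
  ring

variable {n : ℕ}

/-- The bilinear form with Gram matrix `S`. -/
def bil (S : Matrix (Fin n) (Fin n) (ZMod 3)) (x y : Fin n → ZMod 3) : ZMod 3 := x ⬝ᵥ S *ᵥ y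

lemma bil_add_left (S : Matrix (Fin n) (Fin n) (ZMod 3)) (x y z : Fin n → ZMod 3) :
    bil S (x + y) z = bil S x z + bil S y z := add_dotProduct _ _ _

lemma bil_smul_left (S : Matrix (Fin n) (Fin n) (ZMod 3)) (c : ZMod 3) (x z : Fin n → ZMod 3) :
    bil S (c • x) z = c * bil S x z := smul_dotProduct _ _ _

lemma bil_comm {S : Matrix (Fin n) (Fin n) (ZMod 3)} (hS : Sᵀ = S) (x y : Fin n → ZMod 3) :
    bil S x y = bil S y x := by
  rw [bil, bil, dotProduct_comm, ← vecMul_transpose, hS, dotProduct_mulVec]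

lemma bil_transform {m : ℕ} (S : Matrix (Fin n) (Fin n) (ZMod 3)) (U : Matrix (Fin m) (Fin n) (ZMod 3))
    (x y : Fin m → ZMod 3) : bil S (x ᵥ* U) (y ᵥ* U) = bil (U * S * Uᵀ) x y := by
  rw [bil, bil, ← mulVec_mulVec, ← mulVec_mulVec, dotProduct_mulVec x, mulVec_transpose]

lemma transform_apply (S : Matrix (Fin n) (Fin n) (ZMod 3)) {m : ℕ}
    (U : Matrix (Fin m) (Fin n) (ZMod 3)) (i j : Fin m) :
    (U * S * Uᵀ) i j = bil S (U i) (U j) := by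
  rw [Matrix.mul_assoc, mul_apply_eq_vecMul, vecMul, bil]
  rfl

/-- Splitting off an anisotropic vector. -/
lemma exists_split {S : Matrix (Fin (n + 1)) (Fin (n + 1)) (ZMod 3)} (hS : Sᵀ = S)
    {v : Fin (n + 1) → ZMod 3} (hv : bil S v v ≠ 0) :
    ∃ (K : Matrix (Fin n) (Fin n) (ZMod 3)) (e : ZMod 3 × (Fin n → ZMod 3) ≃ (Fin (n + 1) → ZMod 3)),
      Kᵀ = K ∧ K.det = bil S v v * S.det ∧
      (∀ p, bil S (e p) (e p) = bil S v v * p.1 ^ 2 + bil K p.2 p.2) ∧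
      ∀ p, bil S (e p) v = bil S v v * p.1 := by
  have hcases : ∀ x : ZMod 3, x ≠ 0 → x * x = 1 := by decide
  obtain ⟨U, hU, hU0, hUs⟩ := exists_isUnit_det_row v
    (φ := { toFun x := bil S v v * bil S x v
            map_add' x y := by rw [bil_add_left, mul_add]
            map_smul' c x := by rw [bil_smul_left, RingHom.id_apply, smul_eq_mul]; ring })
    (hcases _ hv)
  replace hUs : ∀ i : Fin n, bil S (U i.succ) v = 0 := fun i =>
    (mul_eq_zero.1 (hUs i)).resolve_left hv
  set M := U * S * Uᵀ with hM
  have hMt : Mᵀ = M := by simp [hM, transpose_mul, hS, Matrix.mul_assoc]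
  have h00 : M 0 0 = bil S v v := by rw [hM, transform_apply, hU0]
  have h10 : ∀ i : Fin n, M i.succ 0 = 0 := fun i => by rw [hM, transform_apply, hU0, hUs]
  have h01 : ∀ i : Fin n, M 0 i.succ = 0 := fun i => by rw [← h10 i, ← hMt, transpose_apply, hMt]
  have e0 : ∀ (a : ZMod 3) (w : Fin n → ZMod 3),
      bil M (vecCons a w) (vecCons a w) = bil S v v * a ^ 2 + bil (M.submatrix Fin.succ Fin.succ) w w := by
    intro a w
    simp only [bil, dotProduct, mulVec, Fin.sum_univ_succ, cons_val_zero, cons_val_succ, h00, h01,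
      h10, zero_mul, Finset.sum_const_zero, add_zero, zero_add, submatrix_apply]
    ring
  let e : ZMod 3 × (Fin n → ZMod 3) ≃ (Fin (n + 1) → ZMod 3) :=
    { toFun p := vecCons p.1 p.2 ᵥ* U
      invFun x := ((x ᵥ* U⁻¹) 0, fun i => (x ᵥ* U⁻¹) i.succ)
      left_inv p := by
        simp only [vecMul_vecMul, mul_nonsing_inv _ hU, vecMul_one]
        rfl
      right_inv x := by
        have : vecCons ((x ᵥ* U⁻¹) 0) (fun i => (x ᵥ* U⁻¹) i.succ) = x ᵥ* U⁻¹ :=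
          cons_head_tail (x ᵥ* U⁻¹)
        simp only [this, vecMul_vecMul, nonsing_inv_mul _ hU, vecMul_one] }
  refine ⟨M.submatrix Fin.succ Fin.succ, e, by rw [transpose_submatrix, hMt], ?_, ?_, ?_⟩
  · have h1 : M.det = bil S v v * (M.submatrix Fin.succ Fin.succ).det := by
      rw [det_succ_row_zero, Fin.sum_univ_succ]
      simp [h00, h01]
    have h2 : M.det = S.det := by
      rw [hM, det_mul, det_mul, det_transpose, mul_right_comm, hcases _ hU.ne_zero, one_mul]
    rw [← h2, h1, ← mul_assoc, hcases _ hv, one_mul]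
  · intro p
    change bil S (vecCons p.1 p.2 ᵥ* U) (vecCons p.1 p.2 ᵥ* U) = _
    rw [bil_transform, e0]
  · intro p
    change bil S (vecCons p.1 p.2 ᵥ* U) v = _
    rw [vecMul_eq_sum, Fin.sum_univ_succ, bil_add_left]
    simp only [cons_val_zero, cons_val_succ, bil_smul_left, hU0]
    have : bil S (∑ i : Fin n, p.2 i • U i.succ) v = 0 := by
      rw [bil, sum_dotProduct]
      refine Finset.sum_eq_zero fun i _ => ?_
      have := hUs i
      rw [bil] at this
      rw [smul_dotProduct, this, smul_zero]
    rw [this, add_zero, mul_comm]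

lemma exists_anisotropic {S : Matrix (Fin (n + 1)) (Fin (n + 1)) (ZMod 3)} (hS : Sᵀ = S)
    (hdet : S.det ≠ 0) : ∃ v, bil S v v ≠ 0 := by
  by_contra! h
  refine hdet ?_
  have h0 : S = 0 := by
    ext i j
    have h1 := h (Pi.single i 1 + Pi.single j 1)
    have hadd : ∀ x y, bil S (x + y) (x + y) = bil S x x + bil S y y + 2 * bil S x y := by
      intro x y
      rw [bil_add_left, bil_comm hS x, bil_comm hS y, bil_add_left, bil_add_left, bil_comm hS y x]
      ring
    rw [hadd, h, h, zero_add, zero_add] at h1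
    have h2 := (mul_eq_zero.1 h1).resolve_left (by decide)
    simpa [bil, mulVec_single_one] using h2
  rw [h0, det_zero]

/-- The number of representations of `t` by a quadratic form. -/
def cnt (S : Matrix (Fin n) (Fin n) (ZMod 3)) (t : ZMod 3) : ℤ :=
  ∑ x, if bil S x x = t then 1 else 0

lemma three_mul_cnt : ∀ {n : ℕ} {S : Matrix (Fin n) (Fin n) (ZMod 3)}, Sᵀ = S → S.det ≠ 0 →
    ∀ t, 3 * cnt S t = 3 ^ n + chi S.det * gaussTerm n t
  | 0, S, _, _, t => by
    rw [cnt, Fintype.sum_unique, det_fin_zero]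
    simp only [bil, dotProduct_of_isEmpty, gaussTerm]
    revert t
    decide
  | n + 1, S, hS, hdet, t => by
    obtain ⟨v, hv⟩ := exists_anisotropic hS hdet
    obtain ⟨K, e, hK, hKdet, he, -⟩ := exists_split hS hv
    have ih := three_mul_cnt hK (by rw [hKdet]; exact mul_ne_zero hv hdet)
    have h1 : cnt S t = cnt K t + 2 * cnt K (t - bil S v v) := by
      rw [cnt, ← e.sum_comp, Fintype.sum_prod_type]
      simp only [he]
      have := sum_sq_zmod_three (q := bil S v v) (fun s => cnt K (t - s))
      rw [sub_zero] at this
      rw [← this]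
      refine Finset.sum_congr rfl fun a _ => Finset.sum_congr rfl fun w _ => ?_
      simp only [eq_sub_iff_add_eq, add_comm]
    have h3 : chi S.det = chi K.det * chi (bil S v v) := by
      have : ∀ a b : ZMod 3, a ≠ 0 → chi b = chi (a * b) * chi a := by decide
      rw [hKdet]
      exact this _ _ hv
    rw [h1, mul_add, mul_left_comm, ih, ih, gaussTerm_succ n hv t, h3]
    have h4 : chi (bil S v v) * chi (bil S v v) = 1 := by
      have : ∀ a : ZMod 3, a ≠ 0 → chi a * chi a = 1 := by decide
      exact this _ hv
    linear_combination (-chi K.det * (gaussTerm n t + 2 * gaussTerm n (t - bil S v v))) * h4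

/-- The number of isotropic vectors not orthogonal to a given anisotropic one. -/
lemma three_mul_sum_isotropic {S : Matrix (Fin (n + 1)) (Fin (n + 1)) (ZMod 3)} (hS : Sᵀ = S)
    (hdet : S.det = 1) {v : Fin (n + 1) → ZMod 3} (hv : bil S v v ≠ 0) :
    3 * ∑ x, (if bil S x x = 0 ∧ bil S x v ≠ 0 then 1 else 0 : ℤ) =
      2 * (3 ^ n + chi (bil S v v) * gaussTerm n (-bil S v v)) := by
  have hd0 : S.det ≠ 0 := by rw [hdet]; decide
  obtain ⟨K, e, hK, hKdet, he, he'⟩ := exists_split hS hv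
  have ih := three_mul_cnt hK (by rw [hKdet]; exact mul_ne_zero hv hd0)
  have h1 : ∑ x, (if bil S x x = 0 ∧ bil S x v ≠ 0 then 1 else 0 : ℤ) = 2 * cnt K (-bil S v v) := by
    rw [← e.sum_comp, Fintype.sum_prod_type]
    simp only [he, he']
    have := sum_sq_zmod_three (q := bil S v v) (fun s => if s = 0 then 0 else cnt K (-s))
    rw [if_pos rfl, if_neg hv, zero_add] at this
    rw [← this]
    refine Finset.sum_congr rfl fun a _ => ?_
    by_cases ha : a = 0
    · simp [ha]
    · have h2 : bil S v v * a ≠ 0 := mul_ne_zero hv ha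
      rw [if_neg (mul_ne_zero hv (pow_ne_zero 2 ha)), cnt]
      refine Finset.sum_congr rfl fun w _ => ?_
      simp only [ne_eq, h2, not_false_eq_true, and_true, eq_neg_iff_add_eq_zero, add_comm]
  rw [h1, mul_left_comm, ih, hKdet, hdet, mul_one]

end ZModThree

section LocalCount

variable {n : ℕ} {H : Matrix (Fin n) (Fin n) Eis} {x y : Fin n → Eis}

lemma root_smul_mem_nbr (hH : Uni H) (hx : IsNbrVec H x) :
    root • y ∈ nbr H x ↔ res (hb H y x) = 0 := by
  rw [mem_nbr_iff hH hx, hb_smul_left, Eis.three_dvd_root_mul_iff]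
  exact and_iff_right ⟨0, by rw [red_smul, Eis.res_root, zero_smul, zero_smul]⟩

lemma res_hb_eq_bil (H : Matrix (Fin n) (Fin n) Eis) (x y : Fin n → Eis) :
    res (hb H x y) = bil (H.map res) (red x) (red y) := res_hb H x y

/-- Neighbours containing `√-3 y`. -/
abbrev NbrThrough (H : Matrix (Fin n) (Fin n) Eis) (y : Fin n → Eis) : Type :=
  {N : Submodule Eis (Fin n → Eis) // IsNbr H N ∧ root • y ∈ N}

/-- Isotropic vectors orthogonal to `v`. -/
abbrev Isotropic (S : Matrix (Fin n) (Fin n) (ZMod 3)) (v : Fin n → ZMod 3) : Type :=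
  {x : Fin n → ZMod 3 // x ≠ 0 ∧ bil S x x = 0 ∧ bil S v x = 0}

/-- Neighbours containing `√-3 y` together with a nonzero reduction of one of their members. -/
abbrev NbrFlag (H : Matrix (Fin n) (Fin n) Eis) (y : Fin n → Eis) : Type :=
  {p : Submodule Eis (Fin n → Eis) × (Fin n → ZMod 3) //
    (IsNbr H p.1 ∧ root • y ∈ p.1) ∧ p.2 ≠ 0 ∧ ∃ x ∈ p.1, red x = p.2}

lemma card_nbrFlag_left (hH : Uni H) (y : Fin n → Eis) :
    Nonempty (NbrThrough H y × (ZMod 3)ˣ ≃ NbrFlag H y) := by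
  choose X hX hXN using fun N : NbrThrough H y => N.2.1
  refine ⟨Equiv.ofBijective (fun p => ⟨(p.1.1, (p.2 : ZMod 3) • red (X p.1)), p.1.2,
    smul_ne_zero p.2.ne_zero (hX p.1).red_ne, ?_⟩) ⟨?_, ?_⟩⟩
  · obtain ⟨c, hc⟩ := Eis.res_surjective (p.2 : ZMod 3)
    refine ⟨c • X p.1, Submodule.smul_mem _ _ ?_, by rw [red_smul, hc]⟩
    have := self_mem_nbr H (X p.1)
    rwa [← hXN p.1] at this
  · rintro ⟨N, u⟩ ⟨N', u'⟩ h
    have h1 : N = N' := Subtype.ext (congrArg (fun t => t.1.1) h)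
    subst h1
    have h2 : (u : ZMod 3) • red (X N) = (u' : ZMod 3) • red (X N) := congrArg (fun t => t.1.2) h
    rw [Units.ext (smul_left_injective _ (hX N).red_ne h2)]
  · rintro ⟨⟨N, w⟩, hN, hw, hNw⟩
    obtain ⟨x, hx, rfl⟩ : ∃ x ∈ N, red x = w := hNw
    have hx' : x ∈ nbr H (X ⟨N, hN⟩) := by rwa [← hXN ⟨N, hN⟩]
    obtain ⟨c, hc⟩ := ((mem_nbr_iff hH (hX _)).1 hx').1
    have hc0 : c ≠ 0 := by
      rintro rfl
      exact hw (by simpa using hc)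
    exact ⟨(⟨N, hN⟩, Units.mk0 c hc0), Subtype.ext (Prod.ext rfl hc.symm)⟩

lemma card_nbrFlag_right (hH : Uni H) (y : Fin n → Eis) :
    Nonempty (Isotropic (H.map res) (red y) × ZMod 3 ≃ NbrFlag H y) := by
  choose e he using fun w : Isotropic (H.map res) (red y) => red_surjective w.1
  choose d hd using fun w => hH.exists_res_hb_eq_one (x := e w) (by rw [he]; exact w.2.1)
  choose l hl using Eis.res_surjective
  let X : Isotropic (H.map res) (red y) → ZMod 3 → (Fin n → Eis) :=
    fun w t => e w + root • (l t • d w)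
  have hX : ∀ w t, X w t = e w + root • (l t • d w) := fun _ _ => rfl
  have hred : ∀ w t, red (X w t) = w.1 := fun w t => by
    rw [hX, red_add, red_smul, Eis.res_root, zero_smul, add_zero, he]
  have hnv : ∀ w t, IsNbrVec H (X w t) := fun w t =>
    ⟨by rw [hred]; exact w.2.1, by rw [res_hb_eq_bil, hred]; exact w.2.2.1⟩
  have hdX : ∀ w t, res (hb H (d w) (X w t)) = 1 := fun w t => by
    rw [← hd w, res_hb_eq_bil, res_hb_eq_bil, hred, he]
  refine ⟨Equiv.ofBijective (fun p => ⟨(nbr H (X p.1 p.2), p.1.1), ⟨⟨_, hnv _ _, rfl⟩, ?_⟩,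
    p.1.2.1, _, self_mem_nbr _ _, hred _ _⟩) ⟨?_, ?_⟩⟩
  · rw [root_smul_mem_nbr hH (hnv _ _), res_hb_eq_bil, hred]
    exact p.1.2.2.2
  · rintro ⟨w, t⟩ ⟨w', t'⟩ h
    have h1 : w = w' := Subtype.ext (congrArg (fun t => t.1.2) h)
    subst h1
    have h2 : nbr H (X w t) = nbr H (X w t') := congrArg (fun t => t.1.1) h
    have h3 : X w t' ∈ nbr H (X w t) := h2 ▸ self_mem_nbr H (X w t')
    have h4 := Submodule.sub_mem _ h3 (self_mem_nbr H (X w t))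
    have h5 : X w t' - X w t = root • ((l t' - l t) • d w) := by
      rw [hX, hX]
      module
    rw [h5, root_smul_mem_nbr hH (hnv _ _), hb_smul_left, map_mul, map_sub, hl, hl, hdX, mul_one,
      sub_eq_zero] at h4
    rw [h4]
  · rintro ⟨⟨N, w⟩, ⟨hN, hy⟩, hw, hNw⟩
    obtain ⟨x, hx, rfl⟩ : ∃ x ∈ N, red x = w := hNw
    obtain ⟨x', hx', rfl⟩ : ∃ x, IsNbrVec H x ∧ N = nbr H x := hN
    obtain ⟨hxv, hxn⟩ := nbr_eq_of_mem hH hx' hx hw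
    have hy' : root • y ∈ nbr H x := hxn ▸ hy
    rw [root_smul_mem_nbr hH hxv, res_hb_eq_bil] at hy'
    let w : Isotropic (H.map res) (red y) := ⟨red x, hw, by rw [← res_hb_eq_bil, hxv.res_eq], hy'⟩
    obtain ⟨u, hu⟩ := red_eq_iff.1 (he w).symm
    refine ⟨(w, res (hb H u (e w))), Subtype.ext (Prod.ext ?_ rfl)⟩
    change nbr H (X w _) = nbr H x'
    rw [← hxn]
    refine ((nbr_eq_of_mem hH (hnv _ _) ?_ hw).2).symm
    have h5 : x = X w (res (hb H u (e w))) + root • (u - l (res (hb H u (e w))) • d w) := by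
      rw [hX]
      nth_rw 1 [hu]
      module
    rw [h5]
    refine Submodule.add_mem _ (self_mem_nbr _ _) ((root_smul_mem_nbr hH (hnv _ _)).2 ?_)
    rw [hb_sub_left, hb_smul_left, map_sub, map_mul, hl, hdX, mul_one, sub_eq_zero, res_hb_eq_bil,
      res_hb_eq_bil, hred, he]

lemma finite_nbrThrough (hH : Uni H) (y : Fin n → Eis) : Finite (NbrThrough H y) := by
  obtain ⟨e⟩ := card_nbrFlag_left hH y
  obtain ⟨e'⟩ := card_nbrFlag_right hH y
  exact Finite.of_injective (fun N => e'.symm (e (N, 1))) fun N N' h => by simpa using h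

lemma two_mul_card_nbrThrough (hH : Uni H) (y : Fin n → Eis) :
    2 * Nat.card (NbrThrough H y) = 3 * Nat.card (Isotropic (H.map res) (red y)) := by
  obtain ⟨e⟩ := card_nbrFlag_left hH y
  obtain ⟨e'⟩ := card_nbrFlag_right hH y
  have h := Nat.card_congr (e.trans e'.symm)
  rw [Nat.card_prod, Nat.card_prod, Nat.card_zmod, Nat.card_eq_fintype_card (α := (ZMod 3)ˣ),
    ZMod.card_units_eq_totient] at h
  have : Nat.totient 3 = 2 := by decide
  rw [this] at h
  linarith

/-- Norm `3 m` vectors with nonzero reduction. -/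
abbrev PrimNorm (H : Matrix (Fin n) (Fin n) Eis) (m : ℕ) : Type :=
  {z : Fin n → Eis // hb H z z = ((3 * m : ℕ) : Eis) ∧ red z ≠ 0}

lemma hb_root_smul (H : Matrix (Fin n) (Fin n) Eis) (y : Fin n → Eis) :
    hb H (root • y) (root • y) = 3 * hb H y y := by
  rw [hb_smul_left, hb_smul_right, ← mul_assoc, Eis.root_mul_star_root]

lemma hb_root_smul_eq_iff (H : Matrix (Fin n) (Fin n) Eis) (y : Fin n → Eis) (m : ℕ) :
    hb H (root • y) (root • y) = ((3 * m : ℕ) : Eis) ↔ hb H y y = m := by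
  rw [hb_root_smul, Nat.cast_mul]
  exact mul_right_inj' Eis.three_ne_zero'

lemma root_smul_injective : Function.Injective fun y : Fin n → Eis => root • y :=
  smul_right_injective _ Eis.root_ne_zero

lemma finite_primNorm (hH : Uni H) (m : ℕ) : Finite (PrimNorm H m) := by
  have := hH.finite_norm (3 * m)
  exact Finite.of_injective
    (fun z : PrimNorm H m => (⟨z.1, z.2.1⟩ : {z : Fin n → Eis // hb H z z = ((3 * m : ℕ) : Eis)}))
    fun z z' h => Subtype.ext (congrArg (fun t => t.1) h)

lemma rep_three_mul (hH : Uni H) (m : ℕ) :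
    rep H (3 * m) = Nat.card (PrimNorm H m) + rep H m := by
  have := hH.finite_norm m
  have := finite_primNorm hH m
  rw [rep, rep, ← Nat.card_sum]
  symm
  refine Nat.card_eq_of_bijective (Sum.elim (fun z => ⟨z.1, z.2.1⟩)
    (fun y => ⟨root • y.1, (hb_root_smul_eq_iff H y.1 m).2 y.2⟩)) ⟨?_, ?_⟩
  · have hne : ∀ (z : PrimNorm H m) (y : Fin n → Eis), z.1 ≠ root • y := fun z y h =>
      z.2.2 (red_eq_zero_iff.2 ⟨y, h⟩)
    rintro (z | y) (z' | y') h
    · exact congrArg Sum.inl (Subtype.ext (congrArg (fun t => t.1) h))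
    · exact absurd (congrArg (fun t => t.1) h) (hne z _)
    · exact absurd (congrArg (fun t => t.1) h).symm (hne z' _)
    · exact congrArg Sum.inr (Subtype.ext (root_smul_injective (congrArg (fun t => t.1) h)))
  · rintro ⟨z, hz⟩
    by_cases h : red z = 0
    · obtain ⟨y, rfl⟩ := red_eq_zero_iff.1 h
      exact ⟨Sum.inr ⟨y, (hb_root_smul_eq_iff H y m).1 hz⟩, rfl⟩
    · exact ⟨Sum.inl ⟨z, hz, h⟩, rfl⟩

lemma card_nbrPt_equiv (hH : Uni H) (m : ℕ) :
    Nonempty (PrimNorm H m ⊕ (Σ y : {y : Fin n → Eis // hb H y y = m}, NbrThrough H y.1) ≃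
      NbrPt H m) := by
  have hnv : ∀ z : PrimNorm H m, IsNbrVec H z.1 := fun z =>
    ⟨z.2.2, by rw [z.2.1, Nat.cast_mul, map_mul]; exact mul_eq_zero_of_left Eis.res_three _⟩
  refine ⟨Equiv.ofBijective (Sum.elim
    (fun z => ⟨(nbr H z.1, z.1), ⟨_, hnv z, rfl⟩, self_mem_nbr _ _, z.2.1⟩)
    (fun p => ⟨(p.2.1, root • p.1.1), p.2.2.1, p.2.2.2, (hb_root_smul_eq_iff H _ m).2 p.1.2⟩))
    ⟨?_, ?_⟩⟩
  · have hne : ∀ (z : PrimNorm H m) (y : Fin n → Eis), z.1 ≠ root • y := fun z y h =>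
      z.2.2 (red_eq_zero_iff.2 ⟨y, h⟩)
    rintro (z | ⟨y, N⟩) (z' | ⟨y', N'⟩) h
    · exact congrArg Sum.inl (Subtype.ext (congrArg (fun t => t.1.2) h))
    · exact absurd (congrArg (fun t => t.1.2) h) (hne z _)
    · exact absurd (congrArg (fun t => t.1.2) h).symm (hne z' _)
    · have h1 : y = y' := Subtype.ext (root_smul_injective (congrArg (fun t => t.1.2) h))
      subst h1
      have h2 : N = N' := Subtype.ext (congrArg (fun t => t.1.1) h)
      rw [h2]
  · rintro ⟨⟨N, z⟩, hN, hz, hzz⟩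
    by_cases h : red z = 0
    · obtain ⟨y, rfl⟩ := red_eq_zero_iff.1 h
      exact ⟨Sum.inr ⟨⟨y, (hb_root_smul_eq_iff H y m).1 hzz⟩, ⟨N, hN, hz⟩⟩, rfl⟩
    · obtain ⟨x, hx, rfl⟩ : ∃ x, IsNbrVec H x ∧ N = nbr H x := hN
      exact ⟨Sum.inl ⟨z, hzz, h⟩, Subtype.ext (Prod.ext (nbr_eq_of_mem hH hx hz h).2 rfl)⟩

lemma card_nbrPt (hH : Uni H) (m s : ℕ)
    (hs : ∀ y, hb H y y = m → Nat.card (Isotropic (H.map res) (red y)) = s) :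
    2 * Nat.card (NbrPt H m) + 2 * rep H m = 2 * rep H (3 * m) + 3 * s * rep H m := by
  obtain ⟨e⟩ := card_nbrPt_equiv hH m
  have := hH.finite_norm m
  have := finite_primNorm hH m
  have := fun y => finite_nbrThrough hH y
  have := Fintype.ofFinite {y : Fin n → Eis // hb H y y = m}
  have h : 2 * ∑ y : {y : Fin n → Eis // hb H y y = m}, Nat.card (NbrThrough H y.1) =
      3 * s * rep H m := by
    rw [Finset.mul_sum, Finset.sum_congr rfl fun y _ =>
      (two_mul_card_nbrThrough hH y.1).trans (by rw [hs y.1 y.2])]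
    rw [Finset.sum_const, Finset.card_univ, ← Nat.card_eq_fintype_card, rep, smul_eq_mul, mul_comm]
  rw [← Nat.card_congr e, Nat.card_sum, Nat.card_sigma, rep_three_mul hH, ← h]
  ring

lemma card_nbrPt_zero (hH : Uni H) :
    2 * Nat.card (NbrPt H 0) = 3 * Nat.card (Isotropic (H.map res) 0) := by
  have h0 : ∀ z : Fin n → Eis, hb H z z = ((3 * 0 : ℕ) : Eis) → z = 0 := fun z hz => by
    by_contra h
    have := normNat_pos hH h
    rw [(hH.hb_eq_iff z _).1 hz] at this
    omega
  rw [← red_zero, ← two_mul_card_nbrThrough hH 0]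
  congr 1
  refine Nat.card_congr
    { toFun p := ⟨p.1.1, p.2.1, by rw [smul_zero]; exact Submodule.zero_mem _⟩
      invFun N := ⟨(N.1, 0), N.2.1, Submodule.zero_mem _, by simp [hb]⟩
      left_inv p := Subtype.ext (Prod.ext rfl (h0 _ p.2.2.2).symm)
      right_inv _ := rfl }

end LocalCount

section Hecke

variable {n : ℕ}

lemma card_isotropic (S : Matrix (Fin n) (Fin n) (ZMod 3)) (v : Fin n → ZMod 3) :
    (Nat.card (Isotropic S v) : ℤ) = ∑ x, if x ≠ 0 ∧ bil S x x = 0 ∧ bil S v x = 0 then 1 else 0 := by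
  rw [Nat.card_eq_fintype_card, Fintype.card_subtype, Finset.card_filter, Nat.cast_sum]
  simp only [Nat.cast_ite, Nat.cast_one, Nat.cast_zero]

lemma card_isotropic_zero {S : Matrix (Fin n) (Fin n) (ZMod 3)} (hS : Sᵀ = S) (v : Fin n → ZMod 3) :
    (Nat.card (Isotropic S 0) : ℤ) = Nat.card (Isotropic S v) +
      ∑ x, if bil S x x = 0 ∧ bil S x v ≠ 0 then 1 else 0 := by
  rw [card_isotropic, card_isotropic, ← Finset.sum_add_distrib]
  refine Finset.sum_congr rfl fun x _ => ?_
  have h0 : bil S 0 x = 0 := zero_dotProduct _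
  rw [bil_comm hS x v]
  by_cases hx : x = 0
  · subst hx
    have : bil S v 0 = 0 := by rw [bil_comm hS]; exact zero_dotProduct _
    simp [this]
  · by_cases h1 : bil S x x = 0 <;> by_cases h2 : bil S v x = 0 <;> simp [hx, h0, h1, h2]

lemma rep_three_mul_eq {H : Matrix (Fin (n + 1)) (Fin (n + 1)) Eis} (hH : Uni H) {m : ℕ}
    (hm : (m : ZMod 3) ≠ 0) :
    (rep H (3 * m) : ℚ) = Nat.card (NbrPt H m) +
      ((1 + 3 ^ n + chi m * gaussTerm n (-m) : ℤ) : ℚ) * rep H m -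
      rep H m * Nat.card (NbrPt H 0) := by
  have hS : (H.map res)ᵀ = H.map res := by
    refine Matrix.ext fun i j => ?_
    rw [transpose_apply, map_apply, map_apply, ← Eis.res_star, ← conjTranspose_apply, hH.herm]
  have hdet : (H.map res).det = 1 := by
    have := RingHom.map_det res H
    rw [hH.det, map_one] at this
    exact this.symm
  have hs : ∀ y, hb H y y = m → 3 * (Nat.card (Isotropic (H.map res) 0) : ℤ) =
      3 * Nat.card (Isotropic (H.map res) (red y)) +
        2 * (3 ^ n + chi m * gaussTerm n (-m)) := by
    intro y hy
    have hbil : bil (H.map res) (red y) (red y) = m := by rw [← res_hb_eq_bil, hy, map_natCast]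
    have h := three_mul_sum_isotropic hS hdet (v := red y) (by rwa [hbil])
    rw [hbil] at h
    rw [← h, ← mul_add, ← card_isotropic_zero hS]
  have h0 := card_nbrPt_zero hH
  by_cases hy : ∃ y, hb H y y = m
  · obtain ⟨y, hy⟩ := hy
    have h1 := card_nbrPt hH m _ fun z hz => by
      have := hs z hz
      rw [hs y hy] at this
      exact_mod_cast (mul_left_cancel₀ three_ne_zero (add_right_cancel this)).symm
    have h2 := hs y hy
    qify at h0 h1 h2
    push_cast
    linear_combination (-1 / 2 : ℚ) * h1 + (1 / 2 : ℚ) * rep H m * h0 + (1 / 2 : ℚ) * rep H m * h2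
  · have hr : rep H m = 0 := by
      have : IsEmpty {y : Fin (n + 1) → Eis // hb H y y = m} := ⟨fun y => hy ⟨y.1, y.2⟩⟩
      exact Nat.card_of_isEmpty
    have h1 := card_nbrPt hH m 0 fun z hz => absurd ⟨z, hz⟩ hy
    rw [hr] at h1 ⊢
    qify at h1
    push_cast
    linear_combination (-1 / 2 : ℚ) * h1

lemma avg_add (f g : Matrix (Fin n) (Fin n) Eis → ℚ) :
    avg n (fun H => f H + g H) = avg n f + avg n g := by
  simp only [avg, add_div, Finset.sum_add_distrib]

lemma avg_mul_left (c : ℚ) (f : Matrix (Fin n) (Fin n) Eis → ℚ) :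
    avg n (fun H => c * f H) = c * avg n f := by
  simp only [avg, mul_div_assoc, Finset.mul_sum]

lemma avg_congr {f g : Matrix (Fin n) (Fin n) Eis → ℚ} (h : ∀ H, Uni H → f H = g H) :
    avg n f = avg n g :=
  Finset.sum_congr rfl fun c _ => by rw [h _ (gram_uni c)]

lemma rep_zero {H : Matrix (Fin n) (Fin n) Eis} (hH : Uni H) : rep H 0 = 1 := by
  have h0 : ∀ z : Fin n → Eis, hb H z z = ((0 : ℕ) : Eis) → z = 0 := fun z hz => by
    by_contra h
    have := normNat_pos hH h
    rw [(hH.hb_eq_iff z _).1 hz] at this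
    omega
  have : Unique {x : Fin n → Eis // hb H x x = ((0 : ℕ) : Eis)} :=
    ⟨⟨⟨0, by simp [hb]⟩⟩, fun z => Subtype.ext (h0 _ z.2)⟩
  exact Nat.card_unique

lemma avg_card_nbrPt (m : ℕ) :
    avg n (fun H => (Nat.card (NbrPt H m) : ℚ)) =
      avg n fun H => rep H m * (Nat.card (NbrPt H 0) : ℚ) := by
  rw [← avg_congr fun H hH => sum_nbrMat_rep hH m, avg_sum_nbrMat fun H => (rep H m : ℚ)]
  refine avg_congr fun H hH => ?_
  rw [← sum_nbrMat_rep hH 0]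
  simp only [rep_zero (gram_uni _), Nat.cast_one, mul_one]

/-- Averages of representation numbers are eigenvectors of the Hecke operator at `√-3`. -/
theorem avg_rep_three_mul {m : ℕ} (hm : (m : ZMod 3) ≠ 0) :
    avg (n + 1) (fun H => (rep H (3 * m) : ℚ)) =
      ((1 + 3 ^ n + chi m * gaussTerm n (-m) : ℤ) : ℚ) * avg (n + 1) fun H => (rep H m : ℚ) := by
  set c := ((1 + 3 ^ n + chi m * gaussTerm n (-m) : ℤ) : ℚ)
  have h1 : avg (n + 1) (fun H => (rep H (3 * m) : ℚ)) = avg (n + 1) fun H =>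
      (Nat.card (NbrPt H m) + c * rep H m) + (-1) * (rep H m * (Nat.card (NbrPt H 0) : ℚ)) :=
    avg_congr fun H hH => by rw [rep_three_mul_eq hH hm]; ring
  rw [h1, avg_add, avg_add, avg_mul_left, avg_mul_left, avg_card_nbrPt]
  ring

end Hecke

/-! ### The masses in rank at most fifteen -/

section Masses

variable {n : ℕ}

/-- The weighted sum of the theta series of the unimodular lattices of rank `n`. -/
def avgTheta (n : ℕ) : PowerSeries ℂ :=
  ∑ c : UniClass n, (1 / (autC (classGram c) : ℂ)) • theta (classGram c)

/-- The mass of the unimodular lattices of rank `n`. -/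
def mass (n : ℕ) : ℚ := avg n fun _ ↦ 1

lemma isFricke_avgTheta (n : ℕ) : IsFricke n (avgTheta n) := by
  have h0 : IsFricke n 0 := by
    simpa using (isFricke_thetaOne.pow n).smul 0
  exact Finset.sum_induction _ (IsFricke n) (fun _ _ ↦ IsFricke.add) h0
    fun c _ ↦ (gram_uni c).isFricke_theta.smul _

lemma coeff_avgTheta (n m : ℕ) :
    PowerSeries.coeff m (avgTheta n) = ((avg n fun H ↦ (rep H m : ℚ) : ℚ) : ℂ) := by
  simp only [avgTheta, avg, map_sum, Rat.cast_sum, PowerSeries.coeff_smul, theta,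
    PowerSeries.coeff_mk, Rat.cast_div, Rat.cast_natCast, smul_eq_mul]
  exact Finset.sum_congr rfl fun c _ ↦ by ring

lemma coeff_zero_avgTheta (n : ℕ) : PowerSeries.coeff 0 (avgTheta n) = (mass n : ℂ) := by
  rw [coeff_avgTheta, mass, avg_congr fun H hH ↦ by rw [rep_zero hH, Nat.cast_one]]

lemma coeff_one_avgTheta (n : ℕ) : PowerSeries.coeff 1 (avgTheta (n + 1)) = (mass n : ℂ) := by
  rw [coeff_avgTheta, avg_rep_one, mass]

/-- The eigenvalues of the averaged representation numbers. -/
def heckeValue (n m : ℕ) : ℤ := 1 + 3 ^ n + chi m * gaussTerm n (-m)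

lemma coeff_three_mul_avgTheta {m : ℕ} (hm : (m : ZMod 3) ≠ 0) :
    PowerSeries.coeff (3 * m) (avgTheta (n + 1)) =
      heckeValue n m * PowerSeries.coeff m (avgTheta (n + 1)) := by
  rw [coeff_avgTheta, coeff_avgTheta, avg_rep_three_mul hm, heckeValue, Rat.cast_mul,
    Rat.cast_intCast]

/-- The first coefficients of `thetaOne ^ k * cuspSix ^ j`. -/
def basisJet (k j : ℕ) : List ℤ :=
  mulJet (powJet [1, 6, 0, 6, 6, 0, 0] k) (powJet [0, 1, -6, 9, 4, 6, -54] j)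

lemma hasJet_basis (k j : ℕ) : HasJet (thetaOne ^ k * cuspSix ^ j) (basisJet k j) :=
  (hasJet_thetaOne.pow k).mul (hasJet_cuspSix.pow j)

lemma isFricke_basis {k j n : ℕ} (h : k + 6 * j = n) : IsFricke n (thetaOne ^ k * cuspSix ^ j) := by
  have := (isFricke_thetaOne.pow k).mul (isFricke_cuspSix.pow j)
  rwa [one_mul, h] at this

/-- The entries of `basisJet`. -/
def basisCoeff (k j i : ℕ) : ℤ := (basisJet k j).getD i 0

lemma coeff_basis (k j : ℕ) {i : ℕ} (hi : i < 7) :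
    PowerSeries.coeff i (thetaOne ^ k * cuspSix ^ j) = basisCoeff k j i := hasJet_basis k j i hi

lemma mass_of_lt_six (hn : n + 1 < 6) (h0 : basisCoeff (n + 1) 0 0 = 1) :
    mass (n + 1) * basisCoeff (n + 1) 0 1 = mass n := by
  have hF := ((isFricke_avgTheta (n + 1)).add
    ((isFricke_basis (k := n + 1) (j := 0) rfl).smul (-mass (n + 1) : ℂ))).eq_zero (d := 1) (by omega)
  have hc := congrArg (PowerSeries.coeff 1) (hF fun m hm ↦ by
    obtain rfl : m = 0 := by omega
    simp only [map_add, PowerSeries.coeff_smul, smul_eq_mul, coeff_zero_avgTheta,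
      coeff_basis _ _ (show 0 < 7 by norm_num), h0]
    push_cast
    ring)
  simp only [map_add, PowerSeries.coeff_smul, smul_eq_mul, coeff_one_avgTheta, map_zero,
    coeff_basis _ _ (show 1 < 7 by norm_num)] at hc
  have : (mass n : ℂ) + -mass (n + 1) * basisCoeff (n + 1) 0 1 = 0 := hc
  norm_cast at this
  linarith

lemma mass_of_lt_twelve {k : ℕ} (hk : k < 6) (h0 : basisCoeff (k + 6) 0 0 = 1)
    (h10 : basisCoeff k 1 0 = 0) (h11 : basisCoeff k 1 1 = 1) :
    mass (k + 6) * (basisCoeff (k + 6) 0 3 - basisCoeff (k + 6) 0 1 * basisCoeff k 1 3 : ℤ) =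
      mass (k + 5) * (heckeValue (k + 5) 1 - basisCoeff k 1 3 : ℤ) := by
  have hF := (((isFricke_avgTheta (k + 6)).add
    ((isFricke_basis (k := k + 6) (j := 0) rfl).smul (-mass (k + 6) : ℂ))).add
    ((isFricke_basis (k := k) (j := 1) rfl).smul
      (mass (k + 6) * basisCoeff (k + 6) 0 1 - mass (k + 5) : ℂ))).eq_zero (d := 2) (by omega)
  have hc := congrArg (PowerSeries.coeff 3) (hF fun m hm ↦ by
    interval_cases m
    · simp only [map_add, PowerSeries.coeff_smul, smul_eq_mul, coeff_zero_avgTheta,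
        coeff_basis _ _ (show 0 < 7 by norm_num), h0, h10]
      push_cast
      ring
    · simp only [map_add, PowerSeries.coeff_smul, smul_eq_mul, coeff_one_avgTheta (k + 5),
        coeff_basis _ _ (show 1 < 7 by norm_num), h11]
      push_cast
      ring)
  have h3 := coeff_three_mul_avgTheta (n := k + 5) (m := 1) (by decide)
  rw [coeff_one_avgTheta (k + 5)] at h3
  simp only [map_add, PowerSeries.coeff_smul, smul_eq_mul, map_zero, h3,
    coeff_basis _ _ (show 3 < 7 by norm_num)] at hc
  have : ((mass (k + 6) * (basisCoeff (k + 6) 0 3 - basisCoeff (k + 6) 0 1 * basisCoeff k 1 3 : ℤ) :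
      ℚ) : ℂ) = (mass (k + 5) * (heckeValue (k + 5) 1 - basisCoeff k 1 3 : ℤ) : ℚ) := by
    push_cast
    linear_combination -hc
  exact_mod_cast this

lemma mass_of_lt_eighteen {k : ℕ} (hk : k < 6) {D : ℤ}
    (hD : D = basisCoeff k 2 6 - heckeValue (k + 11) 2)
    (h0 : basisCoeff (k + 12) 0 0 = 1)
    (h10 : basisCoeff (k + 6) 1 0 = 0) (h11 : basisCoeff (k + 6) 1 1 = 1)
    (h20 : basisCoeff k 2 0 = 0) (h21 : basisCoeff k 2 1 = 0) (h22 : basisCoeff k 2 2 = 1) :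
    mass (k + 12) *
      ((basisCoeff (k + 12) 0 3 - basisCoeff (k + 12) 0 1 * basisCoeff (k + 6) 1 3) * D +
        (heckeValue (k + 11) 2 *
            (basisCoeff (k + 12) 0 2 - basisCoeff (k + 12) 0 1 * basisCoeff (k + 6) 1 2) -
          basisCoeff (k + 12) 0 6 + basisCoeff (k + 12) 0 1 * basisCoeff (k + 6) 1 6) *
          basisCoeff k 2 3 : ℤ) =
      mass (k + 11) * ((heckeValue (k + 11) 1 - basisCoeff (k + 6) 1 3) * D -
        (heckeValue (k + 11) 2 * basisCoeff (k + 6) 1 2 - basisCoeff (k + 6) 1 6) *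
          basisCoeff k 2 3 : ℤ) := by
  set x := PowerSeries.coeff 2 (avgTheta (k + 12)) with hx
  set c : ℂ := mass (k + 12) * basisCoeff (k + 12) 0 1 - mass (k + 11) with hcdef
  have hF := ((((isFricke_avgTheta (k + 12)).add
    ((isFricke_basis (k := k + 12) (j := 0) rfl).smul (-mass (k + 12) : ℂ))).add
    ((isFricke_basis (k := k + 6) (j := 1) rfl).smul c)).add
    ((isFricke_basis (k := k) (j := 2) rfl).smul
      (mass (k + 12) * basisCoeff (k + 12) 0 2 - c * basisCoeff (k + 6) 1 2 - x))).eq_zero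
      (d := 3) (by omega)
  have hF' := hF fun m hm ↦ by
    interval_cases m
    · simp only [map_add, PowerSeries.coeff_smul, smul_eq_mul, coeff_zero_avgTheta,
        coeff_basis _ _ (show 0 < 7 by norm_num), h0, h10, h20]
      push_cast
      ring
    · simp only [map_add, PowerSeries.coeff_smul, smul_eq_mul, coeff_one_avgTheta (k + 11),
        coeff_basis _ _ (show 1 < 7 by norm_num), h11, h21]
      push_cast
      ring
    · simp only [map_add, PowerSeries.coeff_smul, smul_eq_mul, ← hx,
        coeff_basis _ _ (show 2 < 7 by norm_num), h22]
      push_cast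
      ring
  have hc3 := congrArg (PowerSeries.coeff 3) hF'
  have hc6 := congrArg (PowerSeries.coeff 6) hF'
  have h3 := coeff_three_mul_avgTheta (n := k + 11) (m := 1) (by decide)
  have h6 := coeff_three_mul_avgTheta (n := k + 11) (m := 2) (by decide)
  rw [coeff_one_avgTheta (k + 11)] at h3
  simp only [map_add, PowerSeries.coeff_smul, smul_eq_mul, map_zero, h3,
    coeff_basis _ _ (show 3 < 7 by norm_num)] at hc3
  simp only [map_add, PowerSeries.coeff_smul, smul_eq_mul, map_zero, h6, ← hx,
    coeff_basis _ _ (show 6 < 7 by norm_num)] at hc6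
  have hDc : (D : ℂ) = basisCoeff k 2 6 - heckeValue (k + 11) 2 := by rw [hD]; push_cast; rfl
  rw [← @Rat.cast_inj ℂ]
  push_cast
  rw [hDc]
  linear_combination -(basisCoeff k 2 6 - heckeValue (k + 11) 2 : ℂ) * hc3 +
    (basisCoeff k 2 3 : ℂ) * hc6

lemma mass_five : mass 5 = 1 / 933120 := by
  have h : ∀ m < 5, mass (m + 1) = mass m / (6 * (m + 1)) := fun m hm ↦ by
    have h1 := mass_of_lt_six (n := m) (by omega) (by interval_cases m <;> decide +kernel)
    have h2 : basisCoeff (m + 1) 0 1 = 6 * (m + 1) := by interval_cases m <;> decide +kernel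
    rw [h2] at h1
    rw [← h1]
    push_cast
    field_simp
  rw [h 4 (by norm_num), h 3 (by norm_num), h 2 (by norm_num), h 1 (by norm_num),
    h 0 (by norm_num), mass, avg_zero]
  norm_num

lemma mass_of_lt_twelve_of_eq {k : ℕ} (hk : k < 6) (h0 : basisCoeff (k + 6) 0 0 = 1)
    (h10 : basisCoeff k 1 0 = 0) (h11 : basisCoeff k 1 1 = 1) {u v : ℤ}
    (hu : basisCoeff (k + 6) 0 3 - basisCoeff (k + 6) 0 1 * basisCoeff k 1 3 = u)
    (hv : heckeValue (k + 5) 1 - basisCoeff k 1 3 = v) (hu0 : u ≠ 0) :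
    mass (k + 6) = mass (k + 5) * v / u := by
  have h := mass_of_lt_twelve hk h0 h10 h11
  rw [hu, hv] at h
  rw [← h, mul_div_cancel_right₀ _ (Int.cast_ne_zero.2 hu0)]

lemma mass_eleven : mass 11 = 1494223 / 2068813932134400 := by
  have h6 : mass 6 = mass 5 * (208 : ℤ) / (4032 : ℤ) :=
    mass_of_lt_twelve_of_eq (k := 0) (by decide) (by decide +kernel) (by decide +kernel)
      (by decide +kernel) (by decide +kernel) (by decide +kernel) (by decide)
  have h7 : mass 7 = mass 6 * (784 : ℤ) / (8736 : ℤ) :=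
    mass_of_lt_twelve_of_eq (k := 1) (by decide) (by decide +kernel) (by decide +kernel)
      (by decide +kernel) (by decide +kernel) (by decide +kernel) (by decide)
  have h8 : mass 8 = mass 7 * (2296 : ℤ) / (13440 : ℤ) :=
    mass_of_lt_twelve_of_eq (k := 2) (by decide) (by decide +kernel) (by decide +kernel)
      (by decide +kernel) (by decide +kernel) (by decide +kernel) (by decide)
  have h9 : mass 9 = mass 8 * (6472 : ℤ) / (17712 : ℤ) :=
    mass_of_lt_twelve_of_eq (k := 3) (by decide) (by decide +kernel) (by decide +kernel)
      (by decide +kernel) (by decide +kernel) (by decide +kernel) (by decide)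
  have h10 : mass 10 = mass 9 * (19360 : ℤ) / (21120 : ℤ) :=
    mass_of_lt_twelve_of_eq (k := 4) (by decide) (by decide +kernel) (by decide +kernel)
      (by decide +kernel) (by decide +kernel) (by decide +kernel) (by decide)
  have h11 : mass 11 = mass 10 * (59104 : ℤ) / (23232 : ℤ) :=
    mass_of_lt_twelve_of_eq (k := 5) (by decide) (by decide +kernel) (by decide +kernel)
      (by decide +kernel) (by decide +kernel) (by decide +kernel) (by decide)
  rw [h11, h10, h9, h8, h7, h6, mass_five]
  norm_num

lemma mass_of_lt_eighteen_of_eq {k : ℕ} (hk : k < 6) (h0 : basisCoeff (k + 12) 0 0 = 1)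
    (h10 : basisCoeff (k + 6) 1 0 = 0) (h11 : basisCoeff (k + 6) 1 1 = 1)
    (h20 : basisCoeff k 2 0 = 0) (h21 : basisCoeff k 2 1 = 0) (h22 : basisCoeff k 2 2 = 1)
    {u v : ℤ}
    (hu : (basisCoeff (k + 12) 0 3 - basisCoeff (k + 12) 0 1 * basisCoeff (k + 6) 1 3) *
        (basisCoeff k 2 6 - heckeValue (k + 11) 2) + (heckeValue (k + 11) 2 *
          (basisCoeff (k + 12) 0 2 - basisCoeff (k + 12) 0 1 * basisCoeff (k + 6) 1 2) -
        basisCoeff (k + 12) 0 6 + basisCoeff (k + 12) 0 1 * basisCoeff (k + 6) 1 6) *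
          basisCoeff k 2 3 = u)
    (hv : (heckeValue (k + 11) 1 - basisCoeff (k + 6) 1 3) *
        (basisCoeff k 2 6 - heckeValue (k + 11) 2) -
      (heckeValue (k + 11) 2 * basisCoeff (k + 6) 1 2 - basisCoeff (k + 6) 1 6) *
        basisCoeff k 2 3 = v) (hu0 : u ≠ 0) :
    mass (k + 12) = mass (k + 11) * v / u := by
  have h := mass_of_lt_eighteen hk rfl h0 h10 h11 h20 h21 h22
  rw [hu, hv] at h
  rw [← h, mul_div_cancel_right₀ _ (Int.cast_ne_zero.2 hu0)]

theorem mass_fifteen :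
    mass 15 = 4366489808207046403 / (2 ^ 26 * 3 ^ 21 * 5 ^ 3 * 11) := by
  have h12 : mass 12 = mass 11 * (-31508715520 : ℤ) / (-4092641280 : ℤ) :=
    mass_of_lt_eighteen_of_eq (k := 0) (by decide) (by decide +kernel) (by decide +kernel)
      (by decide +kernel) (by decide +kernel) (by decide +kernel) (by decide +kernel)
      (by decide +kernel) (by decide +kernel) (by decide)
  have h13 : mass 13 = mass 12 * (-282371235328 : ℤ) / (-11121976320 : ℤ) :=
    mass_of_lt_eighteen_of_eq (k := 1) (by decide) (by decide +kernel) (by decide +kernel)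
      (by decide +kernel) (by decide +kernel) (by decide +kernel) (by decide +kernel)
      (by decide +kernel) (by decide +kernel) (by decide)
  have h14 : mass 14 = mass 13 * (-2532579422464 : ℤ) / (-27805080576 : ℤ) :=
    mass_of_lt_eighteen_of_eq (k := 2) (by decide) (by decide +kernel) (by decide +kernel)
      (by decide +kernel) (by decide +kernel) (by decide +kernel) (by decide +kernel)
      (by decide +kernel) (by decide +kernel) (by decide)
  have h15 : mass 15 = mass 14 * (-22866292276480 : ℤ) / (-64996600320 : ℤ) :=
    mass_of_lt_eighteen_of_eq (k := 3) (by decide) (by decide +kernel) (by decide +kernel)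
      (by decide +kernel) (by decide +kernel) (by decide +kernel) (by decide +kernel)
      (by decide +kernel) (by decide +kernel) (by decide)
  rw [h15, h14, h13, h12, mass_eleven]
  norm_num

end Masses

/-! ### Comparison with matrices over the complex numbers -/

section Comparison

variable {n : ℕ}

lemma entriesIn_toM (H : Matrix (Fin n) (Fin n) Eis) : EntriesIn (toM H) := fun i j ↦ (H i j).2

lemma exists_toM_eq {H : Matrix (Fin n) (Fin n) ℂ} (h : EntriesIn H) :
    ∃ K : Matrix (Fin n) (Fin n) Eis, toM K = H :=
  ⟨Matrix.of fun i j ↦ ⟨H i j, h i j⟩, rfl⟩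

lemma inGL_toM {U : Matrix (Fin n) (Fin n) Eis} : InGL (toM U) ↔ IsUnit U.det := by
  constructor
  · rintro ⟨-, V, hV, h, -⟩
    obtain ⟨V, rfl⟩ := exists_toM_eq hV
    rw [← toM_mul, ← toM_one] at h
    exact .of_mul_eq_one V.det (by rw [← det_mul, toM_injective h, det_one])
  · intro hU
    refine ⟨entriesIn_toM U, toM U⁻¹, entriesIn_toM _, ?_, ?_⟩
    · rw [← toM_mul, mul_nonsing_inv _ hU, toM_one]
    · rw [← toM_mul, nonsing_inv_mul _ hU, toM_one]

lemma isUnimodular_toM {H : Matrix (Fin n) (Fin n) Eis} : IsUnimodular (toM H) ↔ Uni H := by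
  constructor
  · rintro ⟨⟨-, hh, hp⟩, hd⟩
    refine ⟨toM_injective (by rw [toM_conjTranspose]; exact hh), hp, ?_⟩
    rw [det_toM] at hd
    exact Eis.coe_injective hd
  · intro h
    refine ⟨⟨entriesIn_toM H, h.pos.1, h.pos⟩, ?_⟩
    rw [det_toM, h.det]
    rfl

lemma toM_transform_eq {U H H' : Matrix (Fin n) (Fin n) Eis} :
    toM U * toM H * (toM U)ᴴ = toM H' ↔ U * H * Uᴴ = H' := by
  rw [← toM_conjTranspose, ← toM_mul, ← toM_mul, toM_injective.eq_iff]

lemma latIsometric_toM {H H' : Matrix (Fin n) (Fin n) Eis} :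
    LatIsometric (toM H) (toM H') ↔ Iso H H' := by
  constructor
  · rintro ⟨U, hU, h⟩
    obtain ⟨U, rfl⟩ := exists_toM_eq hU.1
    exact ⟨U, inGL_toM.1 hU, toM_transform_eq.1 h.symm⟩
  · rintro ⟨U, hU, h⟩
    exact ⟨toM U, inGL_toM.2 hU, (toM_transform_eq.2 h).symm⟩

lemma autCard_toM (H : Matrix (Fin n) (Fin n) Eis) : autCard (toM H) = autC H := by
  refine (Nat.card_congr (Equiv.ofBijective
    (fun U : {U : Matrix (Fin n) (Fin n) Eis // IsUnit U.det ∧ U * H * Uᴴ = H} ↦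
      (⟨toM U.1, inGL_toM.2 U.2.1, toM_transform_eq.2 U.2.2⟩ :
        {U : Matrix (Fin n) (Fin n) ℂ // InGL U ∧ U * toM H * Uᴴ = toM H})) ⟨?_, ?_⟩)).symm
  · exact fun U V h ↦ Subtype.ext (toM_injective (congrArg (fun t ↦ t.1) h))
  · rintro ⟨U, hU, h⟩
    obtain ⟨U, rfl⟩ := exists_toM_eq hU.1
    exact ⟨⟨U, inGL_toM.1 hU, toM_transform_eq.1 h⟩, rfl⟩

end Comparison

/-- The set of isometry classes of unimodular hermitian `𝓞`-lattices of rank 15 is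
finite, and the mass `M₁₅ = Σ 1/|G(L)|` equals `4366489808207046403 / (2²⁶·3²¹·5³·11)`. -/
theorem stmt_15 :
    ∃ (k : ℕ) (L : Fin k → Matrix (Fin 15) (Fin 15) ℂ),
      (∀ a, IsUnimodular (L a)) ∧
      (∀ a b, LatIsometric (L a) (L b) → a = b) ∧
      (∀ H : Matrix (Fin 15) (Fin 15) ℂ, IsUnimodular H → ∃ a, LatIsometric H (L a)) ∧
      ∑ a, (1 : ℚ) / (autCard (L a) : ℚ) =
        4366489808207046403 / (2 ^ 26 * 3 ^ 21 * 5 ^ 3 * 11) := by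
  let e := Fintype.equivFin (UniClass 15)
  refine ⟨Fintype.card (UniClass 15), fun a ↦ toM (classGram (e.symm a)),
    fun a ↦ isUnimodular_toM.2 (gram_uni _),
    fun a b h ↦ e.symm.injective (eq_of_iso_gram (latIsometric_toM.1 h)), fun H hH ↦ ?_, ?_⟩
  · obtain ⟨K, rfl⟩ := exists_toM_eq hH.1.1
    obtain ⟨c, hc⟩ := (isUnimodular_toM.1 hH).exists_iso_gram
    exact ⟨e c, latIsometric_toM.2 (by simpa using hc.symm)⟩
  · simp only [autCard_toM]
    rw [← mass_fifteen, mass, avg]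
    exact Equiv.sum_comp e.symm fun c ↦ (1 : ℚ) / autC (classGram c)
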